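/- arXiv:2006.15046 — 7 statements merged into one kernel-verified Lean document; each statement's English description precedes it below -/
import Mathlib

section
/- Let λ : ℕ → ℝ be strictly increasing with λ k > 0 for all k and λ k → ∞, and let a : ℕ → ℝ satisfy Summable (fun k => |a k|). Suppose there exists k₀ ∈ ℕ such that a k₀ ≠ 0, λ k₀ ≠ 1, and a k = 0 for every k < k₀ with λ k ≠ 1. Let α, α₁ ∈ (0,2) with α ≠ 1 and α₁ ≠ 1, let β, β₁ ∈ (0,1), let T > 0, and assume ∑' k, a k * (λ k)^(-β) ≠ 0 and ∑' k, a k * (λ k)^(-β₁) ≠ 0. If ∑' k, a k * E_{α,1}(-(λ k)^β * t^α) = ∑' k, a k * E_{α₁,1}(-(λ k)^{β₁} * t^{α₁}) for every t ∈ (0,T), then α = α₁ and β = β₁. -/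
/-- The Mittag-Leffler function `E_{α,1}(z) = ∑_{n=0}^∞ z^n / Γ(α n + 1)`. -/
noncomputable def mittagLeffler (α z : ℝ) : ℝ :=
  ∑' n : ℕ, z ^ n / Real.Gamma (α * n + 1)

open MeasureTheory Set Filter Topology

/-- The two-parameter Mittag-Leffler function `E_{α,b}` of a complex variable. -/
noncomputable def mlComplex (α b : ℝ) (z : ℂ) : ℂ :=
  ∑' n : ℕ, z ^ n / (Real.Gamma (α * n + b) : ℂ)

/-- The function `t ↦ t ^ (b - 1) * E_{α,b}(-c t ^ α)`. -/
noncomputable def mlRelax (α b : ℝ) (c : ℂ) (t : ℝ) : ℂ :=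
  ((t ^ (b - 1) : ℝ) : ℂ) * mlComplex α b (-c * ((t ^ α : ℝ) : ℂ))

lemma rpow_mul_exp_neg_le_Gamma {x R : ℝ} (hx : 1 ≤ x) (hR : 0 < R) :
    R ^ (x - 1) * Real.exp (-R) ≤ Real.Gamma x := by
  rw [Real.Gamma_eq_integral (by linarith), ← integral_exp_neg_Ioi R, ← integral_const_mul]
  have hint := Real.GammaIntegral_convergent (s := x) (by linarith)
  calc ∫ t in Ioi R, R ^ (x - 1) * Real.exp (-t)
      ≤ ∫ t in Ioi R, Real.exp (-t) * t ^ (x - 1) := by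
        refine setIntegral_mono_on ((integrableOn_exp_neg_Ioi R).const_mul _)
          (hint.mono_set (Ioi_subset_Ioi hR.le)) measurableSet_Ioi fun t ht => ?_
        rw [mul_comm]
        have : R < t := ht
        gcongr
    _ ≤ ∫ t in Ioi 0, Real.exp (-t) * t ^ (x - 1) := by
        refine setIntegral_mono_set hint ?_ (Ioi_subset_Ioi hR.le).eventuallyLE
        filter_upwards [ae_restrict_mem measurableSet_Ioi] with t ht
        have : (0 : ℝ) < t := ht
        simp only [Pi.zero_apply]
        positivity

lemma summable_pow_div_Gamma {α b : ℝ} (hα : 0 < α) (hb : 1 ≤ b) {r : ℝ} (hr : 0 ≤ r) :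
    Summable fun n : ℕ => r ^ n / Real.Gamma (α * n + b) := by
  set R : ℝ := (2 * (r + 1)) ^ (1 / α) with hRdef
  have hR : 0 < R := by positivity
  have hRα : R ^ α = 2 * (r + 1) := by
    rw [hRdef, ← Real.rpow_mul (by positivity), one_div_mul_cancel hα.ne', Real.rpow_one]
  have hgeo : Summable fun n : ℕ => (Real.exp R / R ^ (b - 1)) * (1 / 2 : ℝ) ^ n :=
    (summable_geometric_of_lt_one (by norm_num) (by norm_num)).mul_left _
  refine hgeo.of_nonneg_of_le (fun n => ?_) (fun n => ?_)
  · have : 0 < Real.Gamma (α * n + b) := Real.Gamma_pos_of_pos (by positivity)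
    positivity
  · have hn : 0 ≤ α * n := by positivity
    have h := rpow_mul_exp_neg_le_Gamma (x := α * n + b) (R := R) (by linarith) hR
    have e : R ^ (α * n + b - 1) = (2 * (r + 1)) ^ n * R ^ (b - 1) := by
      rw [add_sub_assoc, Real.rpow_add hR, Real.rpow_mul hR.le, hRα, Real.rpow_natCast]
    rw [e] at h
    have hpos : 0 < (2 * (r + 1)) ^ n * R ^ (b - 1) * Real.exp (-R) := by positivity
    calc r ^ n / Real.Gamma (α * n + b)
        ≤ (r + 1) ^ n / ((2 * (r + 1)) ^ n * R ^ (b - 1) * Real.exp (-R)) := by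
          gcongr
          linarith
      _ = _ := by
          rw [Real.exp_neg, mul_pow, one_div, inv_pow]
          field_simp

lemma summable_mlComplex {α b : ℝ} (hα : 0 < α) (hb : 1 ≤ b) (z : ℂ) :
    Summable fun n : ℕ => z ^ n / (Real.Gamma (α * n + b) : ℂ) := by
  refine Summable.of_norm ((summable_pow_div_Gamma hα hb (norm_nonneg z)).congr fun n => ?_)
  have : 0 < Real.Gamma (α * n + b) := Real.Gamma_pos_of_pos (by positivity)
  rw [norm_div, norm_pow, Complex.norm_real, Real.norm_of_nonneg this.le]

lemma differentiable_mlComplex {α b : ℝ} (hα : 0 < α) (hb : 1 ≤ b) :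
    Differentiable ℂ (mlComplex α b) := by
  intro z
  have hd : DifferentiableOn ℂ (mlComplex α b) (Metric.ball 0 (‖z‖ + 1)) := by
    refine Complex.differentiableOn_tsum_of_summable_norm
      (summable_pow_div_Gamma hα hb (r := ‖z‖ + 1) (by positivity)) (fun n => by fun_prop)
      Metric.isOpen_ball fun n w hw => ?_
    have hG : 0 < Real.Gamma (α * n + b) := Real.Gamma_pos_of_pos (by positivity)
    rw [mem_ball_zero_iff] at hw
    rw [norm_div, norm_pow, Complex.norm_real, Real.norm_of_nonneg hG.le]
    gcongr
  exact hd.differentiableAt (Metric.isOpen_ball.mem_nhds (by simp))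

lemma continuous_mlRelax {α b : ℝ} (hα : 0 < α) (hb : 1 ≤ b) (c : ℂ) :
    Continuous (mlRelax α b c) := by
  unfold mlRelax
  have h1 : Continuous fun t : ℝ => t ^ (b - 1) := Real.continuous_rpow_const (by linarith)
  have h2 : Continuous fun t : ℝ => t ^ α := Real.continuous_rpow_const hα.le
  have h3 := (differentiable_mlComplex hα hb).continuous
  fun_prop

/-- Splitting off the first term of the series. -/
lemma mlRelax_eq_sub {α b : ℝ} (hα : 0 < α) (hb : 1 ≤ b) (c : ℂ) {t : ℝ} (ht : 0 < t) :
    mlRelax α b c t = ((t ^ (b - 1) / Real.Gamma b : ℝ) : ℂ) - c * mlRelax α (b + α) c t := by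
  have e : t ^ (b + α - 1) = t ^ (b - 1) * t ^ α := by
    rw [← Real.rpow_add ht]; ring_nf
  unfold mlRelax mlComplex
  rw [(summable_mlComplex hα hb _).tsum_eq_zero_add, e]
  have : ∀ n : ℕ, (-c * ((t ^ α : ℝ) : ℂ)) ^ (n + 1) / (Real.Gamma (α * (n + 1 : ℕ) + b) : ℂ)
      = (-c * ((t ^ α : ℝ) : ℂ)) *
        ((-c * ((t ^ α : ℝ) : ℂ)) ^ n / (Real.Gamma (α * n + (b + α)) : ℂ)) := by
    intro n
    rw [show α * ((n + 1 : ℕ) : ℝ) + b = α * n + (b + α) by push_cast; ring]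
    ring
  rw [tsum_congr this, tsum_mul_left]
  push_cast
  simp
  ring

lemma hasSum_mlRelax {α b : ℝ} (hα : 0 < α) (hb : 1 ≤ b) (c : ℂ) {t : ℝ} (ht : 0 < t) :
    HasSum (fun n : ℕ => (-c) ^ n / (Real.Gamma (α * n + b) : ℂ) *
      ((t ^ (α * n + b - 1) : ℝ) : ℂ)) (mlRelax α b c t) := by
  refine ((summable_mlComplex hα hb (-c * ((t ^ α : ℝ) : ℂ))).hasSum.mul_left
    ((t ^ (b - 1) : ℝ) : ℂ)).congr_fun fun n => ?_
  have e : t ^ (α * n + b - 1) = (t ^ α) ^ n * t ^ (b - 1) := by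
    rw [add_sub_assoc, Real.rpow_add ht, Real.rpow_mul ht.le, Real.rpow_natCast]
  rw [e]
  push_cast
  ring

lemma integral_sub_rpow_mul_rpow {p q t : ℝ} (hp : 0 < p) (hq : 0 < q) (ht : 0 < t) :
    ∫ s in (0 : ℝ)..t, (t - s) ^ (p - 1) * s ^ (q - 1) =
      Real.Gamma p * Real.Gamma q / Real.Gamma (q + p) * t ^ (q + p - 1) := by
  have h := Complex.betaIntegral_scaled (q : ℂ) (p : ℂ) ht
  have hG := Complex.Gamma_mul_Gamma_eq_betaIntegral (s := q) (t := p) (by simpa) (by simpa)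
  have hne : Real.Gamma (q + p) ≠ 0 := (Real.Gamma_pos_of_pos (by linarith)).ne'
  rw [← Complex.ofReal_inj, ← intervalIntegral.integral_ofReal]
  have hB : Complex.betaIntegral q p
      = ((Real.Gamma p * Real.Gamma q / Real.Gamma (q + p) : ℝ) : ℂ) := by
    rw [← Complex.ofReal_add, Complex.Gamma_ofReal, Complex.Gamma_ofReal,
      Complex.Gamma_ofReal] at hG
    have hne' : (Real.Gamma (q + p) : ℂ) ≠ 0 := by exact_mod_cast hne
    push_cast
    rw [eq_div_iff hne', mul_comm, ← hG, mul_comm]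
  rw [hB] at h
  rw [Complex.ofReal_mul, mul_comm, Complex.ofReal_cpow ht.le]
  push_cast at h ⊢
  rw [← h]
  refine intervalIntegral.integral_congr fun s hs => ?_
  rw [uIcc_of_le ht.le] at hs
  rw [Complex.ofReal_cpow (by linarith [hs.2]), Complex.ofReal_cpow hs.1, mul_comm]
  push_cast
  rfl

lemma intervalIntegrable_sub_rpow {p t : ℝ} (hp : 0 < p) :
    IntervalIntegrable (fun s => (t - s) ^ (p - 1)) volume 0 t := by
  have := (intervalIntegral.intervalIntegrable_rpow' (a := t) (b := 0)
    (show -1 < p - 1 by linarith)).comp_sub_left t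
  simpa using this

/-- Riemann-Liouville integration of order `γ` raises the second parameter by `γ`. -/
lemma integral_sub_rpow_mul_mlRelax {α b γ : ℝ} (hα : 0 < α) (hb : 1 ≤ b) (hγ : 0 < γ) (c : ℂ)
    {t : ℝ} (ht : 0 < t) :
    ∫ s in (0 : ℝ)..t, (((t - s) ^ (γ - 1) : ℝ) : ℂ) * mlRelax α b c s =
      (Real.Gamma γ : ℂ) * mlRelax α (b + γ) c t := by
  have hGpos : ∀ n : ℕ, 0 < Real.Gamma (α * n + b) := fun n =>
    Real.Gamma_pos_of_pos (by positivity)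
  set F : ℕ → ℝ → ℂ := fun n s => (-c) ^ n / (Real.Gamma (α * n + b) : ℂ) *
    (((t - s) ^ (γ - 1) * s ^ (α * n + b - 1) : ℝ) : ℂ) with hF
  have hreal : ∀ n : ℕ, IntervalIntegrable
      (fun s : ℝ => (t - s) ^ (γ - 1) * s ^ (α * n + b - 1)) volume 0 t := fun n => by
    have hn : 0 ≤ α * n := by positivity
    exact (intervalIntegrable_sub_rpow hγ).mul_continuousOn
      (Real.continuous_rpow_const (by linarith)).continuousOn
  have hval : ∀ n : ℕ, ∫ s in Ioc 0 t, (t - s) ^ (γ - 1) * s ^ (α * n + b - 1) =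
      Real.Gamma γ * Real.Gamma (α * n + b) / Real.Gamma (α * n + (b + γ)) *
        t ^ (α * n + (b + γ) - 1) := fun n => by
    have := integral_sub_rpow_mul_rpow hγ (q := α * n + b) (by positivity) ht
    rw [intervalIntegral.integral_of_le ht.le] at this
    rw [this, add_assoc]
  have hInt : ∀ n, Integrable (F n) (volume.restrict (Ioc 0 t)) := fun n => by
    have := (intervalIntegrable_iff_integrableOn_Ioc_of_le ht.le).1 (hreal n)
    exact this.ofReal.const_mul _
  have hnorm : ∀ n, ∫ s in Ioc 0 t, ‖F n s‖ =
      ‖(-c) ^ n / (Real.Gamma (α * n + (b + γ)) : ℂ) *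
      ((t ^ (α * n + (b + γ) - 1) : ℝ) : ℂ)‖ * Real.Gamma γ := fun n => by
    have h1 : ∫ s in Ioc 0 t, ‖F n s‖ = ∫ s in Ioc 0 t,
        ‖(-c) ^ n / (Real.Gamma (α * n + b) : ℂ)‖ *
        ((t - s) ^ (γ - 1) * s ^ (α * n + b - 1)) := by
      refine setIntegral_congr_fun measurableSet_Ioc fun s hs => ?_
      have h1 : 0 ≤ (t - s) ^ (γ - 1) := Real.rpow_nonneg (by linarith [hs.2]) _
      have h2 : 0 ≤ s ^ (α * n + b - 1) := Real.rpow_nonneg hs.1.le _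
      simp only [hF, norm_mul, Complex.norm_real, Real.norm_of_nonneg (mul_nonneg h1 h2)]
    have hG' : 0 < Real.Gamma (α * n + (b + γ)) := Real.Gamma_pos_of_pos (by positivity)
    rw [h1, integral_const_mul, hval]
    simp only [norm_mul, norm_div, Complex.norm_real, Real.norm_of_nonneg (hGpos n).le,
      Real.norm_of_nonneg hG'.le, Real.norm_of_nonneg (Real.rpow_nonneg ht.le _)]
    have := hGpos n
    field_simp
  have hs := hasSum_mlRelax hα (b := b + γ) (by linarith) c ht
  have hsum : Summable fun n => ∫ s in Ioc 0 t, ‖F n s‖ := by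
    simp_rw [hnorm]
    exact hs.summable.norm.mul_right _
  have hmain := hasSum_integral_of_summable_integral_norm hInt hsum
  have hterm : ∀ n, ∫ s in Ioc 0 t, F n s = (Real.Gamma γ : ℂ) *
      ((-c) ^ n / (Real.Gamma (α * n + (b + γ)) : ℂ) *
      ((t ^ (α * n + (b + γ) - 1) : ℝ) : ℂ)) := fun n => by
    rw [hF]
    have : (Real.Gamma (α * n + b) : ℂ) ≠ 0 := by exact_mod_cast (hGpos n).ne'
    rw [integral_const_mul, integral_complex_ofReal, hval]
    push_cast
    field_simp
  rw [intervalIntegral.integral_of_le ht.le]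
  simp_rw [hterm] at hmain
  rw [(hs.mul_left _).unique hmain]
  refine setIntegral_congr_fun measurableSet_Ioc fun s hs' => ?_
  have := (hasSum_mlRelax hα hb c hs'.1).mul_left (((t - s) ^ (γ - 1) : ℝ) : ℂ)
  rw [← this.tsum_eq]
  refine tsum_congr fun n => ?_
  rw [hF]
  push_cast
  ring

lemma integral_mlRelax {α b : ℝ} (hα : 0 < α) (hb : 1 ≤ b) (c : ℂ) {t : ℝ} (ht : 0 < t) :
    ∫ s in (0 : ℝ)..t, mlRelax α b c s = mlRelax α (b + 1) c t := by
  simpa using integral_sub_rpow_mul_mlRelax hα hb one_pos c ht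

lemma re_integral_conj_mul_exp_kernel_nonneg {κ : ℂ} (hκ : 0 ≤ κ.re) {T : ℝ} (hT : 0 < T)
    {u : ℝ → ℂ} (hu : Continuous u) :
    0 ≤ (∫ t in (0 : ℝ)..T, (starRingEnd ℂ) (u t) *
      ∫ s in (0 : ℝ)..t, Complex.exp (-(κ * ((t - s : ℝ) : ℂ))) * u s).re := by
  set w : ℝ → ℂ := fun t => Complex.exp (-(κ * t)) * ∫ s in (0 : ℝ)..t, Complex.exp (κ * s) * u s
    with hw
  have hwt : ∀ t, ∫ s in (0 : ℝ)..t, Complex.exp (-(κ * ((t - s : ℝ) : ℂ))) * u s = w t := by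
    intro t
    rw [hw]
    simp only
    rw [← intervalIntegral.integral_const_mul]
    refine intervalIntegral.integral_congr fun s _ => ?_
    rw [← mul_assoc, ← Complex.exp_add]
    push_cast
    ring_nf
  simp_rw [hwt]
  have hc : Continuous fun s : ℝ => Complex.exp (κ * s) * u s := by fun_prop
  have hder : ∀ t, HasDerivAt w (u t - κ * w t) t := by
    intro t
    have h1 : HasDerivAt (fun t : ℝ => ∫ s in (0 : ℝ)..t, Complex.exp (κ * s) * u s)
        (Complex.exp (κ * t) * u t) t := hc.integral_hasStrictDerivAt 0 t |>.hasDerivAt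
    have h2 : HasDerivAt (fun t : ℝ => Complex.exp (-(κ * t)))
        (Complex.exp (-(κ * t)) * (-(κ * 1))) t :=
      (((hasDerivAt_id t).ofReal_comp.const_mul κ).neg).cexp
    have h3 := h2.mul h1
    refine h3.congr_deriv ?_
    have e : Complex.exp (-(κ * t)) * Complex.exp (κ * t) = 1 := by
      rw [← Complex.exp_add]; simp
    rw [hw]
    simp only
    linear_combination u t * e
  have hwc : Continuous w := continuous_iff_continuousAt.2 fun t => (hder t).continuousAt
  have hFTC : ∫ t in (0 : ℝ)..T, 2 * inner ℝ (w t) (u t - κ * w t) = ‖w T‖ ^ 2 - ‖w 0‖ ^ 2 :=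
    intervalIntegral.integral_eq_sub_of_hasDerivAt (fun t _ => (hder t).norm_sq)
      (Continuous.intervalIntegrable (by fun_prop) _ _)
  have hw0 : w 0 = 0 := by simp [hw]
  have hre : (∫ t in (0 : ℝ)..T, (starRingEnd ℂ) (u t) * w t).re =
      ∫ t in (0 : ℝ)..T, ((starRingEnd ℂ) (u t) * w t).re := by
    have hi : IntervalIntegrable (fun t => (starRingEnd ℂ) (u t) * w t) volume 0 T :=
      Continuous.intervalIntegrable (by fun_prop) _ _
    exact (Complex.reCLM.intervalIntegral_comp_comm hi).symm
  rw [hre]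
  have hpt : ∀ t, ((starRingEnd ℂ) (u t) * w t).re =
      2⁻¹ * (2 * inner ℝ (w t) (u t - κ * w t)) + κ.re * ‖w t‖ ^ 2 := by
    intro t
    rw [Complex.inner, ← Complex.normSq_eq_norm_sq, Complex.normSq_apply]
    simp only [Complex.mul_re, Complex.mul_im, Complex.sub_re, Complex.sub_im, Complex.conj_re,
      Complex.conj_im]
    ring
  simp_rw [hpt]
  rw [intervalIntegral.integral_add (Continuous.intervalIntegrable (by fun_prop) _ _)
    (Continuous.intervalIntegrable (by fun_prop) _ _), intervalIntegral.integral_const_mul, hFTC,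
    hw0]
  have : 0 ≤ ∫ t in (0 : ℝ)..T, κ.re * ‖w t‖ ^ 2 :=
    intervalIntegral.integral_nonneg hT.le fun t _ => by positivity
  have := sq_nonneg ‖w T‖
  rw [norm_zero]
  linarith

lemma integrableOn_rpow_mul_exp_neg_mul {q y : ℝ} (hq : -1 < q) (hy : 0 < y) :
    IntegrableOn (fun r : ℝ => r ^ q * Real.exp (-(y * r))) (Ioi 0) := by
  have := integrableOn_rpow_mul_exp_neg_mul_rpow hq one_pos hy
  simpa using this

lemma norm_rpow_mul_cexp {q r : ℝ} (hr : 0 < r) (z : ℂ) :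
    ‖((r ^ q : ℝ) : ℂ) * Complex.exp (-(z * r))‖ = r ^ q * Real.exp (-(z.re * r)) := by
  rw [norm_mul, Complex.norm_real, Real.norm_of_nonneg (Real.rpow_nonneg hr.le _),
    Complex.norm_exp]
  simp

lemma aestronglyMeasurable_rpow_mul_cexp (q : ℝ) (z : ℂ) :
    AEStronglyMeasurable (fun r : ℝ => ((r ^ q : ℝ) : ℂ) * Complex.exp (-(z * r)))
      (volume.restrict (Ioi 0)) := by
  refine Measurable.aestronglyMeasurable ?_
  fun_prop

lemma integrableOn_rpow_mul_cexp {q : ℝ} (hq : -1 < q) {z : ℂ} (hz : 0 < z.re) :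
    IntegrableOn (fun r : ℝ => ((r ^ q : ℝ) : ℂ) * Complex.exp (-(z * r))) (Ioi 0) := by
  refine (integrableOn_rpow_mul_exp_neg_mul hq hz).mono' (aestronglyMeasurable_rpow_mul_cexp q z) ?_
  filter_upwards [ae_restrict_mem measurableSet_Ioi] with r hr
  rw [norm_rpow_mul_cexp hr]

lemma differentiableAt_integral_rpow_mul_cexp {p : ℝ} (hp : 0 < p) {z : ℂ} (hz : 0 < z.re) :
    DifferentiableAt ℂ
      (fun z : ℂ => ∫ r in Ioi (0 : ℝ), ((r ^ (p - 1) : ℝ) : ℂ) * Complex.exp (-(z * r))) z := by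
  refine (hasDerivAt_integral_of_dominated_loc_of_deriv_le
    (F' := fun z r => ((r ^ (p - 1) : ℝ) : ℂ) * (Complex.exp (-(z * r)) * (-(1 * r))))
    (bound := fun r => r ^ p * Real.exp (-((z.re / 2) * r)))
    (s := {w : ℂ | z.re / 2 < w.re}) ?_ ?_ ?_ ?_ ?_ ?_ ?_).2.differentiableAt
  · exact (isOpen_lt continuous_const Complex.continuous_re).mem_nhds (by simp; linarith)
  · exact Eventually.of_forall fun w => aestronglyMeasurable_rpow_mul_cexp _ w
  · exact integrableOn_rpow_mul_cexp (by linarith) hz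
  · refine Measurable.aestronglyMeasurable ?_
    fun_prop
  · filter_upwards [ae_restrict_mem measurableSet_Ioi] with r hr w hw
    have hr' : (0 : ℝ) < r := hr
    have hw' : z.re / 2 < w.re := hw
    rw [← mul_assoc, norm_mul, norm_rpow_mul_cexp hr]
    have e : r ^ p = r ^ (p - 1) * r := by
      rw [← Real.rpow_add_one hr'.ne']; ring_nf
    rw [e]
    simp only [one_mul, norm_neg, Complex.norm_real, Real.norm_of_nonneg hr'.le]
    rw [mul_right_comm]
    gcongr
  · exact integrableOn_rpow_mul_exp_neg_mul (by linarith) (by linarith)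
  · refine Eventually.of_forall fun r w _ => ?_
    exact ((((hasDerivAt_id w).mul_const (r : ℂ)).neg).cexp).const_mul _

lemma convex_abs_im_lt (δ : ℝ) : Convex ℝ {z : ℂ | |z.im| < δ} := by
  have : {z : ℂ | |z.im| < δ} = Complex.imLm ⁻¹' (Metric.ball 0 δ) := by
    ext z; simp
  rw [this]
  exact (convex_ball 0 δ).linear_preimage _

lemma isOpen_abs_im_lt (δ : ℝ) : IsOpen {z : ℂ | |z.im| < δ} :=
  isOpen_lt (continuous_abs.comp Complex.continuous_im) continuous_const

/-- Two holomorphic functions on a horizontal strip that agree on a real ray to the left agree. -/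
lemma eqOn_strip {δ A : ℝ} (hδ : 0 < δ) {f g : ℂ → ℂ}
    (hf : DifferentiableOn ℂ f {z : ℂ | |z.im| < δ})
    (hg : DifferentiableOn ℂ g {z : ℂ | |z.im| < δ})
    (hfg : ∀ x : ℝ, x < A → f x = g x) : EqOn f g {z : ℂ | |z.im| < δ} := by
  have hA : (((A - 1 : ℝ) : ℂ)) ∈ {z : ℂ | |z.im| < δ} := by simpa using hδ
  refine (hf.analyticOnNhd (isOpen_abs_im_lt δ)).eqOn_of_preconnected_of_frequently_eq
    (hg.analyticOnNhd (isOpen_abs_im_lt δ)) (convex_abs_im_lt δ).isPreconnected hA ?_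
  have ht : Tendsto (fun x : ℝ => (x : ℂ)) (𝓝[≠] (A - 1)) (𝓝[≠] ((A - 1 : ℝ) : ℂ)) := by
    refine tendsto_nhdsWithin_iff.2 ⟨?_, ?_⟩
    · exact (Complex.continuous_ofReal.tendsto _).mono_left nhdsWithin_le_nhds
    · filter_upwards [self_mem_nhdsWithin] with x hx
      exact fun h => hx (Complex.ofReal_injective h)
  refine ht.frequently (Eventually.frequently ?_)
  have : ∀ᶠ x in 𝓝 (A - 1), x < A := eventually_lt_nhds (by linarith)
  filter_upwards [nhdsWithin_le_nhds this] with x hx using hfg x hx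

lemma exp_neg_div_re_pos {p : ℝ} (hp : 0 < p) {ζ : ℂ} (hζ : |ζ.im| < p * (Real.pi / 2)) :
    0 < (Complex.exp (-(ζ / p))).re := by
  rw [Complex.exp_re]
  refine mul_pos (Real.exp_pos _) (Real.cos_pos_of_mem_Ioo ?_)
  have h := abs_lt.1 hζ
  have e : (-(ζ / (p : ℂ))).im = -(ζ.im / p) := by simp [Complex.div_ofReal_im]
  rw [e]
  constructor
  · rw [neg_lt_neg_iff, div_lt_iff₀ hp]; linarith
  · rw [neg_lt, lt_div_iff₀ hp]; linarith

lemma integral_rpow_mul_cexp {p x : ℝ} (hp : 0 < p) (hx : 0 < x) {ζ : ℂ}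
    (hζ : |ζ.im| < p * (Real.pi / 2)) :
    ∫ r in Ioi (0 : ℝ), ((r ^ (p - 1) : ℝ) : ℂ) *
        Complex.exp (-((Complex.exp (-(ζ / p)) * x) * r)) =
      Complex.exp ζ * ((Real.Gamma p * x ^ (-p) : ℝ) : ℂ) := by
  have hδ : 0 < p * (Real.pi / 2) := by positivity
  refine eqOn_strip (A := 0) hδ (f := fun ζ => ∫ r in Ioi (0 : ℝ), ((r ^ (p - 1) : ℝ) : ℂ) *
        Complex.exp (-((Complex.exp (-(ζ / p)) * x) * r)))
    (g := fun ζ => Complex.exp ζ * ((Real.Gamma p * x ^ (-p) : ℝ) : ℂ)) ?_ (by fun_prop) ?_ hζ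
  · intro z hz
    have h1 : 0 < (Complex.exp (-(z / p)) * x).re := by
      rw [Complex.re_mul_ofReal]
      exact mul_pos (exp_neg_div_re_pos hp hz) hx
    refine DifferentiableAt.differentiableWithinAt ?_
    exact (differentiableAt_integral_rpow_mul_cexp hp h1).comp z
      (f := fun ζ : ℂ => Complex.exp (-(ζ / p)) * x) (by fun_prop)
  · intro y _
    have h := Real.integral_rpow_mul_exp_neg_mul_Ioi hp (r := Real.exp (-(y / p)) * x)
      (by positivity)
    have e : (1 / (Real.exp (-(y / p)) * x)) ^ p * Real.Gamma p =
        Real.exp y * (Real.Gamma p * x ^ (-p)) := by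
      rw [one_div, Real.inv_rpow (by positivity), Real.mul_rpow (Real.exp_pos _).le hx.le,
        ← Real.exp_mul, Real.rpow_neg hx.le, neg_mul, div_mul_cancel₀ _ hp.ne', mul_inv,
        ← Real.exp_neg, neg_neg]
      ring
    rw [e] at h
    rw [← Complex.ofReal_exp, ← Complex.ofReal_mul, ← h, ← integral_complex_ofReal]
    congr 1
    ext r
    push_cast
    rfl

/-- A double integral against a one-sided difference kernel over a square, in iterated form. -/
lemma integral_conj_mul_indicator_kernel {T : ℝ} (hT : 0 < T) (u K : ℝ → ℂ)
    (hint : Integrable (fun q : ℝ × ℝ => (starRingEnd ℂ) ((Ioc 0 T).indicator u q.1) *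
      ((Ioc 0 T).indicator u q.2 * (Ioi 0).indicator K (q.1 - q.2))) (volume.prod volume)) :
    ∫ q : ℝ × ℝ, (starRingEnd ℂ) ((Ioc 0 T).indicator u q.1) *
      ((Ioc 0 T).indicator u q.2 * (Ioi 0).indicator K (q.1 - q.2)) ∂(volume.prod volume) =
    ∫ t in (0 : ℝ)..T, (starRingEnd ℂ) (u t) * ∫ s in (0 : ℝ)..t, K (t - s) * u s := by
  rw [integral_prod _ hint, intervalIntegral.integral_of_le hT.le,
    ← integral_indicator measurableSet_Ioc]
  refine integral_congr_ae (Eventually.of_forall fun t => ?_)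
  simp only
  by_cases ht : t ∈ Ioc 0 T
  · simp only [indicator_of_mem ht]
    rw [integral_const_mul, intervalIntegral.integral_of_le ht.1.le, integral_Ioc_eq_integral_Ioo,
      ← integral_indicator measurableSet_Ioo]
    congr 2
    ext s
    by_cases hs : s ∈ Ioo 0 t
    · have h1 : s ∈ Ioc 0 T := ⟨hs.1, hs.2.le.trans ht.2⟩
      have h2 : t - s ∈ Ioi (0 : ℝ) := sub_pos.2 hs.2
      rw [indicator_of_mem hs, indicator_of_mem h1, indicator_of_mem h2, mul_comm]
    · rw [indicator_of_notMem hs]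
      by_cases h1 : s ∈ Ioc 0 T
      · have h2 : t - s ∉ Ioi (0 : ℝ) := fun h => hs ⟨h1.1, sub_pos.1 h⟩
        rw [indicator_of_notMem h2, mul_zero]
      · rw [indicator_of_notMem h1, zero_mul]
  · simp [indicator_of_notMem ht]

/-- The Riemann-Liouville kernel of order `γ ∈ (0, 1)`, rotated by an angle of modulus less than
`(1 - γ) π / 2`, is of positive type. -/
lemma re_exp_mul_integral_conj_mul_rpow_kernel_nonneg {γ : ℝ} (hγ : γ ∈ Ioo (0 : ℝ) 1) {ζ : ℂ}
    (hζ : |ζ.im| < (1 - γ) * (Real.pi / 2)) {T : ℝ} (hT : 0 < T) {u : ℝ → ℂ}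
    (hu : Continuous u) :
    0 ≤ (Complex.exp ζ * ∫ t in (0 : ℝ)..T, (starRingEnd ℂ) (u t) *
      ∫ s in (0 : ℝ)..t, (((t - s) ^ (γ - 1) : ℝ) : ℂ) * u s).re := by
  set p : ℝ := 1 - γ with hp
  have hp0 : 0 < p := by linarith [hγ.2]
  have hp1 : p < 1 := by linarith [hγ.1]
  set ω : ℂ := Complex.exp (-(ζ / p)) with hω
  have hωre : 0 < ω.re := exp_neg_div_re_pos hp0 hζ
  set f : ℝ → ℂ := (Ioc 0 T).indicator u with hf
  have hfm : Measurable f := hu.measurable.indicator measurableSet_Ioc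
  obtain ⟨M, hM⟩ : ∃ M, ∀ t, ‖f t‖ ≤ M := by
    obtain ⟨M, hM⟩ := (isCompact_Icc (a := (0 : ℝ)) (b := T)).exists_bound_of_continuousOn
      hu.continuousOn
    have hM0 : 0 ≤ M := (norm_nonneg _).trans (hM 0 ⟨le_rfl, hT.le⟩)
    refine ⟨M, fun t => ?_⟩
    by_cases ht : t ∈ Ioc 0 T
    · rw [hf, indicator_of_mem ht]; exact hM t ⟨ht.1.le, ht.2⟩
    · rw [hf, indicator_of_notMem ht]; simpa
  have hfi : Integrable f :=
    (integrable_indicator_iff measurableSet_Ioc).2 (hu.integrableOn_Ioc)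
  set H : ℝ × ℝ → ℝ → ℂ := fun q r => (starRingEnd ℂ) (f q.1) * (f q.2 *
    (Ioi 0).indicator (fun x : ℝ => ((r ^ (p - 1) : ℝ) : ℂ) * Complex.exp (-((ω * x) * r)))
      (q.1 - q.2)) with hH
  have hωx : ∀ x : ℝ, (ω * x).re = ω.re * x := fun x => Complex.re_mul_ofReal _ _
  -- integrability of the kernel on the square
  have hk : Integrable (fun q : ℝ × ℝ => ‖f q.1‖ * (‖f q.2‖ * (Ioi (0 : ℝ)).indicator
      (fun x : ℝ => x ^ (-p)) (q.1 - q.2))) (volume.prod volume) := by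
    have hki : Integrable ((Ioc 0 T).indicator fun x : ℝ => x ^ (-p)) := by
      rw [integrable_indicator_iff measurableSet_Ioc,
        ← intervalIntegrable_iff_integrableOn_Ioc_of_le hT.le]
      exact intervalIntegral.intervalIntegrable_rpow' (by linarith)
    have hconv := hfi.norm.convolution_integrand (ContinuousLinearMap.mul ℝ ℝ) hki
    have hb := hconv.bdd_mul (c := M) (f := fun q : ℝ × ℝ => ‖f q.1‖)
      (by exact (hfm.comp measurable_fst).norm.aestronglyMeasurable)
      (Eventually.of_forall fun q => by simpa using hM q.1)
    refine hb.congr (Eventually.of_forall fun q => ?_)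
    simp only [ContinuousLinearMap.mul_apply']
    by_cases h1 : q.1 ∈ Ioc 0 T
    · by_cases h2 : q.2 ∈ Ioc 0 T
      · have : q.1 - q.2 ∈ Ioc 0 T ↔ q.1 - q.2 ∈ Ioi (0 : ℝ) :=
          ⟨fun h => h.1, fun h => ⟨h, by linarith [h1.2, h2.1]⟩⟩
        by_cases h3 : q.1 - q.2 ∈ Ioi (0 : ℝ)
        · rw [indicator_of_mem h3, indicator_of_mem (this.2 h3)]
        · rw [indicator_of_notMem h3, indicator_of_notMem (mt this.1 h3)]
      · simp [hf, indicator_of_notMem h2]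
    · simp [hf, indicator_of_notMem h1]
  have hHm : Measurable (Function.uncurry H) := by
    have e : Function.uncurry H = fun z : (ℝ × ℝ) × ℝ => (starRingEnd ℂ) (f z.1.1) * (f z.1.2 *
        {z : (ℝ × ℝ) × ℝ | 0 < z.1.1 - z.1.2}.indicator (fun z => ((z.2 ^ (p - 1) : ℝ) : ℂ) *
          Complex.exp (-((ω * ((z.1.1 - z.1.2 : ℝ) : ℂ)) * z.2))) z) := rfl
    have hms : MeasurableSet {z : (ℝ × ℝ) × ℝ | 0 < z.1.1 - z.1.2} :=
      measurableSet_lt measurable_const (by fun_prop)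
    rw [e]
    refine Measurable.mul ?_ (Measurable.mul ?_ (Measurable.indicator ?_ hms))
    · exact Complex.continuous_conj.measurable.comp (hfm.comp (by fun_prop))
    · exact hfm.comp (by fun_prop)
    · fun_prop
  have hnorm : ∀ q : ℝ × ℝ, ∫ r in Ioi (0 : ℝ), ‖H q r‖ = ((1 / ω.re) ^ p * Real.Gamma p) *
      (‖f q.1‖ * (‖f q.2‖ * (Ioi (0 : ℝ)).indicator (fun x : ℝ => x ^ (-p)) (q.1 - q.2))) := by
    intro q
    by_cases hq : q.1 - q.2 ∈ Ioi (0 : ℝ)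
    · have hq' : 0 < q.1 - q.2 := hq
      simp only [hH, indicator_of_mem hq]
      have : ∫ r in Ioi (0 : ℝ), ‖(starRingEnd ℂ) (f q.1) * (f q.2 * (((r ^ (p - 1) : ℝ) : ℂ) *
          Complex.exp (-((ω * ((q.1 - q.2 : ℝ) : ℂ)) * r))))‖ =
          ∫ r in Ioi (0 : ℝ), (‖f q.1‖ * ‖f q.2‖) *
            (r ^ (p - 1) * Real.exp (-((ω.re * (q.1 - q.2)) * r))) := by
        refine setIntegral_congr_fun measurableSet_Ioi fun r hr => ?_
        rw [norm_mul, norm_mul, norm_rpow_mul_cexp hr, hωx, RCLike.norm_conj, ← mul_assoc ‖f q.1‖]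
      rw [this, integral_const_mul, Real.integral_rpow_mul_exp_neg_mul_Ioi hp0 (by positivity),
        one_div, mul_inv, Real.mul_rpow (by positivity) (by positivity), Real.rpow_neg hq'.le,
        Real.inv_rpow hq'.le, one_div]
      ring
    · simp [hH, indicator_of_notMem hq]
  have hHi : Integrable (Function.uncurry H)
      ((volume.prod volume).prod (volume.restrict (Ioi 0))) := by
    rw [integrable_prod_iff hHm.aestronglyMeasurable]
    refine ⟨Eventually.of_forall fun q => ?_, ?_⟩
    · by_cases hq : q.1 - q.2 ∈ Ioi (0 : ℝ)
      · have hq' : 0 < q.1 - q.2 := hq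
        simp only [Function.uncurry, hH, indicator_of_mem hq]
        refine Integrable.const_mul (Integrable.const_mul ?_ _) _
        exact integrableOn_rpow_mul_cexp (by linarith) (by rw [hωx]; positivity)
      · simp [Function.uncurry, hH, indicator_of_notMem hq]
    · simp only [Function.uncurry]
      simp_rw [hnorm]
      exact hk.const_mul _
  have hswap := integral_integral_swap hHi
  have hleft : ∀ q : ℝ × ℝ, ∫ r in Ioi (0 : ℝ), H q r = (Complex.exp ζ * Real.Gamma p) *
      ((starRingEnd ℂ) (f q.1) * (f q.2 *
        (Ioi 0).indicator (fun x : ℝ => ((x ^ (γ - 1) : ℝ) : ℂ)) (q.1 - q.2))) := by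
    intro q
    by_cases hq : q.1 - q.2 ∈ Ioi (0 : ℝ)
    · have hq' : 0 < q.1 - q.2 := hq
      simp only [hH, indicator_of_mem hq]
      rw [integral_const_mul, integral_const_mul, integral_rpow_mul_cexp hp0 hq' hζ,
        show γ - 1 = -p by rw [hp]; ring]
      push_cast
      ring
    · simp [hH, indicator_of_notMem hq]
  have hGp : 0 < Real.Gamma p := Real.Gamma_pos_of_pos hp0
  have hne : Complex.exp ζ * Real.Gamma p ≠ 0 :=
    mul_ne_zero (Complex.exp_ne_zero _) (by exact_mod_cast hGp.ne')
  have hki : Integrable (fun q : ℝ × ℝ => (starRingEnd ℂ) (f q.1) * (f q.2 *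
        (Ioi 0).indicator (fun x : ℝ => ((x ^ (γ - 1) : ℝ) : ℂ)) (q.1 - q.2)))
        (volume.prod volume) := by
    have h := hHi.integral_prod_left
    simp only [Function.uncurry] at h
    simp_rw [hleft] at h
    exact (integrable_const_mul_iff (IsUnit.mk0 _ hne) _).1 h
  simp_rw [hleft] at hswap
  rw [integral_const_mul, integral_conj_mul_indicator_kernel hT u _ hki] at hswap
  have hre : 0 ≤ (∫ r in Ioi (0 : ℝ), ∫ q : ℝ × ℝ, H q r ∂(volume.prod volume)).re := by
    have hi := hHi.integral_prod_right
    have e := Complex.reCLM.integral_comp_comm hi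
    simp only [Complex.reCLM_apply, Function.uncurry] at e
    rw [← e]
    refine integral_nonneg_of_ae ?_
    filter_upwards [ae_restrict_mem measurableSet_Ioi, hHi.prod_left_ae] with r hr hri
    have hr' : (0 : ℝ) < r := hr
    simp only [Function.uncurry, hH] at hri
    rw [Pi.zero_apply]
    simp only [hH]
    rw [integral_conj_mul_indicator_kernel hT u _ hri]
    have h := re_integral_conj_mul_exp_kernel_nonneg (κ := ω * r)
      (by rw [hωx]; positivity) hT hu
    have e2 : ∫ t in (0 : ℝ)..T, (starRingEnd ℂ) (u t) * ∫ s in (0 : ℝ)..t,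
        ((r ^ (p - 1) : ℝ) : ℂ) * Complex.exp (-((ω * ((t - s : ℝ) : ℂ)) * r)) * u s =
        ((r ^ (p - 1) : ℝ) : ℂ) * ∫ t in (0 : ℝ)..T, (starRingEnd ℂ) (u t) *
        ∫ s in (0 : ℝ)..t, Complex.exp (-((ω * r) * ((t - s : ℝ) : ℂ))) * u s := by
      rw [← intervalIntegral.integral_const_mul]
      refine intervalIntegral.integral_congr fun t _ => ?_
      rw [mul_left_comm]
      congr 1
      rw [← intervalIntegral.integral_const_mul]
      refine intervalIntegral.integral_congr fun s _ => ?_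
      rw [mul_assoc, mul_right_comm ω]
    rw [e2, Complex.re_ofReal_mul]
    positivity
  rw [← hswap, mul_right_comm, Complex.re_mul_ofReal] at hre
  exact nonneg_of_mul_nonneg_left hre hGp

lemma re_exp_mul_integral_conj_mul_mlRelax_nonneg {α γ : ℝ} (hα : 0 < α)
    (hγ : γ ∈ Ioo (0 : ℝ) 1) {ζ : ℂ} (hζ : |ζ.im| < (1 - γ) * (Real.pi / 2)) {T : ℝ}
    (hT : 0 < T) :
    0 ≤ (Complex.exp ζ * ∫ t in (0 : ℝ)..T, (starRingEnd ℂ) (mlRelax α 1 (Complex.exp ζ) t) *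
      mlRelax α (1 + γ) (Complex.exp ζ) t).re := by
  have h := re_exp_mul_integral_conj_mul_rpow_kernel_nonneg hγ hζ hT
    (continuous_mlRelax hα le_rfl (Complex.exp ζ))
  have hG : 0 < Real.Gamma γ := Real.Gamma_pos_of_pos hγ.1
  have e : ∫ t in (0 : ℝ)..T, (starRingEnd ℂ) (mlRelax α 1 (Complex.exp ζ) t) *
      ∫ s in (0 : ℝ)..t, (((t - s) ^ (γ - 1) : ℝ) : ℂ) * mlRelax α 1 (Complex.exp ζ) s =
      (Real.Gamma γ : ℂ) * ∫ t in (0 : ℝ)..T,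
        (starRingEnd ℂ) (mlRelax α 1 (Complex.exp ζ) t) *
          mlRelax α (1 + γ) (Complex.exp ζ) t := by
    rw [← intervalIntegral.integral_const_mul, intervalIntegral.integral_of_le hT.le,
      intervalIntegral.integral_of_le hT.le]
    refine setIntegral_congr_fun measurableSet_Ioc fun t ht => ?_
    rw [integral_sub_rpow_mul_mlRelax hα le_rfl hγ.1 _ ht.1]
    ring
  rw [e, mul_left_comm, Complex.re_ofReal_mul] at h
  exact nonneg_of_mul_nonneg_right h hG

lemma integral_norm_mlRelax_le_of_lt_one {α : ℝ} (hα : α ∈ Ioo (0 : ℝ) 1) {ζ : ℂ}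
    (hζ : |ζ.im| < (1 - α) * (Real.pi / 2)) {T : ℝ} (hT : 0 < T) :
    ∫ t in (0 : ℝ)..T, ‖mlRelax α 1 (Complex.exp ζ) t‖ ≤ T := by
  have h := re_exp_mul_integral_conj_mul_mlRelax_nonneg hα.1 hα hζ hT
  set c := Complex.exp ζ
  set u := mlRelax α 1 c with hu
  have huc : Continuous u := continuous_mlRelax hα.1 le_rfl c
  set v := mlRelax α (1 + α) c with hv
  have hvc : Continuous v :=
    continuous_mlRelax hα.1 (by linarith [hα.1]) c
  rw [← intervalIntegral.integral_const_mul] at h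
  have hi : IntervalIntegrable
      (fun t => c * ((starRingEnd ℂ) (u t) * v t)) volume 0 T :=
    Continuous.intervalIntegrable (by fun_prop) _ _
  have hre := Complex.reCLM.intervalIntegral_comp_comm hi
  simp only [Complex.reCLM_apply] at hre
  rw [← hre] at h
  have hle : ∫ t in (0 : ℝ)..T, (c * ((starRingEnd ℂ) (u t) * v t)).re ≤
      ∫ t in (0 : ℝ)..T, (1 - ‖u t‖) := by
    rw [intervalIntegral.integral_of_le hT.le, intervalIntegral.integral_of_le hT.le]
    refine setIntegral_mono_on ?_ ?_ measurableSet_Ioc fun t ht => ?_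
    · exact Continuous.integrableOn_Ioc (by fun_prop)
    · exact Continuous.integrableOn_Ioc (by fun_prop)
    · have e : u t = 1 - c * v t := by
        rw [hu, mlRelax_eq_sub hα.1 le_rfl c ht.1]
        simp [hv]
      have e2 : c * ((starRingEnd ℂ) (u t) * v t) =
          (starRingEnd ℂ) (u t) - (starRingEnd ℂ) (u t) * u t := by
        linear_combination ((starRingEnd ℂ) (u t)) * e
      rw [e2, ← Complex.normSq_eq_conj_mul_self, Complex.sub_re, Complex.ofReal_re,
        Complex.conj_re, Complex.normSq_eq_norm_sq]
      nlinarith [Complex.re_le_norm (u t), sq_nonneg (1 - ‖u t‖)]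
  have h2 := h.trans hle
  rw [intervalIntegral.integral_sub (Continuous.intervalIntegrable (by fun_prop) _ _)
    (Continuous.intervalIntegrable (by fun_prop) _ _)] at h2
  simpa using h2

lemma integral_norm_mlRelax_le_of_one_lt {α : ℝ} (hα : α ∈ Ioo (1 : ℝ) 2) {ζ : ℂ}
    (hζ : |ζ.im| < (2 - α) * (Real.pi / 2)) {T : ℝ} (hT : 0 < T) :
    ∫ t in (0 : ℝ)..T, ‖mlRelax α 1 (Complex.exp ζ) t‖ ≤ T := by
  have hα0 : 0 < α := by linarith [hα.1]
  set c := Complex.exp ζ with hc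
  set u := mlRelax α 1 c with hu
  set v := mlRelax α α c with hv
  have huc : Continuous u := continuous_mlRelax hα0 le_rfl c
  have hvc : Continuous v := continuous_mlRelax hα0 hα.1.le c
  set y : ℝ → ℂ := fun t => 1 - c * ∫ s in (0 : ℝ)..t, v s with hy
  have hyu : ∀ t, 0 < t → y t = u t := by
    intro t ht
    rw [hu, mlRelax_eq_sub hα0 le_rfl c ht, hy]
    simp only
    rw [hv, integral_mlRelax hα0 hα.1.le c ht, add_comm α 1]
    simp
  have hder : ∀ t, HasDerivAt y (-(c * v t)) t := fun t =>
    ((hvc.integral_hasStrictDerivAt 0 t).hasDerivAt.const_mul c).const_sub 1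
  have hyc : Continuous y := continuous_iff_continuousAt.2 fun t => (hder t).continuousAt
  have hbound : ∀ t, 0 < t → ‖u t‖ ≤ 1 := by
    intro t ht
    have h := re_exp_mul_integral_conj_mul_mlRelax_nonneg hα0 (γ := α - 1)
      ⟨by linarith [hα.1], by linarith [hα.2]⟩ (ζ := ζ) (by convert hζ using 2; ring) ht
    rw [add_sub_cancel, ← hc, ← hu, ← hv, ← intervalIntegral.integral_const_mul] at h
    have hi : IntervalIntegrable
        (fun t => c * ((starRingEnd ℂ) (u t) * v t)) volume 0 t :=
      Continuous.intervalIntegrable (by fun_prop) _ _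
    have hre := Complex.reCLM.intervalIntegral_comp_comm hi
    simp only [Complex.reCLM_apply] at hre
    rw [← hre] at h
    have hFTC : ∫ s in (0 : ℝ)..t, 2 * inner ℝ (y s) (-(c * v s)) = ‖y t‖ ^ 2 - ‖y 0‖ ^ 2 :=
      intervalIntegral.integral_eq_sub_of_hasDerivAt (fun t _ => (hder t).norm_sq)
        (Continuous.intervalIntegrable (by fun_prop) _ _)
    have e : ∫ s in (0 : ℝ)..t, 2 * inner ℝ (y s) (-(c * v s)) =
        ∫ s in (0 : ℝ)..t, (-2) * (c * ((starRingEnd ℂ) (u s) * v s)).re := by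
      rw [intervalIntegral.integral_of_le ht.le, intervalIntegral.integral_of_le ht.le]
      refine setIntegral_congr_fun measurableSet_Ioc fun s hs => ?_
      rw [hyu s hs.1, Complex.inner, mul_left_comm c, neg_mul, Complex.neg_re,
        mul_comm (c * v s)]
      ring
    rw [e, intervalIntegral.integral_const_mul, hyu t ht] at hFTC
    have hy0 : y 0 = 1 := by simp [hy]
    rw [hy0, norm_one] at hFTC
    have : ‖u t‖ ^ 2 ≤ 1 := by linarith
    exact (sq_le_one_iff₀ (norm_nonneg _)).1 this
  calc ∫ t in (0 : ℝ)..T, ‖u t‖ ≤ ∫ t in (0 : ℝ)..T, (1 : ℝ) := by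
        rw [intervalIntegral.integral_of_le hT.le, intervalIntegral.integral_of_le hT.le]
        refine setIntegral_mono_on ?_ ?_ measurableSet_Ioc fun t ht => hbound t ht.1
        · exact Continuous.integrableOn_Ioc (by fun_prop)
        · exact Continuous.integrableOn_Ioc (by fun_prop)
    _ = T := by simp

/-- Uniform mean bound for `t ↦ E_{α,1}(-c t ^ α)` with `c` in a sector about `(0, ∞)`. -/
lemma exists_integral_norm_mlRelax_le {α : ℝ} (hα : α ∈ Ioo (0 : ℝ) 2) (hα1 : α ≠ 1) :
    ∃ δ > 0, ∀ ζ : ℂ, |ζ.im| < δ → ∀ T : ℝ, 0 < T →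
      ∫ t in (0 : ℝ)..T, ‖mlRelax α 1 (Complex.exp ζ) t‖ ≤ T := by
  rcases lt_or_gt_of_ne hα1 with h | h
  · exact ⟨(1 - α) * (Real.pi / 2), mul_pos (by linarith) (by positivity), fun ζ hζ T hT =>
      integral_norm_mlRelax_le_of_lt_one ⟨hα.1, h⟩ hζ hT⟩
  · exact ⟨(2 - α) * (Real.pi / 2), mul_pos (by linarith [hα.2]) (by positivity), fun ζ hζ T hT =>
      integral_norm_mlRelax_le_of_one_lt ⟨h, hα.2⟩ hζ hT⟩

lemma norm_mlRelax_two_le {α : ℝ} (hα : 0 < α) {c : ℂ} {t : ℝ} (ht : 0 < t)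
    (h : ∫ s in (0 : ℝ)..t, ‖mlRelax α 1 c s‖ ≤ t) : ‖mlRelax α 2 c t‖ ≤ t := by
  have e := integral_mlRelax hα le_rfl c ht
  rw [one_add_one_eq_two] at e
  rw [← e]
  exact (intervalIntegral.norm_integral_le_integral_norm ht.le).trans h

lemma norm_mlComplex_two_le {α : ℝ} (hα : 0 < α) {c : ℂ}
    (h : ∫ s in (0 : ℝ)..1, ‖mlRelax α 1 c s‖ ≤ 1) : ‖mlComplex α 2 (-c)‖ ≤ 1 := by
  simpa [mlRelax] using norm_mlRelax_two_le hα one_pos h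

lemma integrableOn_exp_mul_mlRelax_two {α : ℝ} (hα : 0 < α) {c : ℂ} {s : ℝ} (hs : 0 < s)
    (h : ∀ t, 0 < t → ‖mlRelax α 2 c t‖ ≤ t) :
    IntegrableOn (fun t => (Real.exp (-(s * t)) : ℂ) * mlRelax α 2 c t) (Ioi 0) := by
  refine Integrable.mono' (integrableOn_rpow_mul_exp_neg_mul (q := 1) (by norm_num) hs) ?_ ?_
  · have := continuous_mlRelax hα one_le_two c
    exact Continuous.aestronglyMeasurable (by fun_prop)
  · refine (ae_restrict_iff' measurableSet_Ioi).2 (Eventually.of_forall fun t ht => ?_)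
    rw [norm_mul, Complex.norm_real, Real.norm_eq_abs, abs_of_pos (Real.exp_pos _), Real.rpow_one,
      mul_comm]
    exact mul_le_mul_of_nonneg_right (h t ht) (Real.exp_pos _).le

/-- The Laplace transform of `t ↦ t E_{α,2}(-c t ^ α)`. -/
lemma integral_exp_mul_mlRelax_two {α : ℝ} (hα : 0 < α) {c : ℂ} {s : ℝ} (hs : 0 < s)
    (h : ∀ t, 0 < t → ‖mlRelax α 2 c t‖ ≤ t) :
    (∫ t in Ioi (0 : ℝ), (Real.exp (-(s * t)) : ℂ) * mlRelax α 2 c t) *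
      (1 + c * ((s ^ (-α) : ℝ) : ℂ)) = ((s ^ (-2 : ℝ) : ℝ) : ℂ) := by
  have hv := integrableOn_exp_mul_mlRelax_two hα hs h
  have hpow : ∀ p : ℝ, 0 < p → ∫ t in Ioi (0 : ℝ), ((t ^ (p - 1) * Real.exp (-(s * t)) : ℝ) : ℂ) =
      ((s ^ (-p) * Real.Gamma p : ℝ) : ℂ) := fun p hp => by
    rw [integral_complex_ofReal, Real.integral_rpow_mul_exp_neg_mul_Ioi hp hs, one_div,
      Real.inv_rpow hs.le, Real.rpow_neg hs.le]
  have hg : ∀ p : ℝ, 0 < p →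
      IntegrableOn (fun t => ((t ^ (p - 1) * Real.exp (-(s * t)) : ℝ) : ℂ)) (Ioi 0) :=
    fun p hp => (integrableOn_rpow_mul_exp_neg_mul (by linarith) hs).ofReal
  have hconv := integral_posConvolution hv (hg α hα) (ContinuousLinearMap.mul ℝ ℂ)
  simp only [ContinuousLinearMap.mul_apply'] at hconv
  rw [hpow α hα] at hconv
  set N := ∫ t in Ioi (0 : ℝ), (Real.exp (-(s * t)) : ℂ) * mlRelax α 2 c t with hN
  have e1 : ∫ x in Ioi (0 : ℝ), ∫ t in (0 : ℝ)..x, (Real.exp (-(s * t)) : ℂ) * mlRelax α 2 c t *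
      (((x - t) ^ (α - 1) * Real.exp (-(s * (x - t))) : ℝ) : ℂ) =
      Real.Gamma α * ∫ x in Ioi (0 : ℝ), (Real.exp (-(s * x)) : ℂ) * mlRelax α (2 + α) c x := by
    rw [← integral_const_mul]
    refine setIntegral_congr_fun measurableSet_Ioi fun x hx => ?_
    rw [mul_left_comm, ← integral_sub_rpow_mul_mlRelax hα one_le_two hα c hx,
      ← intervalIntegral.integral_const_mul]
    refine intervalIntegral.integral_congr fun t _ => ?_
    rw [show -(s * x) = -(s * t) + -(s * (x - t)) by ring, Real.exp_add]
    push_cast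
    ring
  have e2 : c * ∫ x in Ioi (0 : ℝ), (Real.exp (-(s * x)) : ℂ) * mlRelax α (2 + α) c x =
      ((s ^ (-2 : ℝ) : ℝ) : ℂ) - N := by
    have h2 := hpow 2 two_pos
    rw [Real.Gamma_two, mul_one] at h2
    rw [← h2, hN, ← integral_sub (hg 2 two_pos) hv, ← integral_const_mul]
    refine setIntegral_congr_fun measurableSet_Ioi fun x hx => ?_
    rw [mlRelax_eq_sub hα one_le_two c hx, Real.Gamma_two]
    push_cast
    ring
  rw [e1] at hconv
  have hG : (Real.Gamma α : ℂ) ≠ 0 := by exact_mod_cast (Real.Gamma_pos_of_pos hα).ne'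
  have e3 : ∫ x in Ioi (0 : ℝ), (Real.exp (-(s * x)) : ℂ) * mlRelax α (2 + α) c x =
      N * ((s ^ (-α) : ℝ) : ℂ) := by
    apply mul_left_cancel₀ hG
    rw [hconv]
    push_cast
    ring
  rw [e3] at e2
  linear_combination e2

lemma integral_norm_mlRelax_ofReal_le {α δ : ℝ} (hδ : 0 < δ)
    (hB : ∀ ζ : ℂ, |ζ.im| < δ → ∀ T : ℝ, 0 < T →
      ∫ t in (0 : ℝ)..T, ‖mlRelax α 1 (Complex.exp ζ) t‖ ≤ T) {μ : ℝ} (hμ : 0 < μ) {T : ℝ}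
    (hT : 0 < T) : ∫ t in (0 : ℝ)..T, ‖mlRelax α 1 μ t‖ ≤ T := by
  have h := hB (Real.log μ : ℝ) (by simpa using hδ) T hT
  rwa [← Complex.ofReal_exp, Real.exp_log hμ] at h

lemma tsum_mul_mlRelax_two {α δ : ℝ} (hα : 0 < α) (hδ : 0 < δ)
    (hB : ∀ ζ : ℂ, |ζ.im| < δ → ∀ T : ℝ, 0 < T →
      ∫ t in (0 : ℝ)..T, ‖mlRelax α 1 (Complex.exp ζ) t‖ ≤ T) {a μ : ℕ → ℝ}
    (ha : Summable fun k => |a k|) (hμ : ∀ k, 0 < μ k) {T : ℝ} (hT : 0 < T) :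
    ∑' k, (a k : ℂ) * mlRelax α 2 (μ k) T =
      ∫ t in (0 : ℝ)..T, ∑' k, (a k : ℂ) * mlRelax α 1 (μ k) t := by
  rw [intervalIntegral.integral_of_le hT.le]
  have h := hasSum_integral_of_summable_integral_norm (μ := volume.restrict (Ioc 0 T))
    (F := fun k t => (a k : ℂ) * mlRelax α 1 (μ k) t) (fun k => ?_) ?_
  · rw [← h.tsum_eq]
    refine tsum_congr fun k => ?_
    rw [integral_const_mul, ← intervalIntegral.integral_of_le hT.le,
      integral_mlRelax hα le_rfl _ hT, one_add_one_eq_two]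
  · have := continuous_mlRelax hα le_rfl (μ k : ℂ)
    exact Continuous.integrableOn_Ioc (by fun_prop)
  · refine Summable.of_nonneg_of_le (fun k => integral_nonneg fun t => norm_nonneg _)
      (fun k => ?_) (ha.mul_right T)
    simp only [norm_mul, Complex.norm_real, Real.norm_eq_abs]
    rw [integral_const_mul, ← intervalIntegral.integral_of_le hT.le]
    exact mul_le_mul_of_nonneg_left (integral_norm_mlRelax_ofReal_le hδ hB (hμ k) hT)
      (abs_nonneg _)

/-- The Mittag-Leffler series in the logarithmic time variable. -/
noncomputable def mlSeries (α : ℝ) (a μ : ℕ → ℝ) (z : ℂ) : ℂ :=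
  ∑' k, (a k : ℂ) * mlComplex α 2 (-Complex.exp ((Real.log (μ k) : ℂ) + α * z))

lemma tsum_mul_mlRelax_two_exp {α : ℝ} {a μ : ℕ → ℝ} (hμ : ∀ k, 0 < μ k) (x : ℝ) :
    ∑' k, (a k : ℂ) * mlRelax α 2 (μ k) (Real.exp x) = Real.exp x * mlSeries α a μ x := by
  rw [mlSeries, ← tsum_mul_left]
  refine tsum_congr fun k => ?_
  rw [mlRelax, mul_left_comm, Complex.exp_add, ← Complex.ofReal_exp, Real.exp_log (hμ k),
    show (2 : ℝ) - 1 = 1 by norm_num, Real.rpow_one, ← Real.exp_mul, neg_mul, mul_comm x,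
    Complex.ofReal_exp (α * x), Complex.ofReal_mul]

lemma differentiableOn_mlSeries {α δ : ℝ} (hα : 0 < α)
    (hB : ∀ ζ : ℂ, |ζ.im| < δ → ∀ T : ℝ, 0 < T →
      ∫ t in (0 : ℝ)..T, ‖mlRelax α 1 (Complex.exp ζ) t‖ ≤ T) {a μ : ℕ → ℝ}
    (ha : Summable fun k => |a k|) {ε : ℝ} (hε : ε ≤ δ / α) :
    DifferentiableOn ℂ (mlSeries α a μ) {z | |z.im| < ε} := by
  refine Complex.differentiableOn_tsum_of_summable_norm ha (fun k => ?_) (isOpen_abs_im_lt ε)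
    fun k z hz => ?_
  · have := differentiable_mlComplex hα one_le_two
    exact Differentiable.differentiableOn (by fun_prop)
  · rw [norm_mul, Complex.norm_real, Real.norm_eq_abs]
    refine mul_le_of_le_one_right (abs_nonneg _) (norm_mlComplex_two_le hα (hB _ ?_ 1 one_pos))
    have him : |z.im| < δ / α := lt_of_lt_of_le hz hε
    rw [lt_div_iff₀ hα] at him
    simpa [abs_mul, abs_of_pos hα, mul_comm] using him

/-- The Laplace transform of the integrated Mittag-Leffler series. -/
lemma integral_exp_mul_tsum_mlRelax_two {α δ : ℝ} (hα : 0 < α) (hδ : 0 < δ)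
    (hB : ∀ ζ : ℂ, |ζ.im| < δ → ∀ T : ℝ, 0 < T →
      ∫ t in (0 : ℝ)..T, ‖mlRelax α 1 (Complex.exp ζ) t‖ ≤ T) {a μ : ℕ → ℝ}
    (ha : Summable fun k => |a k|) (hμ : ∀ k, 0 < μ k) {s : ℝ} (hs : 0 < s) :
    ∫ t in Ioi (0 : ℝ), (Real.exp (-(s * t)) : ℂ) * ∑' k, (a k : ℂ) * mlRelax α 2 (μ k) t =
      ((s ^ (-2 : ℝ) * (s ^ α * ∑' k, a k / (s ^ α + μ k)) : ℝ) : ℂ) := by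
  have hb : ∀ k t, 0 < t → ‖mlRelax α 2 (μ k) t‖ ≤ t := fun k t ht =>
    norm_mlRelax_two_le hα ht (integral_norm_mlRelax_ofReal_le hδ hB (hμ k) ht)
  have hint := fun k => integrableOn_exp_mul_mlRelax_two hα hs (hb k)
  have h := hasSum_integral_of_summable_integral_norm (μ := volume.restrict (Ioi 0))
    (F := fun k t => (a k : ℂ) * ((Real.exp (-(s * t)) : ℂ) * mlRelax α 2 (μ k) t))
    (fun k => (hint k).const_mul _) ?_
  · have e : ∫ t in Ioi (0 : ℝ), (Real.exp (-(s * t)) : ℂ) *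
        ∑' k, (a k : ℂ) * mlRelax α 2 (μ k) t =
        ∫ t in Ioi (0 : ℝ), ∑' k, (a k : ℂ) * ((Real.exp (-(s * t)) : ℂ) * mlRelax α 2 (μ k) t) := by
      refine setIntegral_congr_fun measurableSet_Ioi fun t _ => ?_
      rw [← tsum_mul_left]
      exact tsum_congr fun k => mul_left_comm _ _ _
    rw [e, ← h.tsum_eq, ← tsum_mul_left, ← tsum_mul_left, Complex.ofReal_tsum]
    refine tsum_congr fun k => ?_
    have hl := integral_exp_mul_mlRelax_two hα hs (hb k)
    have hsα : 0 < s ^ α := Real.rpow_pos_of_pos hs _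
    have hne : (1 + (μ k : ℂ) * ((s ^ (-α) : ℝ) : ℂ)) ≠ 0 := by
      have : 0 < 1 + μ k * s ^ (-α) := by have := hμ k; positivity
      exact_mod_cast this.ne'
    have hne2 : s ^ α + μ k ≠ 0 := by have := hμ k; positivity
    rw [integral_const_mul, eq_div_of_mul_eq hne hl]
    rw [← Complex.ofReal_mul, ← Complex.ofReal_one, ← Complex.ofReal_add, ← Complex.ofReal_div,
      ← Complex.ofReal_mul, Real.rpow_neg hs.le α]
    congr 1
    field_simp
  · refine Summable.of_nonneg_of_le (fun k => integral_nonneg fun t => norm_nonneg _)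
      (fun k => ?_) (ha.mul_right (∫ t in Ioi (0 : ℝ), t ^ (1 : ℝ) * Real.exp (-(s * t))))
    simp only [norm_mul (a k : ℂ), Complex.norm_real, Real.norm_eq_abs]
    rw [integral_const_mul]
    refine mul_le_mul_of_nonneg_left ?_ (abs_nonneg _)
    refine setIntegral_mono_on (hint k).norm
      (integrableOn_rpow_mul_exp_neg_mul (by norm_num) hs) measurableSet_Ioi fun t ht => ?_
    rw [norm_mul, Complex.norm_real, Real.norm_eq_abs, abs_of_pos (Real.exp_pos _), Real.rpow_one,
      mul_comm]
    exact mul_le_mul_of_nonneg_right (hb k t ht) (Real.exp_pos _).le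

lemma ofReal_mittagLeffler (α x : ℝ) : (mittagLeffler α x : ℂ) = mlComplex α 1 x := by
  rw [mittagLeffler, mlComplex, Complex.ofReal_tsum]
  push_cast
  rfl

/-- Two Mittag-Leffler series that agree on `(0, T)` have the same Laplace transform. -/
lemma rpow_mul_tsum_div_eq_of_forall_mittagLeffler_eq {α α₁ : ℝ} (hα : α ∈ Ioo (0 : ℝ) 2)
    (hα1 : α ≠ 1) (hα₁ : α₁ ∈ Ioo (0 : ℝ) 2) (hα₁1 : α₁ ≠ 1) {a μ ν : ℕ → ℝ}
    (ha : Summable fun k => |a k|) (hμ : ∀ k, 0 < μ k) (hν : ∀ k, 0 < ν k) {T : ℝ} (hT : 0 < T)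
    (h : ∀ t ∈ Ioo (0 : ℝ) T, ∑' k, a k * mittagLeffler α (-μ k * t ^ α) =
      ∑' k, a k * mittagLeffler α₁ (-ν k * t ^ α₁)) {s : ℝ} (hs : 0 < s) :
    s ^ α * ∑' k, a k / (s ^ α + μ k) = s ^ α₁ * ∑' k, a k / (s ^ α₁ + ν k) := by
  obtain ⟨δ, hδ, hB⟩ := exists_integral_norm_mlRelax_le hα hα1
  obtain ⟨δ₁, hδ₁, hB₁⟩ := exists_integral_norm_mlRelax_le hα₁ hα₁1
  have hrel : ∀ (α : ℝ) (μ : ℕ → ℝ) (t : ℝ), ∑' k, (a k : ℂ) * mlRelax α 1 (μ k) t =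
      ((∑' k, a k * mittagLeffler α (-μ k * t ^ α) : ℝ) : ℂ) := fun α μ t => by
    rw [Complex.ofReal_tsum]
    refine tsum_congr fun k => ?_
    rw [Complex.ofReal_mul, ofReal_mittagLeffler, mlRelax, sub_self, Real.rpow_zero]
    push_cast
    rw [one_mul]
  have hshort : ∀ τ ∈ Ioo (0 : ℝ) T, ∑' k, (a k : ℂ) * mlRelax α 2 (μ k) τ =
      ∑' k, (a k : ℂ) * mlRelax α₁ 2 (ν k) τ := fun τ hτ => by
    rw [tsum_mul_mlRelax_two hα.1 hδ hB ha hμ hτ.1, tsum_mul_mlRelax_two hα₁.1 hδ₁ hB₁ ha hν hτ.1,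
      intervalIntegral.integral_of_le hτ.1.le, intervalIntegral.integral_of_le hτ.1.le]
    refine setIntegral_congr_fun measurableSet_Ioc fun t ht => ?_
    rw [hrel, hrel, h t ⟨ht.1, ht.2.trans_lt hτ.2⟩]
  have hstrip : EqOn (mlSeries α a μ) (mlSeries α₁ a ν) {z | |z.im| < min (δ / α) (δ₁ / α₁)} := by
    refine eqOn_strip (A := Real.log T) (lt_min (div_pos hδ hα.1) (div_pos hδ₁ hα₁.1))
      (differentiableOn_mlSeries hα.1 hB ha (min_le_left _ _))
      (differentiableOn_mlSeries hα₁.1 hB₁ ha (min_le_right _ _)) fun x hx => ?_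
    have e := hshort (Real.exp x) ⟨Real.exp_pos _, by rwa [← Real.lt_log_iff_exp_lt hT]⟩
    rw [tsum_mul_mlRelax_two_exp hμ, tsum_mul_mlRelax_two_exp hν] at e
    exact mul_left_cancel₀ (by exact_mod_cast (Real.exp_pos x).ne') e
  have hall : ∀ t : ℝ, 0 < t → ∑' k, (a k : ℂ) * mlRelax α 2 (μ k) t =
      ∑' k, (a k : ℂ) * mlRelax α₁ 2 (ν k) t := fun t ht => by
    rw [← Real.exp_log ht, tsum_mul_mlRelax_two_exp hμ, tsum_mul_mlRelax_two_exp hν, hstrip]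
    simpa using And.intro (div_pos hδ hα.1) (div_pos hδ₁ hα₁.1)
  have e := integral_exp_mul_tsum_mlRelax_two hα.1 hδ hB ha hμ hs
  rw [setIntegral_congr_fun measurableSet_Ioi fun t ht => by rw [hall t ht],
    integral_exp_mul_tsum_mlRelax_two hα₁.1 hδ₁ hB₁ ha hν hs, Complex.ofReal_inj] at e
  exact (mul_left_cancel₀ (Real.rpow_pos_of_pos hs _).ne' e).symm

lemma tendsto_tsum_div_add {b μ : ℕ → ℝ} {m : ℝ} (hb : Summable fun k => |b k|) (hm : 0 < m)
    (hμ : ∀ k, m ≤ μ k) :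
    Tendsto (fun w : ℝ => ∑' k, b k / (w + μ k)) (𝓝[>] 0) (𝓝 (∑' k, b k / μ k)) := by
  refine tendsto_tsum_of_dominated_convergence (bound := fun k => |b k| / m) (hb.div_const m)
    (fun k => ?_) ?_
  · have hk : (0 : ℝ) + μ k ≠ 0 := by linarith [hμ k]
    have : ContinuousAt (fun w : ℝ => b k / (w + μ k)) 0 := by fun_prop (disch := assumption)
    simpa using this.tendsto.mono_left nhdsWithin_le_nhds
  · filter_upwards [self_mem_nhdsWithin] with w (hw : 0 < w) k
    have hk := hμ k
    rw [norm_div, Real.norm_eq_abs, Real.norm_eq_abs, abs_of_pos (by linarith : 0 < w + μ k)]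
    gcongr
    linarith

/-- If the Stieltjes-type sums agree after rescaling by distinct powers, the second one has zero
mass at the origin. -/
lemma tsum_div_eq_zero_of_rpow_lt {α α₁ : ℝ} (hα₁ : 0 < α₁) (hlt : α₁ < α) {a μ ν : ℕ → ℝ} {m : ℝ}
    (ha : Summable fun k => |a k|) (hm : 0 < m) (hμ : ∀ k, m ≤ μ k) {n : ℝ} (hn : 0 < n)
    (hν : ∀ k, n ≤ ν k)
    (h : ∀ s : ℝ, 0 < s →
      s ^ α * ∑' k, a k / (s ^ α + μ k) = s ^ α₁ * ∑' k, a k / (s ^ α₁ + ν k)) :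
    ∑' k, a k / ν k = 0 := by
  have hpow : ∀ p : ℝ, 0 < p → Tendsto (fun s : ℝ => s ^ p) (𝓝[>] 0) (𝓝[>] 0) := fun p hp => by
    refine tendsto_nhdsWithin_iff.2 ⟨?_, ?_⟩
    · have := (Real.continuousAt_rpow_const 0 p (Or.inr hp.le)).tendsto
      rw [Real.zero_rpow hp.ne'] at this
      exact this.mono_left nhdsWithin_le_nhds
    · filter_upwards [self_mem_nhdsWithin] with s hs using Real.rpow_pos_of_pos hs p
  have h1 := (tendsto_tsum_div_add ha hn hν).comp (hpow α₁ hα₁)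
  have h2 := ((hpow (α - α₁) (by linarith)).mono_right nhdsWithin_le_nhds).mul
    ((tendsto_tsum_div_add ha hm hμ).comp (hpow α (by linarith)))
  rw [zero_mul] at h2
  refine tendsto_nhds_unique (h1.congr' ?_) h2
  filter_upwards [self_mem_nhdsWithin] with s (hs : 0 < s)
  have hs1 : 0 < s ^ α₁ := Real.rpow_pos_of_pos hs _
  apply mul_left_cancel₀ hs1.ne'
  simp only [Function.comp_apply]
  rw [← h s hs, ← mul_assoc, ← Real.rpow_add hs, add_sub_cancel]

lemma summable_abs_mul_inv_pow {a μ : ℕ → ℝ} {m : ℝ} (ha : Summable fun k => |a k|) (hm : 0 < m)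
    (hμ : ∀ k, m ≤ μ k) (n : ℕ) : Summable fun k => |a k * (μ k)⁻¹ ^ n| := by
  refine Summable.of_nonneg_of_le (fun k => abs_nonneg _) (fun k => ?_) (ha.mul_right (m⁻¹ ^ n))
  have hk : 0 < μ k := hm.trans_le (hμ k)
  rw [abs_mul, abs_of_pos (by positivity : 0 < (μ k)⁻¹ ^ n)]
  have := hμ k
  gcongr

lemma tsum_mul_inv_pow_div_add {a μ : ℕ → ℝ} {m : ℝ} (ha : Summable fun k => |a k|) (hm : 0 < m)
    (hμ : ∀ k, m ≤ μ k) (n : ℕ) {w : ℝ} (hw : 0 < w) :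
    ∑' k, a k * (μ k)⁻¹ ^ n / (w + μ k) =
      ∑' k, a k * (μ k)⁻¹ ^ (n + 1) - w * ∑' k, a k * (μ k)⁻¹ ^ (n + 1) / (w + μ k) := by
  have h1 := summable_abs_mul_inv_pow ha hm hμ (n + 1)
  have h2 : Summable fun k => a k * (μ k)⁻¹ ^ (n + 1) / (w + μ k) := by
    refine Summable.of_norm_bounded (h1.div_const w) fun k => ?_
    have hk := hm.trans_le (hμ k)
    rw [norm_div, Real.norm_eq_abs, Real.norm_eq_abs, abs_of_pos (by positivity : 0 < w + μ k)]
    gcongr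
    linarith
  rw [← tsum_mul_left, ← h1.of_abs.tsum_sub (h2.mul_left w)]
  refine tsum_congr fun k => ?_
  have hk := hm.trans_le (hμ k)
  rw [pow_succ]
  field_simp
  ring

/-- Equality of Stieltjes-type sums on the half line implies equality of all inverse moments. -/
lemma tsum_mul_inv_pow_eq {a μ ν : ℕ → ℝ} {m n : ℝ} (ha : Summable fun k => |a k|) (hm : 0 < m)
    (hμ : ∀ k, m ≤ μ k) (hn : 0 < n) (hν : ∀ k, n ≤ ν k)
    (h : ∀ w : ℝ, 0 < w → ∑' k, a k / (w + μ k) = ∑' k, a k / (w + ν k)) (j : ℕ) :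
    ∑' k, a k * (μ k)⁻¹ ^ j = ∑' k, a k * (ν k)⁻¹ ^ j := by
  have hstep : ∀ j, (∀ w : ℝ, 0 < w →
      ∑' k, a k * (μ k)⁻¹ ^ j / (w + μ k) = ∑' k, a k * (ν k)⁻¹ ^ j / (w + ν k)) →
      ∑' k, a k * (μ k)⁻¹ ^ (j + 1) = ∑' k, a k * (ν k)⁻¹ ^ (j + 1) := fun j hj => by
    have h1 := tendsto_tsum_div_add (summable_abs_mul_inv_pow ha hm hμ j) hm hμ
    have h2 := tendsto_tsum_div_add (summable_abs_mul_inv_pow ha hn hν j) hn hν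
    have e := tendsto_nhds_unique_of_eventuallyEq h1 h2
      (by filter_upwards [self_mem_nhdsWithin] with w hw using hj w hw)
    simpa only [pow_succ, div_eq_mul_inv, mul_assoc] using e
  have hall : ∀ j, ∀ w : ℝ, 0 < w →
      ∑' k, a k * (μ k)⁻¹ ^ j / (w + μ k) = ∑' k, a k * (ν k)⁻¹ ^ j / (w + ν k) := fun j => by
    induction j with
    | zero => simpa using h
    | succ j ih =>
      intro w hw
      have e := ih w hw
      rw [tsum_mul_inv_pow_div_add ha hm hμ j hw, tsum_mul_inv_pow_div_add ha hn hν j hw,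
        hstep j ih] at e
      exact mul_left_cancel₀ hw.ne' (sub_right_injective e)
  cases j with
  | zero => simp
  | succ j => exact hstep j (hall j)

/-- Equality of all moments rules out a strictly larger leading node. -/
lemma eq_zero_of_tsum_mul_pow_eq {b x y : ℕ → ℝ} {k₀ : ℕ} (hb : Summable fun k => |b k|)
    (hb0 : ∀ k < k₀, b k = 0) (hx : ∀ k, 0 ≤ x k) (hy : ∀ k, 0 ≤ y k)
    (hxlt : ∀ k, k₀ < k → x k < x k₀) (hyle : ∀ k, k₀ ≤ k → y k ≤ y k₀) (hyx : y k₀ < x k₀)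
    (h : ∀ n : ℕ, ∑' k, b k * x k ^ n = ∑' k, b k * y k ^ n) : b k₀ = 0 := by
  have hX : 0 < x k₀ := (hy k₀).trans_lt hyx
  have hbd : ∀ z : ℕ → ℝ, (∀ k, 0 ≤ z k) → (∀ k, k₀ ≤ k → z k ≤ x k₀) →
      ∀ (n k : ℕ), ‖b k * (z k / x k₀) ^ n‖ ≤ |b k| := fun z hz0 hz n k => by
    rcases lt_or_ge k k₀ with hk | hk
    · simp [hb0 k hk]
    · rw [norm_mul, Real.norm_eq_abs, norm_pow, Real.norm_eq_abs,
        abs_of_nonneg (div_nonneg (hz0 k) hX.le)]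
      exact mul_le_of_le_one_right (abs_nonneg _)
        (pow_le_one₀ (div_nonneg (hz0 k) hX.le) ((div_le_one hX).2 (hz k hk)))
  have hlim : ∀ z : ℕ → ℝ, (∀ k, 0 ≤ z k) → ∀ k, z k < x k₀ →
      Tendsto (fun n : ℕ => b k * (z k / x k₀) ^ n) atTop (𝓝 0) := fun z hz0 k hz => by
    simpa using (tendsto_pow_atTop_nhds_zero_of_lt_one (div_nonneg (hz0 k) hX.le)
      ((div_lt_one hX).2 hz)).const_mul (b k)
  have hxle : ∀ k, k₀ ≤ k → x k ≤ x k₀ := fun k hk => by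
    rcases hk.eq_or_lt with rfl | hk
    · exact le_rfl
    · exact (hxlt k hk).le
  have h1 := tendsto_tsum_of_dominated_convergence (𝓕 := atTop)
    (f := fun (n : ℕ) k => b k * (x k / x k₀) ^ n) (g := fun k => if k = k₀ then b k₀ else 0) hb
    (fun k => ?_) (Eventually.of_forall fun n => hbd x hx hxle n)
  · have h2 := tendsto_tsum_of_dominated_convergence (𝓕 := atTop)
      (f := fun (n : ℕ) k => b k * (y k / x k₀) ^ n) (g := fun _ => 0) hb
      (fun k => ?_) (Eventually.of_forall fun n =>
        hbd y hy (fun k hk => (hyle k hk).trans hyx.le) n)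
    · rw [tsum_ite_eq] at h1
      rw [tsum_zero] at h2
      refine tendsto_nhds_unique h1 (h2.congr fun n => ?_)
      simp only [div_pow, ← mul_div_assoc]
      rw [tsum_div_const, tsum_div_const, h n]
    · rcases lt_or_ge k k₀ with hk | hk
      · simp [hb0 k hk]
      · exact hlim y hy k ((hyle k hk).trans_lt hyx)
  · rcases lt_trichotomy k k₀ with hk | rfl | hk
    · simp [hb0 k hk, hk.ne]
    · simp [hX.ne']
    · simpa [hk.ne'] using hlim x hx k (hxlt k hk)

theorem order_uniqueness
    (lam : ℕ → ℝ) (hmono : StrictMono lam) (hpos : ∀ k, 0 < lam k)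
    (htend : Filter.Tendsto lam Filter.atTop Filter.atTop)
    (a : ℕ → ℝ) (hsum : Summable (fun k => |a k|))
    (k₀ : ℕ) (hak₀ : a k₀ ≠ 0) (hlamk₀ : lam k₀ ≠ 1)
    (hbelow : ∀ k < k₀, lam k ≠ 1 → a k = 0)
    (α α₁ : ℝ) (hα : α ∈ Set.Ioo (0 : ℝ) 2) (hα1 : α ≠ 1)
    (hα₁ : α₁ ∈ Set.Ioo (0 : ℝ) 2) (hα₁1 : α₁ ≠ 1)
    (β β₁ : ℝ) (hβ : β ∈ Set.Ioo (0 : ℝ) 1) (hβ₁ : β₁ ∈ Set.Ioo (0 : ℝ) 1)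
    (T : ℝ) (hT : 0 < T)
    (hne : (∑' k, a k * (lam k) ^ (-β)) ≠ 0)
    (hne₁ : (∑' k, a k * (lam k) ^ (-β₁)) ≠ 0)
    (hobs : ∀ t ∈ Set.Ioo (0 : ℝ) T,
      (∑' k, a k * mittagLeffler α (-(lam k) ^ β * t ^ α))
        = ∑' k, a k * mittagLeffler α₁ (-(lam k) ^ β₁ * t ^ α₁)) :
    α = α₁ ∧ β = β₁ := by
  have hpow : ∀ b ∈ Ioo (0 : ℝ) 1, StrictMono fun k => lam k ^ b := fun b hb i j hij =>
    Real.rpow_lt_rpow (hpos i).le (hmono hij) hb.1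
  have hppos : ∀ (b : ℝ) (k : ℕ), 0 < lam k ^ b := fun b k => Real.rpow_pos_of_pos (hpos k) b
  have hle : ∀ b ∈ Ioo (0 : ℝ) 1, ∀ k, lam 0 ^ b ≤ lam k ^ b := fun b hb k =>
    (hpow b hb).monotone (Nat.zero_le k)
  have hmean : ∀ b : ℝ, ∑' k, a k * lam k ^ (-b) = ∑' k, a k / lam k ^ b := fun b =>
    tsum_congr fun k => by rw [Real.rpow_neg (hpos k).le, div_eq_mul_inv]
  rw [hmean] at hne hne₁
  have hL : ∀ s : ℝ, 0 < s → s ^ α * ∑' k, a k / (s ^ α + lam k ^ β) =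
      s ^ α₁ * ∑' k, a k / (s ^ α₁ + lam k ^ β₁) := fun s hs =>
    rpow_mul_tsum_div_eq_of_forall_mittagLeffler_eq hα hα1 hα₁ hα₁1 hsum (hppos β) (hppos β₁) hT
      hobs hs
  have hαα : α = α₁ := by
    rcases lt_trichotomy α α₁ with hlt | heq | hlt
    · exact absurd (tsum_div_eq_zero_of_rpow_lt hα.1 hlt hsum (hppos β₁ 0) (hle β₁ hβ₁)
        (hppos β 0) (hle β hβ) fun s hs => (hL s hs).symm) hne
    · exact heq
    · exact absurd (tsum_div_eq_zero_of_rpow_lt hα₁.1 hlt hsum (hppos β 0) (hle β hβ)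
        (hppos β₁ 0) (hle β₁ hβ₁) hL) hne₁
  refine ⟨hαα, ?_⟩
  subst hαα
  have hS : ∀ w : ℝ, 0 < w →
      ∑' k, a k / (w + lam k ^ β) = ∑' k, a k / (w + lam k ^ β₁) := fun w hw => by
    have h := hL (w ^ α⁻¹) (Real.rpow_pos_of_pos hw _)
    rw [← Real.rpow_mul hw.le, inv_mul_cancel₀ hα.1.ne', Real.rpow_one] at h
    exact mul_left_cancel₀ hw.ne' h
  have hmom := tsum_mul_inv_pow_eq hsum (hppos β 0) (hle β hβ) (hppos β₁ 0) (hle β₁ hβ₁) hS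
  set b : ℕ → ℝ := fun k => if lam k = 1 then 0 else a k with hb
  have hbsum : Summable fun k => |b k| := by
    refine Summable.of_nonneg_of_le (fun k => abs_nonneg _) (fun k => ?_) hsum
    by_cases hk : lam k = 1 <;> simp [hb, hk]
  have hb0 : ∀ k < k₀, b k = 0 := fun k hk => by
    by_cases h1 : lam k = 1
    · simp [hb, h1]
    · simp [hb, h1, hbelow k hk h1]
  have hsplit : ∀ γ ∈ Ioo (0 : ℝ) 1, ∀ n : ℕ, ∑' k, b k * (lam k ^ γ)⁻¹ ^ n =
      ∑' k, a k * (lam k ^ γ)⁻¹ ^ n - ∑' k, (a k - b k) := fun γ hγ n => by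
    rw [← (summable_abs_mul_inv_pow hsum (hppos γ 0) (hle γ hγ) n).of_abs.tsum_sub
      (hsum.of_abs.sub hbsum.of_abs)]
    refine tsum_congr fun k => ?_
    by_cases h1 : lam k = 1 <;> simp [hb, h1]
  have hbmom : ∀ n : ℕ, ∑' k, b k * (lam k ^ β)⁻¹ ^ n = ∑' k, b k * (lam k ^ β₁)⁻¹ ^ n :=
    fun n => by rw [hsplit β hβ, hsplit β₁ hβ₁, hmom n]
  have hbk : b k₀ ≠ 0 := by simpa [hb, hlamk₀] using hak₀
  have hnot : ∀ γ ∈ Ioo (0 : ℝ) 1, ∀ γ' ∈ Ioo (0 : ℝ) 1,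
      (∀ n : ℕ, ∑' k, b k * (lam k ^ γ)⁻¹ ^ n = ∑' k, b k * (lam k ^ γ')⁻¹ ^ n) →
      ¬ lam k₀ ^ γ < lam k₀ ^ γ' := fun γ hγ γ' hγ' h hlt => by
    refine hbk (eq_zero_of_tsum_mul_pow_eq hbsum hb0 (fun k => (inv_pos.2 (hppos γ k)).le)
      (fun k => (inv_pos.2 (hppos γ' k)).le) (fun k hk => ?_) (fun k hk => ?_) ?_ h)
    · exact inv_strictAnti₀ (hppos γ k₀) (hpow γ hγ hk)
    · exact inv_anti₀ (hppos γ' k₀) ((hpow γ' hγ').monotone hk)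
    · exact inv_strictAnti₀ (hppos γ k₀) hlt
  have heq : lam k₀ ^ β = lam k₀ ^ β₁ :=
    le_antisymm (not_lt.1 (hnot β₁ hβ₁ β hβ fun n => (hbmom n).symm))
      (not_lt.1 (hnot β hβ β₁ hβ₁ hbmom))
  exact (Real.rpow_right_inj (hpos k₀) hlamk₀).1 heq
end

section
/- Let α, α₁ ∈ (0,2) with α ≠ 1 and α₁ ≠ 1, let p, p₁ ∈ ℝ with p ≠ 0 and p₁ ≠ 0, and let f : ℝ → ℝ. Assume that (fun t => f t - p / (Γ(1-α) * t^α)) is O(t^{-2α}) as t → ∞ and that (fun t => f t - p₁ / (Γ(1-α₁) * t^{α₁})) is O(t^{-2α₁}) as t → ∞ (big-O along the filter atTop). Then α = α₁ and p = p₁. -/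
open Filter Topology Asymptotics in
lemma tendsto_rpow_mul_of_sub_isBigO {f : ℝ → ℝ} {a g c : ℝ} (ha : 0 < a)
    (h : (fun t => f t - c / (g * t ^ a)) =O[atTop] fun t => t ^ (-(2 * a))) :
    Tendsto (fun t => t ^ a * f t) atTop (𝓝 (c / g)) := by
  have hmul : (fun t : ℝ => t ^ a * (f t - c / (g * t ^ a))) =O[atTop]
      fun t => t ^ a * t ^ (-(2 * a)) := (isBigO_refl _ _).mul h
  have hzero : Tendsto (fun t : ℝ => t ^ a * t ^ (-(2 * a))) atTop (𝓝 0) := by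
    refine (tendsto_rpow_neg_atTop ha).congr' ?_
    filter_upwards [eventually_gt_atTop 0] with t ht
    rw [← Real.rpow_add ht]
    ring_nf
  have hlim := (hmul.trans_tendsto hzero).add_const (c / g)
  rw [zero_add] at hlim
  refine hlim.congr' ?_
  filter_upwards [eventually_gt_atTop 0] with t ht
  have hta : t ^ a ≠ 0 := (Real.rpow_pos_of_pos ht a).ne'
  rw [mul_sub, div_mul_eq_div_div, mul_div_cancel₀ _ hta, sub_add_cancel]

open Filter Topology in
lemma le_of_tendsto_rpow_mul {f : ℝ → ℝ} {a b c d : ℝ} (hc : c ≠ 0)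
    (ha : Tendsto (fun t => t ^ a * f t) atTop (𝓝 c))
    (hb : Tendsto (fun t => t ^ b * f t) atTop (𝓝 d)) : b ≤ a := by
  by_contra! hab
  have hlim := (tendsto_rpow_neg_atTop (sub_pos.2 hab)).mul hb
  rw [zero_mul] at hlim
  refine hc (tendsto_nhds_unique ha (hlim.congr' ?_))
  filter_upwards [eventually_gt_atTop 0] with t ht
  rw [← mul_assoc, ← Real.rpow_add ht]
  ring_nf

lemma Real.Gamma_one_sub_ne_zero {a : ℝ} (ha : a < 2) (ha1 : a ≠ 1) :
    Real.Gamma (1 - a) ≠ 0 := by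
  refine Real.Gamma_ne_zero fun m hm => ?_
  have hm1 : (m : ℝ) < 1 := by linarith
  have hm0 : m = 0 := Nat.lt_one_iff.1 (by exact_mod_cast hm1)
  subst hm0
  exact ha1 (by simp at hm; linarith)

theorem alpha_uniqueness_from_asymptotics
    (α α₁ : ℝ) (hα : α ∈ Set.Ioo (0 : ℝ) 2) (hα1 : α ≠ 1)
    (hα₁ : α₁ ∈ Set.Ioo (0 : ℝ) 2) (hα₁1 : α₁ ≠ 1)
    (p p₁ : ℝ) (hp : p ≠ 0) (hp₁ : p₁ ≠ 0)
    (f : ℝ → ℝ)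
    (h : (fun t => f t - p / (Real.Gamma (1 - α) * t ^ α))
      =O[Filter.atTop] fun t => t ^ (-(2 * α)))
    (h₁ : (fun t => f t - p₁ / (Real.Gamma (1 - α₁) * t ^ α₁))
      =O[Filter.atTop] fun t => t ^ (-(2 * α₁))) :
    α = α₁ ∧ p = p₁ := by
  have hΓ := Real.Gamma_one_sub_ne_zero hα.2 hα1
  have hΓ₁ := Real.Gamma_one_sub_ne_zero hα₁.2 hα₁1
  have hlim := tendsto_rpow_mul_of_sub_isBigO hα.1 h
  have hlim₁ := tendsto_rpow_mul_of_sub_isBigO hα₁.1 h₁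
  obtain rfl : α = α₁ :=
    le_antisymm (le_of_tendsto_rpow_mul (div_ne_zero hp₁ hΓ₁) hlim₁ hlim)
      (le_of_tendsto_rpow_mul (div_ne_zero hp hΓ) hlim hlim₁)
  exact ⟨rfl, (div_left_inj' hΓ).1 (tendsto_nhds_unique hlim hlim₁)⟩
end

section
/- Let λ : ℕ → ℝ be strictly increasing with λ k > 0 for all k and λ k → ∞, and let a : ℕ → ℝ. Let β, β₁ ∈ (0,1) and assume Summable (fun k => |a k| * (λ k)^(-(min β β₁))). Suppose there exists k₀ ∈ ℕ such that a k₀ ≠ 0, λ k₀ ≠ 1, and a k = 0 for every k < k₀. If the set { ℓ : ℕ | ℓ ≥ 1 ∧ ∑' k, a k * (λ k)^(-(β * ℓ)) = ∑' k, a k * (λ k)^(-(β₁ * ℓ)) } is infinite, then β = β₁. -/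
open Filter Topology in
/-- A generalized Dirichlet series, rescaled by its leading term, tends to its leading coefficient. -/
theorem tendsto_rpow_mul_dirichletSum {lam : ℕ → ℝ} (hmono : StrictMono lam)
    (hpos : ∀ k, 0 < lam k) {a : ℕ → ℝ} {m : ℝ}
    (hsum : Summable (fun k => |a k| * (lam k) ^ (-m)))
    {k₀ : ℕ} (hbelow : ∀ k < k₀, a k = 0) :
    Tendsto (fun s : ℝ => (lam k₀) ^ s * ∑' k, a k * (lam k) ^ (-s)) atTop (𝓝 (a k₀)) := by
  have key : ∀ (s : ℝ) (k : ℕ), (lam k₀) ^ s * (a k * (lam k) ^ (-s)) = a k * (lam k₀ / lam k) ^ s := by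
    intro s k
    rw [Real.div_rpow (hpos _).le (hpos _).le, Real.rpow_neg (hpos _).le]
    ring
  simp_rw [← tsum_mul_left, key]
  have hlim : ∑' k, (if k = k₀ then a k₀ else 0) = a k₀ := tsum_ite_eq k₀ _
  rw [← hlim]
  refine tendsto_tsum_of_dominated_convergence (hsum.mul_left ((lam k₀) ^ m)) ?_ ?_
  · intro k
    rcases lt_trichotomy k k₀ with h | rfl | h
    · simp [hbelow k h, h.ne]
    · simp [div_self (hpos k).ne']
    · rw [if_neg h.ne']
      have h0 : 0 < lam k₀ / lam k := div_pos (hpos _) (hpos _)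
      simpa using (tendsto_rpow_atTop_of_base_lt_one _ (by linarith)
        ((div_lt_one (hpos k)).2 (hmono h))).const_mul (a k)
  · filter_upwards [eventually_ge_atTop m] with s hs k
    rcases lt_or_ge k k₀ with h | h
    · simp [hbelow k h]
    · have h0 : 0 < lam k₀ / lam k := div_pos (hpos _) (hpos _)
      calc ‖a k * (lam k₀ / lam k) ^ s‖ = |a k| * (lam k₀ / lam k) ^ s := by
            rw [norm_mul, Real.norm_eq_abs, Real.norm_of_nonneg (Real.rpow_nonneg h0.le _)]
        _ ≤ |a k| * (lam k₀ / lam k) ^ m :=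
            mul_le_mul_of_nonneg_left (Real.rpow_le_rpow_of_exponent_ge h0
              ((div_le_one (hpos k)).2 (hmono.monotone h)) hs) (abs_nonneg _)
        _ = (lam k₀) ^ m * (|a k| * (lam k) ^ (-m)) := by
            rw [Real.div_rpow (hpos _).le (hpos _).le, Real.rpow_neg (hpos _).le]
            ring

open Filter Topology in
/-- Powers of a positive real number can only tend to `1` along infinitely many exponents if the
base is `1`. -/
theorem eq_one_of_tendsto_pow_one {c : ℝ} (hc : 0 < c) {l : Filter ℕ} [l.NeBot] (hl : l ≤ atTop)
    (h : Tendsto (fun n : ℕ => c ^ n) l (𝓝 1)) : c = 1 := by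
  rcases lt_trichotomy c 1 with h1 | h1 | h1
  · exact absurd (tendsto_nhds_unique h
      ((tendsto_pow_atTop_nhds_zero_of_lt_one hc.le h1).mono_left hl)) one_ne_zero
  · exact h1
  · exact absurd h (not_tendsto_nhds_of_tendsto_atTop
      ((tendsto_pow_atTop_atTop_of_one_lt h1).mono_left hl) 1)

theorem beta_uniqueness_from_dirichlet_sums
    (lam : ℕ → ℝ) (hmono : StrictMono lam) (hpos : ∀ k, 0 < lam k)
    (htend : Filter.Tendsto lam Filter.atTop Filter.atTop)
    (a : ℕ → ℝ)
    (β β₁ : ℝ) (hβ : β ∈ Set.Ioo (0 : ℝ) 1) (hβ₁ : β₁ ∈ Set.Ioo (0 : ℝ) 1)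
    (hsum : Summable (fun k => |a k| * (lam k) ^ (-(min β β₁))))
    (k₀ : ℕ) (hak₀ : a k₀ ≠ 0) (hlamk₀ : lam k₀ ≠ 1)
    (hbelow : ∀ k < k₀, a k = 0)
    (hinf : {ℓ : ℕ | 1 ≤ ℓ ∧
      (∑' k, a k * (lam k) ^ (-(β * ℓ))) = ∑' k, a k * (lam k) ^ (-(β₁ * ℓ))}.Infinite) :
    β = β₁ := by
  set S := {ℓ : ℕ | 1 ≤ ℓ ∧
      (∑' k, a k * (lam k) ^ (-(β * ℓ))) = ∑' k, a k * (lam k) ^ (-(β₁ * ℓ))} with hS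
  let l : Filter ℕ := Filter.atTop ⊓ Filter.principal S
  have hl : l ≤ Filter.atTop := inf_le_left
  have : l.NeBot := Filter.frequently_mem_iff_neBot.1 (Nat.frequently_atTop_iff_infinite.2 hinf)
  have hF := tendsto_rpow_mul_dirichletSum hmono hpos hsum hbelow
  have hlin : ∀ b : ℝ, 0 < b → Filter.Tendsto (fun n : ℕ => b * (n : ℝ)) l Filter.atTop :=
    fun b hb => (tendsto_natCast_atTop_atTop.const_mul_atTop hb).mono_left hl
  have hβF := hF.comp (hlin β hβ.1)
  have hβ₁F := hF.comp (hlin β₁ hβ₁.1)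
  have hratio := hβ₁F.div hβF hak₀
  rw [div_self hak₀] at hratio
  have hpow : Filter.Tendsto (fun n : ℕ => ((lam k₀) ^ (β₁ - β)) ^ n) l (nhds 1) := by
    refine hratio.congr' ?_
    filter_upwards [hβF.eventually_ne hak₀, Filter.mem_inf_of_right (Filter.mem_principal_self S)]
      with n hn hnS
    simp only [Function.comp_apply, Pi.div_apply] at hn ⊢
    rw [← hnS.2, mul_div_mul_right _ _ (right_ne_zero_of_mul hn), ← Real.rpow_sub (hpos k₀),
      ← Real.rpow_natCast, ← Real.rpow_mul (hpos k₀).le, sub_mul]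
  have hone := eq_one_of_tendsto_pow_one (Real.rpow_pos_of_pos (hpos k₀) _) hl hpow
  have hlog := congrArg Real.log hone
  rw [Real.log_rpow (hpos k₀), Real.log_one] at hlog
  rcases mul_eq_zero.1 hlog with h | h
  · linarith
  · exact absurd h (Real.log_ne_zero_of_pos_of_ne_one (hpos k₀) hlamk₀)
end

section
/- Let λ : ℕ → ℝ be strictly increasing with λ k > 0 for all k and λ k → ∞, and let a : ℕ → ℝ. Let β, β₁ ∈ (0,1) with β < β₁ and assume Summable (fun k => |a k| * (λ k)^(-β)). Suppose there exists k₀ ∈ ℕ such that a k₀ ≠ 0, λ k₀ > 1, and a k = 0 for every k < k₀. Then the set { ℓ : ℕ | ℓ ≥ 1 ∧ ∑' k, a k * (λ k)^(-(β * ℓ)) = ∑' k, a k * (λ k)^(-(β₁ * ℓ)) } is finite. -/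
open Filter Topology in
/-- As `n → ∞`, the power sums `∑ a k * r k ^ n` with ratios in `[0, 1]` on the support of `a`
converge to the sum of the coefficients whose ratio is `1`. -/
theorem tendsto_tsum_mul_pow_of_le_one {a r : ℕ → ℝ} (hr : ∀ k, 0 ≤ r k)
    (hr1 : ∀ k, a k ≠ 0 → r k ≤ 1) (hs : Summable fun k => |a k| * r k) :
    Tendsto (fun n : ℕ => ∑' k, a k * r k ^ n) atTop
      (𝓝 (∑' k, if r k = 1 then a k else 0)) := by
  refine tendsto_tsum_of_dominated_convergence hs (fun k => ?_) ?_
  · split_ifs with h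
    · simp [h]
    · by_cases ha : a k = 0
      · simp [ha]
      · simpa using (tendsto_pow_atTop_nhds_zero_of_lt_one (hr k)
          (lt_of_le_of_ne (hr1 k ha) h)).const_mul (a k)
  · filter_upwards [eventually_ge_atTop 1] with n hn k
    by_cases ha : a k = 0
    · simp [ha]
    · rw [norm_mul, norm_pow, Real.norm_eq_abs, Real.norm_eq_abs, abs_of_nonneg (hr k)]
      gcongr
      exact pow_le_of_le_one (hr k) (hr1 k ha) (by omega)

/-- Scaling a Dirichlet-type sum by `L ^ (β * n)` turns it into a power sum. -/
theorem rpow_mul_tsum_rpow_neg {lam : ℕ → ℝ} (hpos : ∀ k, 0 < lam k) (a : ℕ → ℝ)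
    {L : ℝ} (hL : 0 < L) (β γ : ℝ) (n : ℕ) :
    L ^ (β * n) * ∑' k, a k * lam k ^ (-(γ * n)) =
      ∑' k, a k * (L ^ β * lam k ^ (-γ)) ^ n := by
  rw [← tsum_mul_left]
  refine tsum_congr fun k => ?_
  rw [mul_pow, ← Real.rpow_mul_natCast hL.le, ← Real.rpow_mul_natCast (hpos k).le, neg_mul]
  ring

open Filter Topology in
theorem case1_lam_gt_one
    (lam : ℕ → ℝ) (hmono : StrictMono lam) (hpos : ∀ k, 0 < lam k)
    (htend : Filter.Tendsto lam Filter.atTop Filter.atTop)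
    (a : ℕ → ℝ)
    (β β₁ : ℝ) (hβ : β ∈ Set.Ioo (0 : ℝ) 1) (hβ₁ : β₁ ∈ Set.Ioo (0 : ℝ) 1)
    (hlt : β < β₁)
    (hsum : Summable (fun k => |a k| * (lam k) ^ (-β)))
    (k₀ : ℕ) (hak₀ : a k₀ ≠ 0) (hlamk₀ : 1 < lam k₀)
    (hbelow : ∀ k < k₀, a k = 0) :
    {ℓ : ℕ | 1 ≤ ℓ ∧
      (∑' k, a k * (lam k) ^ (-(β * ℓ))) = ∑' k, a k * (lam k) ^ (-(β₁ * ℓ))}.Finite := by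
  have hL := hpos k₀
  have hk : ∀ k, a k ≠ 0 → k₀ ≤ k := fun k h => not_lt.1 fun hlt => h (hbelow k hlt)
  have hr (γ : ℝ) (k : ℕ) : 0 ≤ lam k₀ ^ β * lam k ^ (-γ) :=
    mul_nonneg (Real.rpow_nonneg hL.le _) (Real.rpow_nonneg (hpos k).le _)
  have hone : lam k₀ ^ β * lam k₀ ^ (-β) = 1 := by
    rw [← Real.rpow_add hL, add_neg_cancel, Real.rpow_zero]
  have hle : ∀ k, k₀ ≤ k → lam k₀ ^ β * lam k ^ (-β) ≤ 1 := fun k h => by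
    rw [← hone]
    exact mul_le_mul_of_nonneg_left (Real.rpow_le_rpow_of_nonpos hL (hmono.monotone h)
      (neg_nonpos.2 hβ.1.le)) (Real.rpow_nonneg hL.le _)
  have hlt_of_lt : ∀ k, k₀ < k → lam k₀ ^ β * lam k ^ (-β) < 1 := fun k h => by
    rw [← hone]
    exact mul_lt_mul_of_pos_left (Real.rpow_lt_rpow_of_neg hL (hmono h)
      (neg_neg_iff_pos.2 hβ.1)) (Real.rpow_pos_of_pos hL _)
  have hcmp : ∀ k, k₀ ≤ k → lam k₀ ^ β * lam k ^ (-β₁) < lam k₀ ^ β * lam k ^ (-β) := fun k h =>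
    mul_lt_mul_of_pos_left (Real.rpow_lt_rpow_of_exponent_lt
      (hlamk₀.trans_le (hmono.monotone h)) (neg_lt_neg hlt)) (Real.rpow_pos_of_pos hL _)
  have hs : Summable fun k => |a k| * (lam k₀ ^ β * lam k ^ (-β)) :=
    (hsum.mul_left (lam k₀ ^ β)).congr fun k => by ring
  have hs₁ : Summable fun k => |a k| * (lam k₀ ^ β * lam k ^ (-β₁)) := by
    refine hs.of_nonneg_of_le (fun k => mul_nonneg (abs_nonneg _) (hr _ k)) fun k => ?_
    by_cases ha : a k = 0
    · simp [ha]
    · exact mul_le_mul_of_nonneg_left (hcmp k (hk k ha)).le (abs_nonneg _)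
  have h := tendsto_tsum_mul_pow_of_le_one (hr β) (fun k ha => hle k (hk k ha)) hs
  have h₁ := tendsto_tsum_mul_pow_of_le_one (hr β₁)
    (fun k ha => (hcmp k (hk k ha)).le.trans (hle k (hk k ha))) hs₁
  have hlim : (∑' k, if lam k₀ ^ β * lam k ^ (-β) = 1 then a k else 0) = a k₀ := by
    rw [tsum_eq_single k₀, if_pos hone]
    intro k hne
    rcases hne.lt_or_gt with hlt | hgt
    · simp [hbelow k hlt]
    · exact if_neg (hlt_of_lt k hgt).ne
  have hlim₁ : (∑' k, if lam k₀ ^ β * lam k ^ (-β₁) = 1 then a k else 0) = 0 := by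
    refine (tsum_congr fun k => ?_).trans tsum_zero
    rcases lt_or_ge k k₀ with hlt | hge
    · simp [hbelow k hlt]
    · exact if_neg ((hcmp k hge).trans_le (hle k hge)).ne
  rw [hlim] at h
  rw [hlim₁] at h₁
  have hne := (h.sub h₁).eventually_ne (by simpa using hak₀ : a k₀ - 0 ≠ 0)
  rw [← Nat.cofinite_eq_atTop] at hne
  refine (eventually_cofinite.1 hne).subset fun n hn => not_not.2 ?_
  rw [← rpow_mul_tsum_rpow_neg hpos a hL, ← rpow_mul_tsum_rpow_neg hpos a hL, hn.2, sub_self]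
end

section
/- Let λ : ℕ → ℝ be strictly increasing with λ k > 0 for all k and λ k → ∞, and let a : ℕ → ℝ. Let β, β₁ ∈ (0,1) with β < β₁ and assume Summable (fun k => |a k| * (λ k)^(-β)). Suppose there exists k₀ ∈ ℕ such that a k₀ ≠ 0, λ k₀ < 1, and a k = 0 for every k < k₀. Then the set { ℓ : ℕ | ℓ ≥ 1 ∧ ∑' k, a k * (λ k)^(-(β * ℓ)) = ∑' k, a k * (λ k)^(-(β₁ * ℓ)) } is finite. -/
open Filter Topology in
/-- A generalized Dirichlet series, normalized by its leading term, tends to its leading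
coefficient. -/
theorem tendsto_rpow_mul_tsum_rpow_neg
    {lam : ℕ → ℝ} (hmono : StrictMono lam) (hpos : ∀ k, 0 < lam k) {a : ℕ → ℝ} {β γ : ℝ}
    (hγ : 0 < γ) (hβγ : β ≤ γ) (hsum : Summable (fun k => |a k| * (lam k) ^ (-β)))
    {k₀ : ℕ} (hbelow : ∀ k < k₀, a k = 0) :
    Tendsto (fun ℓ : ℕ => lam k₀ ^ (γ * ℓ) * ∑' k, a k * (lam k) ^ (-(γ * ℓ)))
      atTop (𝓝 (a k₀)) := by
  have hterm (k ℓ : ℕ) : lam k₀ ^ (γ * ℓ) * (a k * (lam k) ^ (-(γ * ℓ))) =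
      a k * ((lam k₀ / lam k) ^ γ) ^ ℓ := by
    rw [← Real.rpow_natCast, ← Real.rpow_mul (div_pos (hpos _) (hpos _)).le,
      Real.div_rpow (hpos _).le (hpos _).le, Real.rpow_neg (hpos _).le]
    ring
  simp_rw [← tsum_mul_left, hterm]
  rw [show a k₀ = ∑' k, if k = k₀ then a k₀ else 0 from (tsum_ite_eq k₀ fun _ => a k₀).symm]
  refine tendsto_tsum_of_dominated_convergence
    (bound := fun k => lam k₀ ^ β * (|a k| * (lam k) ^ (-β))) (hsum.mul_left _) ?_ ?_
  · intro k
    rcases lt_trichotomy k k₀ with hk | rfl | hk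
    · simp [hbelow k hk, hk.ne]
    · simp [div_self (hpos k).ne']
    · have hratio : lam k₀ / lam k < 1 := (div_lt_one (hpos _)).2 (hmono hk)
      have hratio_pos : 0 < lam k₀ / lam k := div_pos (hpos _) (hpos _)
      simpa [hk.ne'] using (tendsto_pow_atTop_nhds_zero_of_lt_one
        (Real.rpow_nonneg hratio_pos.le γ)
        (Real.rpow_lt_one hratio_pos.le hratio hγ)).const_mul (a k)
  · filter_upwards [eventually_ge_atTop 1] with ℓ hℓ k
    rcases lt_or_ge k k₀ with hk | hk
    · simp [hbelow k hk]
    · have hratio : lam k₀ / lam k ≤ 1 := (div_le_one (hpos _)).2 (hmono.monotone hk)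
      have hratio_pos : 0 < lam k₀ / lam k := div_pos (hpos _) (hpos _)
      have hpow_nonneg := Real.rpow_nonneg hratio_pos.le γ
      calc ‖a k * ((lam k₀ / lam k) ^ γ) ^ ℓ‖ = |a k| * ((lam k₀ / lam k) ^ γ) ^ ℓ := by
            rw [Real.norm_eq_abs, abs_mul, abs_of_nonneg (pow_nonneg hpow_nonneg ℓ)]
        _ ≤ |a k| * (lam k₀ / lam k) ^ β := by
            gcongr
            exact (pow_le_of_le_one hpow_nonneg (Real.rpow_le_one hratio_pos.le hratio hγ.le)
              (by omega)).trans (Real.rpow_le_rpow_of_exponent_ge hratio_pos hratio hβγ)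
        _ = lam k₀ ^ β * (|a k| * (lam k) ^ (-β)) := by
            rw [Real.div_rpow (hpos _).le (hpos _).le, Real.rpow_neg (hpos _).le]
            ring

theorem case2_lam_lt_one
    (lam : ℕ → ℝ) (hmono : StrictMono lam) (hpos : ∀ k, 0 < lam k)
    (htend : Filter.Tendsto lam Filter.atTop Filter.atTop)
    (a : ℕ → ℝ)
    (β β₁ : ℝ) (hβ : β ∈ Set.Ioo (0 : ℝ) 1) (hβ₁ : β₁ ∈ Set.Ioo (0 : ℝ) 1)
    (hlt : β < β₁)
    (hsum : Summable (fun k => |a k| * (lam k) ^ (-β)))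
    (k₀ : ℕ) (hak₀ : a k₀ ≠ 0) (hlamk₀ : lam k₀ < 1)
    (hbelow : ∀ k < k₀, a k = 0) :
    {ℓ : ℕ | 1 ≤ ℓ ∧
      (∑' k, a k * (lam k) ^ (-(β * ℓ))) = ∑' k, a k * (lam k) ^ (-(β₁ * ℓ))}.Finite := by
  have h₀ := tendsto_rpow_mul_tsum_rpow_neg hmono hpos hβ.1 le_rfl hsum hbelow
  have h₁ := tendsto_rpow_mul_tsum_rpow_neg hmono hpos hβ₁.1 hlt.le hsum hbelow
  have hgap := (tendsto_pow_atTop_nhds_zero_of_lt_one (Real.rpow_nonneg (hpos k₀).le (β₁ - β))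
    (Real.rpow_lt_one (hpos k₀).le hlamk₀ (sub_pos.2 hlt))).mul h₀
  have hdiff := h₁.sub hgap
  rw [zero_mul, sub_zero] at hdiff
  have hne := hdiff.eventually_ne hak₀
  rw [← Nat.cofinite_eq_atTop, Filter.eventually_cofinite] at hne
  refine hne.subset fun ℓ hℓ => ?_
  simp only [Set.mem_ofPred_eq, not_not]
  rw [hℓ.2, ← mul_assoc, ← Real.rpow_natCast, ← Real.rpow_mul (hpos k₀).le,
    ← Real.rpow_add (hpos k₀), ← add_mul, sub_add_cancel, sub_self]
end

section
/- Let d ≥ 1, let Ω ⊆ ℝ^d be a nonempty bounded connected open set, let μ > 0, and let a_{ij} : ℝ^d → ℝ (1 ≤ i,j ≤ d) be continuously differentiable on a neighborhood of the closure of Ω with a_{ij} = a_{ji} and ∑_{i,j=1}^d a_{ij}(x) ξ_i ξ_j ≥ μ ∑_{i=1}^d ξ_i² for all x in the closure of Ω and all ξ ∈ ℝ^d. Let c : ℝ^d → ℝ be continuous with c ≤ 0 on Ω, and let η ≥ 0. Let f : ℝ^d → ℝ be continuous on the closure of Ω with f ≥ 0 on Ω and f not identically zero on Ω. Suppose w :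 ℝ^d → ℝ is continuous on the closure of Ω, twice continuously differentiable on Ω, satisfies ∑_{i,j=1}^d ∂_i(a_{ij} ∂_j w)(x) + c(x) w(x) - η w(x) = -f(x) for every x ∈ Ω, and w = 0 on the boundary ∂Ω. Then w(x) > 0 for every x ∈ Ω. -/
open scoped BigOperators

/-- Partial derivative in the `i`-th coordinate direction of Euclidean space. -/
noncomputable def pderiv' (d : ℕ) (i : Fin d)
    (g : EuclideanSpace ℝ (Fin d) → ℝ) (x : EuclideanSpace ℝ (Fin d)) : ℝ :=
  fderiv ℝ g x (EuclideanSpace.single i 1)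

open Set Filter Topology

variable {d : ℕ}

/-- The second-order divergence-form operator `u ↦ ∑ i j, ∂ᵢ (aᵢⱼ ∂ⱼ u)`. -/
noncomputable def divForm (A : Fin d → Fin d → EuclideanSpace ℝ (Fin d) → ℝ)
    (u : EuclideanSpace ℝ (Fin d) → ℝ) (x : EuclideanSpace ℝ (Fin d)) : ℝ :=
  ∑ i, ∑ j, pderiv' d i (fun y => A i j y * pderiv' d j u y) x

lemma fderiv_apply_eq_sum_pderiv' (g : EuclideanSpace ℝ (Fin d) → ℝ)
    (x ξ : EuclideanSpace ℝ (Fin d)) :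
    fderiv ℝ g x ξ = ∑ i, ξ i * pderiv' d i g x := by
  have h : ξ = ∑ i, ξ i • EuclideanSpace.single i (1 : ℝ) := by
    ext k
    simp [Finset.sum_apply, Pi.single_apply]
  conv_lhs => rw [h]
  simp [pderiv']

lemma ContDiffAt.differentiableAt_pderiv' {u : EuclideanSpace ℝ (Fin d) → ℝ}
    {x : EuclideanSpace ℝ (Fin d)} (hu : ContDiffAt ℝ 2 u x) (j : Fin d) :
    DifferentiableAt ℝ (pderiv' d j u) x := by
  have h : DifferentiableAt ℝ (fderiv ℝ u) x :=
    (hu.fderiv_right (m := 1) (by norm_num)).differentiableAt (by norm_num)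
  exact h.clm_apply (differentiableAt_const _)

lemma pderiv'_mul {f g : EuclideanSpace ℝ (Fin d) → ℝ} {x : EuclideanSpace ℝ (Fin d)}
    (hf : DifferentiableAt ℝ f x) (hg : DifferentiableAt ℝ g x) (i : Fin d) :
    pderiv' d i (fun y => f y * g y) x = f x * pderiv' d i g x + g x * pderiv' d i f x := by
  simp [pderiv', fderiv_fun_mul hf hg]

lemma pderiv'_sub_const_sub_mul {f g : EuclideanSpace ℝ (Fin d) → ℝ}
    {x : EuclideanSpace ℝ (Fin d)} (m ε : ℝ)
    (hf : DifferentiableAt ℝ f x) (hg : DifferentiableAt ℝ g x) (i : Fin d) :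
    pderiv' d i (fun y => f y - m - ε * g y) x = pderiv' d i f x - ε * pderiv' d i g x := by
  unfold pderiv'
  rw [fderiv_fun_sub (hf.sub_const m) (hg.const_mul ε), fderiv_sub_const,
    fderiv_const_mul hg]
  simp

lemma divForm_sub_const_sub_mul {A : Fin d → Fin d → EuclideanSpace ℝ (Fin d) → ℝ}
    {u v : EuclideanSpace ℝ (Fin d) → ℝ} {x : EuclideanSpace ℝ (Fin d)} (m ε : ℝ)
    (hA : ∀ i j, DifferentiableAt ℝ (A i j) x)
    (hu : ContDiffAt ℝ 2 u x) (hv : ContDiffAt ℝ 2 v x) :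
    divForm A (fun y => u y - m - ε * v y) x = divForm A u x - ε * divForm A v x := by
  unfold divForm
  rw [Finset.mul_sum, ← Finset.sum_sub_distrib]
  refine Finset.sum_congr rfl fun i _ => ?_
  rw [Finset.mul_sum, ← Finset.sum_sub_distrib]
  refine Finset.sum_congr rfl fun j _ => ?_
  have hu' := (hA i j).fun_mul (hu.differentiableAt_pderiv' j)
  have hv' := (hA i j).fun_mul (hv.differentiableAt_pderiv' j)
  refine Eq.trans ?_ (pderiv'_sub_const_sub_mul 0 ε hu' hv' i)
  have key : (fun y => A i j y * pderiv' d j (fun y => u y - m - ε * v y) y) =ᶠ[𝓝 x]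
      fun y => A i j y * pderiv' d j u y - 0 - ε * (A i j y * pderiv' d j v y) := by
    filter_upwards [hu.eventually (by simp), hv.eventually (by simp)] with y huy hvy
    rw [pderiv'_sub_const_sub_mul m ε (huy.differentiableAt (by norm_num))
      (hvy.differentiableAt (by norm_num))]
    ring
  unfold pderiv' at key ⊢
  rw [key.fderiv_eq]

lemma divForm_eq_expand {A : Fin d → Fin d → EuclideanSpace ℝ (Fin d) → ℝ}
    {u : EuclideanSpace ℝ (Fin d) → ℝ} {x : EuclideanSpace ℝ (Fin d)}
    (hA : ∀ i j, DifferentiableAt ℝ (A i j) x) (hu : ContDiffAt ℝ 2 u x) :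
    divForm A u x = ∑ i, ∑ j, (A i j x * pderiv' d i (pderiv' d j u) x
      + pderiv' d j u x * pderiv' d i (A i j) x) := by
  unfold divForm
  exact Finset.sum_congr rfl fun i _ => Finset.sum_congr rfl fun j _ =>
    pderiv'_mul (hA i j) (hu.differentiableAt_pderiv' j) i

lemma sum_mul_nonneg_of_quadratic_nonneg {a H : Fin d → Fin d → ℝ}
    (hsymm : ∀ i j, a i j = a j i)
    (ha : ∀ ξ : Fin d → ℝ, 0 ≤ ∑ i, ∑ j, a i j * ξ i * ξ j)
    (hH : ∀ ξ : Fin d → ℝ, 0 ≤ ∑ i, ∑ j, ξ i * (ξ j * H i j)) :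
    0 ≤ ∑ i, ∑ j, a i j * H i j := by
  have hP : (Matrix.of a).PosSemidef := by
    rw [Matrix.posSemidef_iff_dotProduct_mulVec]
    refine ⟨by ext i j; simp [hsymm i j], fun ξ => ?_⟩
    refine (ha ξ).trans_eq ?_
    simp only [dotProduct, Matrix.mulVec, Finset.mul_sum, Matrix.of_apply]
    refine Finset.sum_congr rfl fun i _ => Finset.sum_congr rfl fun j _ => ?_
    rw [Pi.star_apply, star_trivial]
    ring
  obtain ⟨n, v, hv⟩ := Matrix.posSemidef_iff_eq_sum_vecMulVec.mp hP
  have hav : ∀ i j, a i j = ∑ k, v k i * v k j := fun i j => by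
    have := congrFun (congrFun hv i) j
    simpa [Matrix.sum_apply, Matrix.vecMulVec_apply] using this
  have : ∑ i, ∑ j, a i j * H i j = ∑ k, ∑ i, ∑ j, v k i * (v k j * H i j) := by
    simp only [hav, Finset.sum_mul]
    rw [Finset.sum_comm]
    simp_rw [Finset.sum_comm (s := (Finset.univ : Finset (Fin n)))]
    rw [Finset.sum_comm]
    simp only [mul_assoc]
  rw [this]
  exact Finset.sum_nonneg fun k _ => hH (v k)

lemma IsLocalMin.deriv_deriv_nonneg {g : ℝ → ℝ} {t : ℝ} (h : IsLocalMin g t)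
    (hc : ContinuousAt g t) : 0 ≤ deriv (deriv g) t := by
  by_contra! hneg
  have hmax := isLocalMax_of_deriv_deriv_neg hneg h.deriv_eq_zero hc
  have hconst : g =ᶠ[𝓝 t] fun _ => g t := by
    filter_upwards [h, hmax] with s h₁ h₂ using le_antisymm h₂ h₁
  have : deriv (deriv g) t = 0 := by
    rw [hconst.deriv.deriv_eq]
    simp
  exact hneg.ne this

lemma IsLocalMin.hessian_nonneg {h : EuclideanSpace ℝ (Fin d) → ℝ}
    {q : EuclideanSpace ℝ (Fin d)} (hmin : IsLocalMin h q) (hh : ContDiffAt ℝ 2 h q)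
    (ξ : EuclideanSpace ℝ (Fin d)) :
    0 ≤ ∑ i, ∑ j, ξ i * (ξ j * pderiv' d i (pderiv' d j h) q) := by
  have hline : ∀ t : ℝ, HasDerivAt (fun t : ℝ => q + t • ξ) ξ t := fun t => by
    simpa using ((hasDerivAt_id t).smul_const ξ).const_add q
  have hcont : ContinuousAt (fun t : ℝ => q + t • ξ) 0 := (hline 0).continuousAt
  have hq : q + (0 : ℝ) • ξ = q := by simp
  have htend : Tendsto (fun t : ℝ => q + t • ξ) (𝓝 0) (𝓝 q) := by
    simpa using hcont.tendsto
  have hg : IsLocalMin (fun t : ℝ => h (q + t • ξ)) 0 := by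
    filter_upwards [htend.eventually hmin] with t ht
    simpa using ht
  have hgc : ContinuousAt (fun t : ℝ => h (q + t • ξ)) 0 :=
    ContinuousAt.comp (g := h) (by rw [hq]; exact hh.continuousAt) hcont
  have hd1 : deriv (fun t : ℝ => h (q + t • ξ)) =ᶠ[𝓝 0]
      fun t => ∑ j, ξ j * pderiv' d j h (q + t • ξ) := by
    filter_upwards [htend.eventually (hh.eventually (by simp))] with t ht
    rw [← fderiv_apply_eq_sum_pderiv']
    exact ((ht.differentiableAt (by norm_num)).hasFDerivAt.comp_hasDerivAt t (hline t)).deriv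
  have hd2 : HasDerivAt (fun t : ℝ => ∑ j, ξ j * pderiv' d j h (q + t • ξ))
      (∑ j, ξ j * fderiv ℝ (pderiv' d j h) q ξ) 0 := by
    refine HasDerivAt.fun_sum fun j _ => HasDerivAt.const_mul (ξ j) ?_
    have := (hh.differentiableAt_pderiv' j).hasFDerivAt
    rw [← hq] at this
    have := this.comp_hasDerivAt (0 : ℝ) (hline 0)
    rwa [hq] at this
  have := hg.deriv_deriv_nonneg hgc
  rw [hd1.deriv_eq, hd2.deriv] at this
  simp_rw [fderiv_apply_eq_sum_pderiv', Finset.mul_sum] at this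
  rw [Finset.sum_comm] at this
  refine this.trans_eq (Finset.sum_congr rfl fun i _ => Finset.sum_congr rfl fun j _ => ?_)
  ring

lemma IsLocalMin.divForm_nonneg {A : Fin d → Fin d → EuclideanSpace ℝ (Fin d) → ℝ}
    {h : EuclideanSpace ℝ (Fin d) → ℝ} {q : EuclideanSpace ℝ (Fin d)}
    (hA : ∀ i j, DifferentiableAt ℝ (A i j) q) (hsymm : ∀ i j, A i j q = A j i q)
    (hpos : ∀ ξ : Fin d → ℝ, 0 ≤ ∑ i, ∑ j, A i j q * ξ i * ξ j)
    (hmin : IsLocalMin h q) (hh : ContDiffAt ℝ 2 h q) : 0 ≤ divForm A h q := by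
  have hgrad : ∀ j, pderiv' d j h q = 0 := fun j => by simp [pderiv', hmin.fderiv_eq_zero]
  rw [divForm_eq_expand hA hh]
  simp only [hgrad, zero_mul, add_zero]
  exact sum_mul_nonneg_of_quadratic_nonneg hsymm hpos
    fun ξ => hmin.hessian_nonneg hh (WithLp.toLp 2 ξ)

section Gaussian

variable (α : ℝ) (y : EuclideanSpace ℝ (Fin d))

lemma contDiff_gaussian :
    ContDiff ℝ 2 fun x : EuclideanSpace ℝ (Fin d) => Real.exp (-α * ‖x - y‖ ^ 2) :=
  (contDiff_const.mul ((contDiff_id.sub contDiff_const).norm_sq ℝ)).exp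

lemma pderiv'_gaussian (j : Fin d) :
    pderiv' d j (fun x => Real.exp (-α * ‖x - y‖ ^ 2)) =
      fun x => (-2 * α * (x j - y j)) * Real.exp (-α * ‖x - y‖ ^ 2) := by
  funext x
  have h : HasFDerivAt (fun x : EuclideanSpace ℝ (Fin d) => Real.exp (-α * ‖x - y‖ ^ 2)) _ x :=
    ((((hasFDerivAt_id x).sub_const y).norm_sq).const_mul (-α)).exp
  rw [pderiv', h.fderiv]
  simp [EuclideanSpace.inner_single_right]
  ring

lemma pderiv'_coord_sub (i j : Fin d) (x : EuclideanSpace ℝ (Fin d)) :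
    pderiv' d i (fun x => -2 * α * (x j - y j)) x = if i = j then -2 * α else 0 := by
  have h : HasFDerivAt (fun x : EuclideanSpace ℝ (Fin d) => -2 * α * (x j - y j)) _ x :=
    (((EuclideanSpace.proj j : EuclideanSpace ℝ (Fin d) →L[ℝ] ℝ).hasFDerivAt).sub_const
      (y j)).const_mul (-2 * α)
  rw [pderiv', h.fderiv]
  by_cases hij : i = j <;> simp [hij, Ne.symm]

lemma pderiv'_pderiv'_gaussian (i j : Fin d) (x : EuclideanSpace ℝ (Fin d)) :
    pderiv' d i (pderiv' d j (fun x => Real.exp (-α * ‖x - y‖ ^ 2))) x =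
      (4 * α ^ 2 * ((x i - y i) * (x j - y j)) - if i = j then 2 * α else 0)
        * Real.exp (-α * ‖x - y‖ ^ 2) := by
  have h : DifferentiableAt ℝ (fun x : EuclideanSpace ℝ (Fin d) => -2 * α * (x j - y j)) x := by
    fun_prop
  rw [pderiv'_gaussian, pderiv'_mul h
    ((contDiff_gaussian α y).contDiffAt.differentiableAt (by norm_num)), pderiv'_gaussian,
    pderiv'_coord_sub]
  split_ifs <;> ring

lemma divForm_gaussian {A : Fin d → Fin d → EuclideanSpace ℝ (Fin d) → ℝ}
    {x : EuclideanSpace ℝ (Fin d)} (hA : ∀ i j, DifferentiableAt ℝ (A i j) x) :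
    divForm A (fun x => Real.exp (-α * ‖x - y‖ ^ 2)) x =
      (4 * α ^ 2 * ∑ i, ∑ j, A i j x * (x i - y i) * (x j - y j)
        - 2 * α * ∑ i, ∑ j, ((if i = j then A i j x else 0)
            + (x j - y j) * pderiv' d i (A i j) x)) * Real.exp (-α * ‖x - y‖ ^ 2) := by
  rw [divForm_eq_expand hA (contDiff_gaussian α y).contDiffAt]
  simp only [pderiv'_pderiv'_gaussian]
  simp only [pderiv'_gaussian]
  rw [Finset.mul_sum, Finset.mul_sum, ← Finset.sum_sub_distrib, Finset.sum_mul]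
  refine Finset.sum_congr rfl fun i _ => ?_
  rw [Finset.mul_sum, Finset.mul_sum, ← Finset.sum_sub_distrib, Finset.sum_mul]
  refine Finset.sum_congr rfl fun j _ => ?_
  split_ifs <;> ring

end Gaussian

/-- For a large enough exponent a Gaussian is a strict subsolution away from its centre. -/
lemma exists_gaussian_subsolution {A : Fin d → Fin d → EuclideanSpace ℝ (Fin d) → ℝ}
    {k : EuclideanSpace ℝ (Fin d) → ℝ} {Ω K : Set (EuclideanSpace ℝ (Fin d))} {μ s : ℝ}
    {y : EuclideanSpace ℝ (Fin d)} (hΩ : IsOpen Ω) (hA : ∀ i j, ContDiffOn ℝ 1 (A i j) Ω)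
    (hμ : 0 < μ)
    (hell : ∀ x ∈ Ω, ∀ ξ : Fin d → ℝ, μ * ∑ i, (ξ i) ^ 2 ≤ ∑ i, ∑ j, A i j x * ξ i * ξ j)
    (hk : ContinuousOn k Ω) (hK : IsCompact K) (hKΩ : K ⊆ Ω)
    (hs : 0 < s) (hKy : ∀ x ∈ K, s ≤ ‖x - y‖) :
    ∃ α : ℝ, 0 < α ∧ ∀ x ∈ K, k x * Real.exp (-α * ‖x - y‖ ^ 2) <
      divForm A (fun x => Real.exp (-α * ‖x - y‖ ^ 2)) x := by
  have hdA : ∀ i j, ContinuousOn (pderiv' d i (A i j)) Ω := fun i j =>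
    ((hA i j).continuousOn_fderiv_of_isOpen hΩ le_rfl).clm_apply continuousOn_const
  have hG : ContinuousOn (fun x => ∑ i, ∑ j, ((if i = j then A i j x else 0)
      + (x j - y j) * pderiv' d i (A i j) x)) K := by
    refine continuousOn_finsetSum _ fun i _ => continuousOn_finsetSum _ fun j _ => ?_
    refine ContinuousOn.add ?_ (ContinuousOn.mul (by fun_prop) ((hdA i j).mono hKΩ))
    split_ifs
    · exact (hA i j).continuousOn.mono hKΩ
    · exact continuousOn_const
  obtain ⟨C, hC⟩ := hK.exists_bound_of_continuousOn hG
  obtain ⟨M, hM⟩ := hK.exists_bound_of_continuousOn (hk.mono hKΩ)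
  have hms : 0 < 4 * (μ * s ^ 2) := by positivity
  refine ⟨1 + (2 * |C| + |M|) / (4 * (μ * s ^ 2)), by positivity, fun x hx => ?_⟩
  set α := 1 + (2 * |C| + |M|) / (4 * (μ * s ^ 2)) with hα
  have hα1 : 1 ≤ α := by
    have : 0 ≤ (2 * |C| + |M|) / (4 * (μ * s ^ 2)) := by positivity
    linarith
  have hαe : α * (4 * (μ * s ^ 2)) = 4 * (μ * s ^ 2) + (2 * |C| + |M|) := by
    rw [hα]; field_simp
  rw [divForm_gaussian α y fun i j =>
    ((hA i j).contDiffAt (hΩ.mem_nhds (hKΩ hx))).differentiableAt (by norm_num)]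
  refine mul_lt_mul_of_pos_right ?_ (Real.exp_pos _)
  have h1 := (le_abs_self _).trans ((Real.norm_eq_abs _ ▸ hC x hx).trans (le_abs_self C))
  have h2 := (le_abs_self _).trans ((Real.norm_eq_abs _ ▸ hM x hx).trans (le_abs_self M))
  have h3 : μ * s ^ 2 ≤ ∑ i, ∑ j, A i j x * (x i - y i) * (x j - y j) := by
    refine le_trans ?_ (hell x (hKΩ hx) fun i => x i - y i)
    have : ‖x - y‖ ^ 2 = ∑ i, (x i - y i) ^ 2 := by
      rw [EuclideanSpace.real_norm_sq_eq]; simp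
    rw [← this]
    gcongr
    exact hKy x hx
  have h4 : α * (α * (4 * (μ * s ^ 2))) ≤ 4 * α ^ 2 *
      ∑ i, ∑ j, A i j x * (x i - y i) * (x j - y j) := by
    calc α * (α * (4 * (μ * s ^ 2))) = 4 * α ^ 2 * (μ * s ^ 2) := by ring
      _ ≤ _ := by gcongr
  have h5 := mul_le_mul_of_nonneg_left h1 (by linarith : 0 ≤ 2 * α)
  rw [hαe] at h4
  nlinarith [mul_le_mul_of_nonneg_right hα1 (abs_nonneg M), mul_le_mul_of_nonneg_right hα1 hms.le]

/-- The zeroth-order term being absorbing, a strict supersolution that is nonnegative on the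
boundary of a ball is positive at the centre. -/
lemma pos_of_strict_supersolution {A : Fin d → Fin d → EuclideanSpace ℝ (Fin d) → ℝ}
    {k h : EuclideanSpace ℝ (Fin d) → ℝ} {p : EuclideanSpace ℝ (Fin d)} {ρ : ℝ} (hρ : 0 < ρ)
    (hA : ∀ x ∈ Metric.closedBall p ρ, ∀ i j, DifferentiableAt ℝ (A i j) x)
    (hsymm : ∀ i j x, A i j x = A j i x)
    (hpos : ∀ x ∈ Metric.closedBall p ρ, ∀ ξ : Fin d → ℝ, 0 ≤ ∑ i, ∑ j, A i j x * ξ i * ξ j)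
    (hk : ∀ x ∈ Metric.closedBall p ρ, 0 ≤ k x)
    (hh : ∀ x ∈ Metric.closedBall p ρ, ContDiffAt ℝ 2 h x)
    (hsuper : ∀ x ∈ Metric.closedBall p ρ, divForm A h x < k x * h x)
    (hbd : ∀ x ∈ Metric.sphere p ρ, 0 ≤ h x) : 0 < h p := by
  by_contra! hp
  have hpm : p ∈ Metric.closedBall p ρ := Metric.mem_closedBall_self hρ.le
  have hinterior : ∀ q ∈ Metric.ball p ρ, IsMinOn h (Metric.closedBall p ρ) q → False := by
    intro q hq hmin
    have hq' := Metric.ball_subset_closedBall hq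
    have hloc : IsLocalMin h q := hmin.isLocalMin
      (Filter.mem_of_superset (Metric.isOpen_ball.mem_nhds hq) Metric.ball_subset_closedBall)
    have h1 := hloc.divForm_nonneg (hA q hq') (fun i j => hsymm i j q) (hpos q hq') (hh q hq')
    have h2 : h q ≤ 0 := (hmin hpm).trans hp
    linarith [hsuper q hq', mul_nonpos_of_nonneg_of_nonpos (hk q hq') h2]
  obtain ⟨q, hq, hmin⟩ := (isCompact_closedBall p ρ).exists_isMinOn ⟨p, hpm⟩
    fun x hx => (hh x hx).continuousAt.continuousWithinAt
  rcases (Metric.mem_closedBall.mp hq).lt_or_eq with hlt | heq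
  · exact hinterior q hlt hmin
  · exact hinterior p (Metric.mem_ball_self hρ) fun x hx => hp.trans ((hbd q heq).trans (hmin hx))

/-- A supersolution cannot attain a nonpositive interior minimum at a point touched by a ball on
which it exceeds that minimum. -/
lemma false_of_ball_contact {A : Fin d → Fin d → EuclideanSpace ℝ (Fin d) → ℝ}
    {k w : EuclideanSpace ℝ (Fin d) → ℝ} {Ω : Set (EuclideanSpace ℝ (Fin d))} {μ m ρ : ℝ}
    {p y : EuclideanSpace ℝ (Fin d)} (hΩ : IsOpen Ω) (hA : ∀ i j, ContDiffOn ℝ 1 (A i j) Ω)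
    (hsymm : ∀ i j x, A i j x = A j i x) (hμ : 0 < μ)
    (hell : ∀ x ∈ Ω, ∀ ξ : Fin d → ℝ, μ * ∑ i, (ξ i) ^ 2 ≤ ∑ i, ∑ j, A i j x * ξ i * ξ j)
    (hk : ContinuousOn k Ω) (hk0 : ∀ x ∈ Ω, 0 ≤ k x)
    (hw : ContDiffOn ℝ 2 w Ω) (hsuper : ∀ x ∈ Ω, divForm A w x ≤ k x * w x)
    (hm : m ≤ 0) (hmin : ∀ x ∈ Ω, m ≤ w x) (hp : w p = m)
    (hρ : 0 < ρ) (hρy : ρ < ‖p - y‖) (hball : Metric.closedBall p ρ ⊆ Ω)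
    (hcontact : ∀ x ∈ Metric.closedBall p ρ, ‖x - y‖ ≤ ‖p - y‖ → x ≠ p → m < w x) : False := by
  have hK := isCompact_closedBall p ρ
  obtain ⟨α, hα, hsub⟩ := exists_gaussian_subsolution (y := y) hΩ hA hμ hell hk hK hball
    (sub_pos.mpr hρy) fun x hx => by
      have h1 : ‖p - y‖ ≤ ‖x - y‖ + ‖x - p‖ := by
        rw [add_comm]
        simpa [norm_sub_rev] using norm_sub_le_norm_sub_add_norm_sub p x y
      rw [mem_closedBall_iff_norm] at hx
      linarith
  set v : EuclideanSpace ℝ (Fin d) → ℝ := fun x => Real.exp (-α * ‖x - y‖ ^ 2) with hv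
  have hv1 : ∀ x, v x ≤ 1 := fun x => Real.exp_le_one_iff.mpr (by nlinarith [sq_nonneg ‖x - y‖])
  have hwc : ContinuousOn w Ω := hw.continuousOn
  obtain ⟨ε, hε, hεw⟩ : ∃ ε > 0, ∀ x ∈ Metric.sphere p ρ, ‖x - y‖ ≤ ‖p - y‖ → ε ≤ w x - m := by
    have hT : IsCompact (Metric.sphere p ρ ∩ {x | ‖x - y‖ ≤ ‖p - y‖}) :=
      (isCompact_sphere p ρ).inter_right (isClosed_le (by fun_prop) continuous_const)
    rcases (Metric.sphere p ρ ∩ {x | ‖x - y‖ ≤ ‖p - y‖}).eq_empty_or_nonempty with he | hne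
    · refine ⟨1, one_pos, fun x hx hxy => ?_⟩
      have : x ∈ Metric.sphere p ρ ∩ {x | ‖x - y‖ ≤ ‖p - y‖} := ⟨hx, hxy⟩
      simp [he] at this
    · obtain ⟨q, hq, hqmin⟩ := hT.exists_isMinOn hne
        (hwc.mono (inter_subset_left.trans (Metric.sphere_subset_closedBall.trans hball)))
      refine ⟨w q - m, sub_pos.mpr (hcontact q (Metric.sphere_subset_closedBall hq.1) hq.2
        (Metric.ne_of_mem_sphere hq.1 hρ.ne')), fun x hx hxy => ?_⟩
      exact sub_le_sub_right (hqmin ⟨hx, hxy⟩) m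
  have hvC : ∀ x, ContDiffAt ℝ 2 v x := fun x => (contDiff_gaussian α y).contDiffAt
  have hwC : ∀ x ∈ Ω, ContDiffAt ℝ 2 w x := fun x hx => hw.contDiffAt (hΩ.mem_nhds hx)
  have hAd : ∀ x ∈ Ω, ∀ i j, DifferentiableAt ℝ (A i j) x := fun x hx i j =>
    ((hA i j).contDiffAt (hΩ.mem_nhds hx)).differentiableAt (by norm_num)
  have hpos := pos_of_strict_supersolution (A := A) (k := k)
    (h := fun x => w x - (m - ε * v p) - ε * v x) hρ
    (fun x hx => hAd x (hball hx)) hsymm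
    (fun x hx ξ => le_trans (by positivity) (hell x (hball hx) ξ))
    (fun x hx => hk0 x (hball hx))
    (fun x hx => ((hwC x (hball hx)).sub contDiffAt_const).sub (contDiffAt_const.mul (hvC x)))
    (fun x hx => by
      rw [divForm_sub_const_sub_mul _ _ (hAd x (hball hx)) (hwC x (hball hx)) (hvC x)]
      have h1 := hsuper x (hball hx)
      have h2 := mul_lt_mul_of_pos_left (hsub x hx) hε
      have h3 := mul_nonpos_of_nonneg_of_nonpos (hk0 x (hball hx)) hm
      have h4 : 0 ≤ k x * (ε * v p) :=
        mul_nonneg (hk0 x (hball hx)) (mul_nonneg hε.le (Real.exp_pos _).le)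
      linarith)
    (fun x hx => by
      have hvp : 0 < v p := Real.exp_pos _
      rcases le_total ‖x - y‖ ‖p - y‖ with hxy | hxy
      · have := hεw x hx hxy
        nlinarith [hv1 x]
      · have h1 := hmin x (hball (Metric.sphere_subset_closedBall hx))
        have h2 : v x ≤ v p := Real.exp_le_exp.mpr (by
          have : ‖p - y‖ ^ 2 ≤ ‖x - y‖ ^ 2 := by gcongr
          nlinarith)
        nlinarith)
  simp only [hp] at hpos
  linarith

/-- Local form of the strong minimum principle. -/
lemma eventually_eq_of_nonpos_min {A : Fin d → Fin d → EuclideanSpace ℝ (Fin d) → ℝ}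
    {k w : EuclideanSpace ℝ (Fin d) → ℝ} {Ω : Set (EuclideanSpace ℝ (Fin d))} {μ m : ℝ}
    {z : EuclideanSpace ℝ (Fin d)} (hΩ : IsOpen Ω) (hA : ∀ i j, ContDiffOn ℝ 1 (A i j) Ω)
    (hsymm : ∀ i j x, A i j x = A j i x) (hμ : 0 < μ)
    (hell : ∀ x ∈ Ω, ∀ ξ : Fin d → ℝ, μ * ∑ i, (ξ i) ^ 2 ≤ ∑ i, ∑ j, A i j x * ξ i * ξ j)
    (hk : ContinuousOn k Ω) (hk0 : ∀ x ∈ Ω, 0 ≤ k x)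
    (hw : ContDiffOn ℝ 2 w Ω) (hsuper : ∀ x ∈ Ω, divForm A w x ≤ k x * w x)
    (hm : m ≤ 0) (hmin : ∀ x ∈ Ω, m ≤ w x) (hzΩ : z ∈ Ω) (hz : w z = m) :
    ∀ᶠ x in 𝓝 z, w x = m := by
  by_contra hnot
  obtain ⟨R, hR, hRΩ⟩ := Metric.isOpen_iff.mp hΩ z hzΩ
  obtain ⟨y, hyw, hyz⟩ := ((not_eventually.mp hnot).and_eventually
    (Metric.ball_mem_nhds z (by positivity : 0 < R / 3))).exists
  have hB : Metric.closedBall y (dist z y) ⊆ Ω := fun x hx => hRΩ (by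
    rw [Metric.mem_closedBall, dist_comm z y] at hx
    rw [Metric.mem_ball]
    linarith [dist_triangle x y z])
  have hS : IsCompact (Metric.closedBall y (dist z y) ∩ w ⁻¹' {m}) :=
    (isCompact_closedBall y _).of_isClosed_subset
      ((hw.continuousOn.mono hB).preimage_isClosed_of_isClosed Metric.isClosed_closedBall
        isClosed_singleton) inter_subset_left
  obtain ⟨p, ⟨hpB, hpw⟩, hpmin⟩ := hS.exists_isMinOn ⟨z, by simp, hz⟩
    (f := fun x => dist x y) (by fun_prop)
  have hpw : w p = m := hpw
  have hpy : 0 < dist p y := dist_pos.mpr fun h => hyw (h ▸ hpw)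
  rw [Metric.mem_closedBall] at hpB
  have hout : ∀ x, dist x y < dist p y → m < w x := fun x hx => by
    have hxB : x ∈ Metric.closedBall y (dist z y) := (hx.le.trans hpB)
    refine lt_of_le_of_ne (hmin x (hB hxB)) fun h => ?_
    exact absurd (hpmin ⟨hxB, h.symm⟩) (not_le.mpr hx)
  have hmid : ‖p - midpoint ℝ p y‖ = dist p y / 2 := by
    rw [← dist_eq_norm, dist_left_midpoint]
    simp; ring
  refine false_of_ball_contact (y := midpoint ℝ p y) (ρ := dist p y / 4) hΩ hA hsymm hμ hell hk
    hk0 hw hsuper hm hmin hpw (by positivity) (by rw [hmid]; linarith) (fun x hx => hRΩ ?_)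
    fun x _ hxy hxp => hout x ?_
  · rw [Metric.mem_closedBall] at hx
    rw [Metric.mem_ball]
    rw [dist_comm z y] at hpB
    linarith [dist_triangle x p z, dist_triangle p y z]
  · have hap :=
      EuclideanGeometry.dist_sq_add_dist_sq_eq_two_mul_dist_midpoint_sq_add_half_dist_sq x p y
    rw [hmid, ← dist_eq_norm] at hxy
    have h1 : 0 < dist x p := dist_pos.mpr hxp
    have h2 : dist x (midpoint ℝ p y) ^ 2 ≤ (dist p y / 2) ^ 2 := by gcongr
    exact lt_of_pow_lt_pow_left₀ 2 hpy.le (by nlinarith)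

theorem strong_positivity_divergence_form
    (d : ℕ) (hd : 1 ≤ d)
    (Ω : Set (EuclideanSpace ℝ (Fin d)))
    (hΩne : Ω.Nonempty) (hΩbd : Bornology.IsBounded Ω)
    (hΩconn : IsConnected Ω) (hΩopen : IsOpen Ω)
    (μ : ℝ) (hμ : 0 < μ)
    (A : Fin d → Fin d → EuclideanSpace ℝ (Fin d) → ℝ)
    (hAreg : ∃ U : Set (EuclideanSpace ℝ (Fin d)), IsOpen U ∧ closure Ω ⊆ U ∧
      ∀ i j, ContDiffOn ℝ 1 (A i j) U)
    (hAsymm : ∀ i j x, A i j x = A j i x)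
    (hAell : ∀ x ∈ closure Ω, ∀ ξ : Fin d → ℝ,
      μ * ∑ i, (ξ i) ^ 2 ≤ ∑ i, ∑ j, A i j x * ξ i * ξ j)
    (c : EuclideanSpace ℝ (Fin d) → ℝ) (hc : Continuous c)
    (hcneg : ∀ x ∈ Ω, c x ≤ 0)
    (η : ℝ) (hη : 0 ≤ η)
    (f : EuclideanSpace ℝ (Fin d) → ℝ)
    (hfcont : ContinuousOn f (closure Ω))
    (hfnonneg : ∀ x ∈ Ω, 0 ≤ f x)
    (hfne : ∃ x ∈ Ω, f x ≠ 0)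
    (w : EuclideanSpace ℝ (Fin d) → ℝ)
    (hwcont : ContinuousOn w (closure Ω))
    (hwreg : ContDiffOn ℝ 2 w Ω)
    (hweq : ∀ x ∈ Ω,
      (∑ i, ∑ j, pderiv' d i (fun y => A i j y * pderiv' d j w y) x)
        + c x * w x - η * w x = -f x)
    (hwbdry : ∀ x ∈ frontier Ω, w x = 0) :
    ∀ x ∈ Ω, 0 < w x := by
  intro x₀ hx₀
  by_contra! hwx₀
  obtain ⟨U, hUopen, hΩU, hAU⟩ := hAreg
  have hsub : Ω ⊆ closure Ω := subset_closure
  have hdiv : ∀ x ∈ Ω, divForm A w x = (η - c x) * w x - f x := fun x hx => by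
    have := hweq x hx
    unfold divForm
    linarith
  obtain ⟨q, hq, hqmin⟩ := hΩbd.isCompact_closure.exists_isMinOn ⟨x₀, hsub hx₀⟩ hwcont
  have hm : w q ≤ 0 := (hqmin (hsub hx₀)).trans hwx₀
  obtain ⟨z, hzΩ, hz⟩ : ∃ z ∈ Ω, w z = w q := by
    by_cases hqΩ : q ∈ Ω
    · exact ⟨q, hqΩ, rfl⟩
    · have hq0 := hwbdry q ⟨hq, by rwa [hΩopen.interior_eq]⟩
      exact ⟨x₀, hx₀, le_antisymm (hwx₀.trans hq0.ge) (hqmin (hsub hx₀))⟩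
  have hloc : ∀ x ∈ Ω, w x = w q → ∀ᶠ x' in 𝓝 x, w x' = w q := fun x hx hxq =>
    eventually_eq_of_nonpos_min (k := fun x => η - c x) hΩopen
      (fun i j => (hAU i j).mono (hsub.trans hΩU)) hAsymm hμ (fun x hx => hAell x (hsub hx))
      (by fun_prop) (fun x hx => by linarith [hcneg x hx]) hwreg
      (fun x hx => by linarith [hdiv x hx, hfnonneg x hx]) hm
      (fun x hx => hqmin (hsub hx)) hx hxq
  have hconst : Ω ⊆ {x | ∀ᶠ x' in 𝓝 x, w x' = w q} := by
    refine hΩconn.isPreconnected.subset_of_closure_inter_subset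
      isOpen_setOfPred_eventually_nhds ⟨z, hzΩ, hloc z hzΩ hz⟩ ?_
    rintro x ⟨hx, hxΩ⟩
    refine hloc x hxΩ ?_
    have hfreq : ∃ᶠ x' in 𝓝 x, w x' = w q :=
      (mem_closure_iff_frequently.mp hx).mono fun x' hx' => hx'.self_of_nhds
    have hcont : ContinuousAt w x := (hwreg.contDiffAt (hΩopen.mem_nhds hxΩ)).continuousAt
    by_contra hne
    exact hfreq (hcont.eventually_ne hne)
  obtain ⟨x₁, hx₁, hfx₁⟩ := hfne
  have hwx₁ : w x₁ = w q := (hconst hx₁).self_of_nhds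
  have hgrad : ∀ j, pderiv' d j w =ᶠ[𝓝 x₁] fun _ => 0 := fun j => by
    filter_upwards [hΩopen.mem_nhds hx₁] with x hx
    have : w =ᶠ[𝓝 x] fun _ => w q := hconst hx
    simp [pderiv', this.fderiv_eq]
  have hzero : divForm A w x₁ = 0 := by
    refine Finset.sum_eq_zero fun i _ => Finset.sum_eq_zero fun j _ => ?_
    have : (fun y => A i j y * pderiv' d j w y) =ᶠ[𝓝 x₁] fun _ => 0 := by
      filter_upwards [hgrad j] with x hx
      simp [hx]
    unfold pderiv' at this ⊢
    simp [this.fderiv_eq]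
  have h1 := hdiv x₁ hx₁
  have h2 : 0 < f x₁ := lt_of_le_of_ne (hfnonneg x₁ hx₁) hfx₁.symm
  have h3 := mul_nonpos_of_nonneg_of_nonpos
    (by linarith [hcneg x₁ hx₁] : 0 ≤ η - c x₁) (hwx₁.le.trans hm)
  linarith
end

section
/- Let α ∈ (0,2) with α ≠ 1, let β ∈ (0,1), let λ : ℕ → ℝ be strictly increasing with λ k > 0 for all k and λ k → ∞, and let a : ℕ → ℝ with Summable (fun k => |a k|). Then (fun t => (∑' k, a k * E_{α,1}(-(λ k)^β * t^α)) - (∑' k, a k * (λ k)^(-β)) / (Γ(1-α) * t^α)) is O(t^{-2α}) as t → ∞ (big-O along the filter atTop). -/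
open MeasureTheory Set Filter Topology Complex

/-- The closed half-strip `Re w ≥ c`, `|Im w| ≤ θ`. -/
def halfStrip (θ c : ℝ) : Set ℂ := Ici c ×ℂ Icc (-θ) θ

/-- The Hankel integral `∫ e^ζ g(log ζ) dζ / ζ` in the logarithmic coordinate `w = log ζ`: the
contour is the boundary of `halfStrip θ c`, traversed from `∞ - iθ` to `∞ + iθ`. -/
noncomputable def hankelIntegral (θ c : ℝ) (g : ℂ → ℂ) : ℂ :=
  (∫ u in Ioi c, cexp (cexp (u + θ * I)) * g (u + θ * I))
    - (∫ u in Ioi c, cexp (cexp (u + (-θ : ℝ) * I)) * g (u + (-θ : ℝ) * I))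
    + I * ∫ y in (-θ)..θ, cexp (cexp (c + y * I)) * g (c + y * I)

/-- `g` is continuous on `halfStrip θ c`, with `‖g w‖ ≤ M * exp (p * Re w)` there. -/
structure HasExpGrowth (θ c : ℝ) (g : ℂ → ℂ) (M p : ℝ) : Prop where
  continuousOn : ContinuousOn g (halfStrip θ c)
  bound : ∀ w ∈ halfStrip θ c, ‖g w‖ ≤ M * Real.exp (p * w.re)

/-- The constant controlling `hankelIntegral` of a function of exponential growth `p`. -/
noncomputable def hankelConst (θ c p : ℝ) : ℝ :=
  2 * (∫ u in Ioi c, Real.exp (Real.exp u * Real.cos θ) * Real.exp (p * u))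
    + 2 * |θ| * (Real.exp (Real.exp c) * Real.exp (p * c))

lemma norm_cexp_cexp (u y : ℝ) :
    ‖cexp (cexp (u + y * I))‖ = Real.exp (Real.exp u * Real.cos y) := by
  rw [norm_exp]
  congr 1
  rw [exp_re]
  simp

lemma mk_mem_halfStrip {θ c u y : ℝ} (hu : c ≤ u) (hy : |y| ≤ θ) :
    (u + y * I : ℂ) ∈ halfStrip θ c := by
  simpa [halfStrip, mem_reProdIm, hu] using abs_le.mp hy

lemma tendsto_exp_exp_mul_exp {κ : ℝ} (hκ : κ < 0) (p : ℝ) :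
    Tendsto (fun u => Real.exp (Real.exp u * κ) * Real.exp (p * u)) atTop (𝓝 0) := by
  have h := (tendsto_rpow_mul_exp_neg_mul_atTop_nhds_zero p (-κ) (by linarith)).comp
    Real.tendsto_exp_atTop
  refine h.congr fun u => ?_
  simp only [Function.comp, ← Real.exp_mul, neg_neg]
  rw [mul_comm, mul_comm p u, mul_comm κ]

lemma integrableOn_exp_exp_mul_exp {κ : ℝ} (hκ : κ < 0) (p c : ℝ) :
    IntegrableOn (fun u => Real.exp (Real.exp u * κ) * Real.exp (p * u)) (Ioi c) := by
  refine integrable_of_isBigO_exp_neg one_pos (by fun_prop) ?_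
  have h := ((tendsto_exp_exp_mul_exp hκ (p + 1)).isBigO_one ℝ).mul
    (Asymptotics.isBigO_refl (fun u : ℝ => Real.exp (-1 * u)) atTop)
  refine (h.congr (fun u => ?_) fun u => ?_)
  · rw [mul_assoc, ← Real.exp_add]; congr 2; ring
  · simp

lemma cos_neg_of_mem {θ : ℝ} (h : Real.pi / 2 < θ) (h' : θ ≤ Real.pi) : Real.cos θ < 0 :=
  Real.cos_neg_of_pi_div_two_lt_of_lt h (by linarith [Real.pi_pos])

section
variable {θ c M p : ℝ} {g : ℂ → ℂ}

lemma HasExpGrowth.norm_le_exp {κ u y : ℝ} (hg : HasExpGrowth θ c g M p) (hu : c ≤ u)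
    (hy : |y| ≤ θ) (hκ : Real.cos y ≤ κ) :
    ‖cexp (cexp (u + y * I)) * g (u + y * I)‖
      ≤ M * (Real.exp (Real.exp u * κ) * Real.exp (p * u)) := by
  have hb := hg.bound _ (mk_mem_halfStrip hu hy)
  rw [norm_mul, norm_cexp_cexp]
  simp only [add_re, ofReal_re, mul_re, I_re, mul_zero, ofReal_im, I_im, mul_one, sub_self,
    add_zero] at hb
  have hM := (norm_nonneg _).trans hb
  calc _ ≤ Real.exp (Real.exp u * κ) * (M * Real.exp (p * u)) := by gcongr
    _ = _ := by ring

lemma HasExpGrowth.continuousOn_horizontal {y : ℝ} (hg : HasExpGrowth θ c g M p)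
    (hy : |y| ≤ θ) :
    ContinuousOn (fun u : ℝ => cexp (cexp (u + y * I)) * g (u + y * I)) (Ici c) :=
  ContinuousOn.mul (by fun_prop) <| hg.continuousOn.comp (by fun_prop)
    fun _ hu => mk_mem_halfStrip hu hy

lemma HasExpGrowth.continuousOn_vertical {u : ℝ} (hg : HasExpGrowth θ c g M p) (hu : c ≤ u) :
    ContinuousOn (fun y : ℝ => cexp (cexp (u + y * I)) * g (u + y * I)) (Icc (-θ) θ) :=
  ContinuousOn.mul (by fun_prop) <| hg.continuousOn.comp (by fun_prop)
    fun _ hy => mk_mem_halfStrip hu (abs_le.mpr hy)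

lemma HasExpGrowth.integrableOn_horizontal {y : ℝ} (hg : HasExpGrowth θ c g M p)
    (hy : |y| ≤ θ) (hcos : Real.cos y < 0) :
    IntegrableOn (fun u : ℝ => cexp (cexp (u + y * I)) * g (u + y * I)) (Ioi c) := by
  refine Integrable.mono' ((integrableOn_exp_exp_mul_exp hcos p c).const_mul M)
    (((hg.continuousOn_horizontal hy).mono Ioi_subset_Ici_self).aestronglyMeasurable
      measurableSet_Ioi) ?_
  filter_upwards [ae_restrict_mem measurableSet_Ioi] with u hu
  exact hg.norm_le_exp (le_of_lt hu) hy le_rfl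

lemma HasExpGrowth.intervalIntegrable_vertical {u : ℝ} (hg : HasExpGrowth θ c g M p)
    (hθ : 0 ≤ θ) (hu : c ≤ u) :
    IntervalIntegrable (fun y : ℝ => cexp (cexp (u + y * I)) * g (u + y * I)) volume (-θ) θ :=
  ContinuousOn.intervalIntegrable (by
    rw [uIcc_of_le (by linarith)]; exact hg.continuousOn_vertical hu)

lemma hankelIntegral_const_mul (k : ℂ) :
    hankelIntegral θ c (fun w => k * g w) = k * hankelIntegral θ c g := by
  simp only [hankelIntegral, mul_left_comm _ k, integral_const_mul,
    intervalIntegral.integral_const_mul]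
  ring

lemma hankelIntegral_congr {g₂ : ℂ → ℂ} (hθ : 0 ≤ θ) (h : EqOn g g₂ (halfStrip θ c)) :
    hankelIntegral θ c g = hankelIntegral θ c g₂ := by
  have h1 : |θ| ≤ θ := (abs_of_nonneg hθ).le
  have h2 : |-θ| ≤ θ := by rwa [abs_neg]
  have hray : ∀ y : ℝ, |y| ≤ θ → ∫ u in Ioi c, cexp (cexp (u + y * I)) * g (u + y * I)
      = ∫ u in Ioi c, cexp (cexp (u + y * I)) * g₂ (u + y * I) := fun y hy =>
    setIntegral_congr_fun measurableSet_Ioi fun u hu => by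
      simp only [h (mk_mem_halfStrip (le_of_lt hu) hy)]
  have hvert : ∫ y in (-θ)..θ, cexp (cexp (c + y * I)) * g (c + y * I)
      = ∫ y in (-θ)..θ, cexp (cexp (c + y * I)) * g₂ (c + y * I) :=
    intervalIntegral.integral_congr fun y hy => by
      rw [uIcc_of_le (by linarith)] at hy
      simp only [h (mk_mem_halfStrip le_rfl (abs_le.mpr hy))]
  rw [hankelIntegral, hankelIntegral, hray θ h1, hray (-θ) h2, hvert]

lemma hankelIntegral_sub {g₂ : ℂ → ℂ} {M₂ p₂ : ℝ} (hθ : Real.pi / 2 < θ) (hθ' : θ ≤ Real.pi)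
    (hg : HasExpGrowth θ c g M p) (hg₂ : HasExpGrowth θ c g₂ M₂ p₂) :
    hankelIntegral θ c (fun w => g w - g₂ w) = hankelIntegral θ c g - hankelIntegral θ c g₂ := by
  have h0 : 0 ≤ θ := by linarith [Real.pi_pos]
  have hcos := cos_neg_of_mem hθ hθ'
  have hcos' : Real.cos (-θ) < 0 := by rwa [Real.cos_neg]
  have h1 : |θ| ≤ θ := (abs_of_nonneg h0).le
  have h2 : |-θ| ≤ θ := by rwa [abs_neg]
  simp only [hankelIntegral, mul_sub]
  rw [integral_sub (hg.integrableOn_horizontal h1 hcos) (hg₂.integrableOn_horizontal h1 hcos),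
    integral_sub (hg.integrableOn_horizontal h2 hcos') (hg₂.integrableOn_horizontal h2 hcos'),
    intervalIntegral.integral_sub (hg.intervalIntegrable_vertical h0 le_rfl)
      (hg₂.intervalIntegrable_vertical h0 le_rfl)]
  ring

lemma norm_hankelIntegral_le (hθ : Real.pi / 2 < θ) (hθ' : θ ≤ Real.pi)
    (hg : HasExpGrowth θ c g M p) :
    ‖hankelIntegral θ c g‖ ≤ M * hankelConst θ c p := by
  have h0 : 0 ≤ θ := by linarith [Real.pi_pos]
  have hcos := cos_neg_of_mem hθ hθ'
  have h1 : |θ| ≤ θ := (abs_of_nonneg h0).le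
  have h2 : |-θ| ≤ θ := by rwa [abs_neg]
  have key : ∀ y : ℝ, |y| ≤ θ → Real.cos y = Real.cos θ →
      ‖∫ u in Ioi c, cexp (cexp (u + y * I)) * g (u + y * I)‖
        ≤ M * ∫ u in Ioi c, Real.exp (Real.exp u * Real.cos θ) * Real.exp (p * u) := by
    intro y hy hyθ
    rw [← integral_const_mul]
    refine norm_integral_le_of_norm_le ((integrableOn_exp_exp_mul_exp hcos p c).const_mul M) ?_
    filter_upwards [ae_restrict_mem measurableSet_Ioi] with u hu
    exact hg.norm_le_exp (le_of_lt hu) hy hyθ.le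
  have hv : ‖∫ y in (-θ)..θ, cexp (cexp (c + y * I)) * g (c + y * I)‖
      ≤ M * (Real.exp (Real.exp c) * Real.exp (p * c)) * |θ - -θ| := by
    refine intervalIntegral.norm_integral_le_of_norm_le_const fun y hy => ?_
    rw [uIoc_of_le (by linarith)] at hy
    simpa using hg.norm_le_exp le_rfl (abs_le.mpr ⟨hy.1.le, hy.2⟩) (Real.cos_le_one y)
  have hθθ : |θ - -θ| = 2 * |θ| := by rw [sub_neg_eq_add, ← two_mul, abs_mul]; norm_num
  rw [hθθ] at hv
  rw [hankelIntegral, hankelConst]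
  refine (norm_add_le _ _).trans ?_
  rw [norm_mul, norm_I, one_mul]
  have := norm_sub_le (∫ u in Ioi c, cexp (cexp (u + θ * I)) * g (u + θ * I))
    (∫ u in Ioi c, cexp (cexp (u + (-θ : ℝ) * I)) * g (u + (-θ : ℝ) * I))
  linarith [key θ h1 rfl, key (-θ) h2 (Real.cos_neg θ)]

end

lemma integral_boundary_rect_eq_zero {f : ℂ → ℂ} (hf : Differentiable ℂ f) (a b c d : ℝ) :
    (∫ u in a..b, f (u + c * I)) - (∫ u in a..b, f (u + d * I)) + I * (∫ y in c..d, f (b + y * I))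
      - I * ∫ y in c..d, f (a + y * I) = 0 := by
  simpa using integral_boundary_rect_eq_zero_of_differentiableOn f (a + c * I) (b + d * I)
    hf.differentiableOn

lemma hankelIntegral_eq_of_le {θ c c' M p : ℝ} {g : ℂ → ℂ} (hθ : Real.pi / 2 < θ)
    (hθ' : θ ≤ Real.pi) (hg : HasExpGrowth θ c g M p)
    (hd : DifferentiableOn ℂ g (halfStrip θ c)) (hc : c ≤ c') :
    hankelIntegral θ c g = hankelIntegral θ c' g := by
  have h0 : 0 ≤ θ := by linarith [Real.pi_pos]
  have hcos := cos_neg_of_mem hθ hθ'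
  have hcos' : Real.cos (-θ) < 0 := by rwa [Real.cos_neg]
  have h1 : |θ| ≤ θ := (abs_of_nonneg h0).le
  have h2 : |-θ| ≤ θ := by rwa [abs_neg]
  have split : ∀ y : ℝ, |y| ≤ θ → Real.cos y < 0 →
      ∫ u in Ioi c, cexp (cexp (u + y * I)) * g (u + y * I)
        = (∫ u in c..c', cexp (cexp (u + y * I)) * g (u + y * I))
          + ∫ u in Ioi c', cexp (cexp (u + y * I)) * g (u + y * I) := by
    intro y hy hyc
    have hi := hg.integrableOn_horizontal hy hyc
    rw [intervalIntegral.integral_interval_add_Ioi hi (hi.mono_set (Ioi_subset_Ioi hc))]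
  have hrect := integral_boundary_rect_eq_zero_of_differentiableOn
    (fun w => cexp (cexp w) * g w) (c + (-θ : ℝ) * I) (c' + θ * I) (by
      refine DifferentiableOn.mul (by fun_prop) (hd.mono ?_)
      simp only [add_re, ofReal_re, mul_re, I_re, mul_zero, ofReal_im, I_im, mul_one, sub_self,
        add_zero, add_im, mul_im, zero_add]
      rw [uIcc_of_le hc, uIcc_of_le (by linarith), halfStrip]
      exact reProdIm_subset_iff.mpr (Set.prod_mono Icc_subset_Ici_self le_rfl))
  simp only [add_re, ofReal_re, mul_re, I_re, mul_zero, ofReal_im, I_im, mul_one, sub_self,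
    add_zero, add_im, mul_im, zero_add, smul_eq_mul] at hrect
  rw [hankelIntegral, hankelIntegral, split θ h1 hcos, split (-θ) h2 hcos']
  linear_combination -hrect

lemma integral_Ioi_sub_integral_Ioi {a b κ c M p : ℝ} {g : ℂ → ℂ}
    (hg : HasExpGrowth Real.pi c g M p) (hd : Differentiable ℂ g) (hab : a ≤ b)
    (ha : -Real.pi ≤ a) (hb : b ≤ Real.pi) (hκ : κ < 0) (hcos : ∀ y ∈ Icc a b, Real.cos y ≤ κ) :
    (∫ u in Ioi c, cexp (cexp (u + a * I)) * g (u + a * I))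
      - (∫ u in Ioi c, cexp (cexp (u + b * I)) * g (u + b * I))
      = I * ∫ y in a..b, cexp (cexp (c + y * I)) * g (c + y * I) := by
  have hmem : ∀ y ∈ Icc a b, |y| ≤ Real.pi := fun y hy =>
    abs_le.mpr ⟨ha.trans hy.1, hy.2.trans hb⟩
  have hray : ∀ y ∈ Icc a b, Tendsto
      (fun R : ℝ => ∫ u in c..R, cexp (cexp (u + y * I)) * g (u + y * I)) atTop
      (𝓝 (∫ u in Ioi c, cexp (cexp (u + y * I)) * g (u + y * I))) := fun y hy =>
    intervalIntegral_tendsto_integral_Ioi c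
      (hg.integrableOn_horizontal (hmem y hy) ((hcos y hy).trans_lt hκ)) tendsto_id
  have hside : Tendsto (fun R : ℝ => ∫ y in a..b, cexp (cexp (R + y * I)) * g (R + y * I))
      atTop (𝓝 0) := by
    have hlim := ((tendsto_exp_exp_mul_exp hκ p).const_mul M).mul_const |b - a|
    rw [mul_zero, zero_mul] at hlim
    refine squeeze_zero_norm' ?_ hlim
    filter_upwards [eventually_ge_atTop c] with R hR
    refine intervalIntegral.norm_integral_le_of_norm_le_const fun y hy => ?_
    rw [uIoc_of_le hab] at hy
    have hy' := Ioc_subset_Icc_self hy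
    exact hg.norm_le_exp hR (hmem y hy') (hcos y hy')
  have hF : Differentiable ℂ fun w => cexp (cexp w) * g w := by fun_prop
  have hlim := (((hray a ⟨le_rfl, hab⟩).sub (hray b ⟨hab, le_rfl⟩)).add (hside.const_mul I)).sub
    (tendsto_const_nhds (x := I * ∫ y in a..b, cexp (cexp (c + y * I)) * g (c + y * I)))
  have h0 := tendsto_nhds_unique hlim (tendsto_const_nhds.congr fun R =>
    (integral_boundary_rect_eq_zero hF c R a b).symm)
  linear_combination h0

lemma hankelIntegral_eq_pi {θ c M p : ℝ} {g : ℂ → ℂ} (hθ : Real.pi / 2 < θ)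
    (hθ' : θ ≤ Real.pi) (hg : HasExpGrowth Real.pi c g M p) (hd : Differentiable ℂ g) :
    hankelIntegral θ c g = hankelIntegral Real.pi c g := by
  have hpi := Real.pi_pos
  have hcos : ∀ y ∈ Icc θ Real.pi, Real.cos y ≤ Real.cos θ := fun y hy =>
    Real.cos_le_cos_of_nonneg_of_le_pi (by linarith) hy.2 hy.1
  have hκ := cos_neg_of_mem hθ hθ'
  have h1 := integral_Ioi_sub_integral_Ioi hg hd hθ' (by linarith) le_rfl hκ hcos
  have h2 := integral_Ioi_sub_integral_Ioi hg hd (neg_le_neg hθ') le_rfl (by linarith) hκ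
    (fun y hy => by
      rw [← Real.cos_neg]; exact hcos _ ⟨by linarith [hy.2], by linarith [hy.1]⟩)
  have hF : Continuous fun y : ℝ => cexp (cexp (c + y * I)) * g (c + y * I) := by
    have := hd.continuous
    fun_prop
  have hi := fun a b => hF.intervalIntegrable (μ := volume) a b
  have hsplit := intervalIntegral.integral_add_adjacent_intervals (hi (-Real.pi) (-θ)) (hi (-θ) θ)
  have hsplit' := intervalIntegral.integral_add_adjacent_intervals (hi (-Real.pi) θ)
    (hi θ Real.pi)
  rw [hankelIntegral, hankelIntegral, ← hsplit', ← hsplit]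
  linear_combination h1 + h2

lemma hasExpGrowth_cexp (θ c a : ℝ) : HasExpGrowth θ c (fun w => cexp (a * w)) 1 a where
  continuousOn := by fun_prop
  bound w _ := by simp [norm_exp]

lemma hankelIntegral_cexp_congr {θ c c' : ℝ} (hθ : Real.pi / 2 < θ) (hθ' : θ ≤ Real.pi) (a : ℝ) :
    hankelIntegral θ c (fun w => cexp (a * w))
      = hankelIntegral Real.pi c' (fun w => cexp (a * w)) := by
  have hd : Differentiable ℂ fun w => cexp (a * w) := by fun_prop
  have hpi := Real.pi_pos
  rw [hankelIntegral_eq_pi hθ hθ' (hasExpGrowth_cexp _ _ a) hd]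
  have h := fun {c₁ c₂ : ℝ} (hc : c₁ ≤ c₂) => hankelIntegral_eq_of_le (by linarith) le_rfl
    (hasExpGrowth_cexp Real.pi c₁ a) hd.differentiableOn hc
  exact (le_total c c').elim h fun hc => (h hc).symm

lemma hasDerivAt_cexp_cexp_mul (a : ℝ) (w : ℂ) :
    HasDerivAt (fun w => cexp (cexp w) * cexp (a * w))
      (cexp (cexp w) * (cexp ((a + 1 : ℝ) * w) - (-a : ℂ) * cexp (a * w))) w := by
  have h := (hasDerivAt_exp w).cexp.mul (((hasDerivAt_id w).const_mul (a : ℂ)).cexp)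
  refine h.congr_deriv ?_
  have : ((a + 1 : ℝ) : ℂ) * w = a * w + w := by push_cast; ring
  rw [this, Complex.exp_add]
  simp only [id]
  ring

/-- Integration by parts along the Hankel contour. -/
lemma hankelIntegral_cexp_add_one {θ c : ℝ} (hθ : Real.pi / 2 < θ) (hθ' : θ ≤ Real.pi) (a : ℝ) :
    hankelIntegral θ c (fun w => cexp ((a + 1 : ℝ) * w))
      = -a * hankelIntegral θ c (fun w => cexp (a * w)) := by
  have h0 : 0 ≤ θ := by linarith [Real.pi_pos]
  have hcos := cos_neg_of_mem hθ hθ'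
  have hcos' : Real.cos (-θ) < 0 := by rwa [Real.cos_neg]
  have h1 : |θ| ≤ θ := (abs_of_nonneg h0).le
  have h2 : |-θ| ≤ θ := by rwa [abs_neg]
  have hg := hasExpGrowth_cexp θ c (a + 1)
  have hg₂ : HasExpGrowth θ c (fun w => (-a : ℂ) * cexp (a * w)) |a| a :=
    ⟨by fun_prop, fun w _ => by simp [norm_exp]⟩
  rw [← sub_eq_zero, ← hankelIntegral_const_mul, ← hankelIntegral_sub hθ hθ' hg hg₂]
  have hray : ∀ y : ℝ, |y| ≤ θ → Real.cos y < 0 →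
      ∫ u in Ioi c, cexp (cexp (u + y * I))
          * (cexp ((a + 1 : ℝ) * (u + y * I)) - (-a : ℂ) * cexp (a * (u + y * I)))
        = 0 - cexp (cexp (c + y * I)) * cexp (a * (c + y * I)) := by
    intro y hy hyc
    refine integral_Ioi_of_hasDerivAt_of_tendsto'
      (f := fun u : ℝ => cexp (cexp (u + y * I)) * cexp (a * (u + y * I))) (fun u _ => ?_) ?_ ?_
    · have hin : HasDerivAt (fun u : ℝ => (u + y * I : ℂ)) 1 u :=
        (ofRealCLM.hasDerivAt).add_const _
      exact ((hasDerivAt_cexp_cexp_mul a (u + y * I)).comp u hin).congr_deriv (mul_one _)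
    · simp only [mul_sub (cexp (cexp _))]
      exact (hg.integrableOn_horizontal hy hyc).sub (hg₂.integrableOn_horizontal hy hyc)
    · refine squeeze_zero_norm' ?_ (tendsto_exp_exp_mul_exp hyc a)
      filter_upwards [eventually_ge_atTop c] with u hu
      simpa using (hasExpGrowth_cexp θ c a).norm_le_exp hu hy le_rfl
  have hvert : I * ∫ y in (-θ)..θ, cexp (cexp (c + y * I))
          * (cexp ((a + 1 : ℝ) * (c + y * I)) - (-a : ℂ) * cexp (a * (c + y * I)))
        = cexp (cexp (c + θ * I)) * cexp (a * (c + θ * I))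
          - cexp (cexp (c + (-θ : ℝ) * I)) * cexp (a * (c + (-θ : ℝ) * I)) := by
    rw [← intervalIntegral.integral_const_mul]
    refine intervalIntegral.integral_eq_sub_of_hasDerivAt
      (f := fun y : ℝ => cexp (cexp (c + y * I)) * cexp (a * (c + y * I))) (fun y _ => ?_) ?_
    · have hin : HasDerivAt (fun y : ℝ => (c + y * I : ℂ)) I y := by
        simpa using ((ofRealCLM.hasDerivAt (x := y)).mul_const I).const_add (c : ℂ)
      rw [mul_comm I]
      exact (hasDerivAt_cexp_cexp_mul a (c + y * I)).comp y hin
    · exact Continuous.intervalIntegrable (by fun_prop) _ _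
  rw [hankelIntegral, hray θ h1 hcos, hray (-θ) h2 hcos', hvert]
  ring

lemma tendsto_integral_exp_neg_exp_mul_exp {a : ℝ} (ha : 0 < a) :
    Tendsto (fun c => ∫ u in Ioi c, Real.exp (-Real.exp u) * Real.exp (a * u)) atBot
      (𝓝 (Real.Gamma a)) := by
  have hsub : ∀ c : ℝ, ∫ u in Ioi c, Real.exp (-Real.exp u) * Real.exp (a * u)
      = ∫ r in Ioi (Real.exp c), Real.exp (-r) * r ^ (a - 1) := by
    intro c
    rw [← integral_comp_exp_Ioi]
    refine integral_congr_ae (.of_forall fun u => ?_)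
    simp only [smul_eq_mul, ← Real.exp_mul, ← Real.exp_add]
    congr 1
    ring
  simp only [hsub]
  rw [Real.Gamma_eq_integral ha]
  have hcover : AECover (volume.restrict (Ioi (0 : ℝ))) atBot fun c => Ioi (Real.exp c) :=
    aecover_Ioi_of_Ioi Real.tendsto_exp_atBot
  refine (hcover.integral_tendsto_of_countably_generated
    (Real.GammaIntegral_convergent ha)).congr fun c => ?_
  rw [Measure.restrict_restrict measurableSet_Ioi, Ioi_inter_Ioi,
    max_eq_left (Real.exp_pos c).le]

lemma inv_Gamma_one_sub (a : ℝ) (ha : 0 < a) :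
    (Real.Gamma (1 - a))⁻¹ = Real.Gamma a * Real.sin (Real.pi * a) / Real.pi := by
  have h := Real.Gamma_mul_Gamma_one_sub a
  have hG := (Real.Gamma_pos_of_pos ha).ne'
  have hpi := Real.pi_ne_zero
  have h1 : Real.Gamma (1 - a) = Real.pi / Real.sin (Real.pi * a) / Real.Gamma a := by
    rw [← h]; field_simp
  rw [h1]
  simp only [inv_div, div_div_eq_mul_div]

lemma hankelIntegral_cexp_of_pos {a : ℝ} (ha : 0 < a) (c : ℝ) :
    hankelIntegral Real.pi c (fun w => cexp (a * w))
      = 2 * Real.pi * I * ((Real.Gamma (1 - a))⁻¹ : ℝ) := by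
  have hpi := Real.pi_pos
  have hray : ∀ (s : ℝ), cexp (s * I) = -1 → ∀ c : ℝ,
      ∫ u in Ioi c, cexp (cexp (u + s * I)) * cexp (a * (u + s * I))
        = cexp (a * s * I) * (∫ u in Ioi c, Real.exp (-Real.exp u) * Real.exp (a * u) : ℝ) := by
    intro s hs c
    rw [← integral_complex_ofReal, ← integral_const_mul]
    refine integral_congr_ae (.of_forall fun u => ?_)
    simp only [Complex.exp_add, hs, mul_add, ← mul_assoc]
    push_cast
    simp only [mul_neg, mul_one]
    ring
  have hpos : cexp ((Real.pi : ℝ) * I) = -1 := exp_pi_mul_I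
  have hneg : cexp ((-Real.pi : ℝ) * I) = -1 := by
    rw [ofReal_neg, neg_mul, Complex.exp_neg, exp_pi_mul_I]; norm_num
  have hvert : Tendsto (fun c : ℝ => ∫ y in (-Real.pi)..Real.pi,
      cexp (cexp (c + y * I)) * cexp (a * (c + y * I))) atBot (𝓝 0) := by
    have hlim : Tendsto (fun c : ℝ => 1 * (Real.exp (Real.exp c * 1) * Real.exp (a * c))
        * |Real.pi - -Real.pi|) atBot (𝓝 (1 * (Real.exp (0 * 1) * 0) * |Real.pi - -Real.pi|)) := by
      refine (Tendsto.mul ?_ ?_).const_mul 1 |>.mul_const _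
      · exact (Real.continuous_exp.tendsto _).comp (Real.tendsto_exp_atBot.mul_const 1)
      · exact Real.tendsto_exp_atBot.comp (tendsto_id.const_mul_atBot ha)
    rw [mul_zero, mul_zero, zero_mul] at hlim
    refine squeeze_zero_norm (fun c => ?_) hlim
    refine intervalIntegral.norm_integral_le_of_norm_le_const fun y hy => ?_
    rw [uIoc_of_le (by linarith)] at hy
    exact (hasExpGrowth_cexp Real.pi c a).norm_le_exp le_rfl (abs_le.mpr ⟨hy.1.le, hy.2⟩)
      (Real.cos_le_one y)
  have hG : Tendsto (fun c : ℝ =>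
      ((∫ u in Ioi c, Real.exp (-Real.exp u) * Real.exp (a * u) : ℝ) : ℂ)) atBot
      (𝓝 (Real.Gamma a)) :=
    (continuous_ofReal.tendsto _).comp (tendsto_integral_exp_neg_exp_mul_exp ha)
  have hlim := ((hG.const_mul (cexp (a * Real.pi * I))).sub
    (hG.const_mul (cexp (a * (-Real.pi : ℝ) * I)))).add (hvert.const_mul I)
  refine (tendsto_nhds_unique hlim (tendsto_const_nhds
    (x := hankelIntegral Real.pi c fun w => cexp (a * w)).congr fun c' => ?_)).symm.trans ?_
  · rw [hankelIntegral_cexp_congr (by linarith) le_rfl a (c' := c'), hankelIntegral,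
      hray _ hpos, hray _ hneg]
  · rw [inv_Gamma_one_sub a ha]
    have hpi' : (Real.pi : ℂ) ≠ 0 := by exact_mod_cast hpi.ne'
    push_cast
    rw [Complex.sin, mul_comm (a : ℂ), mul_comm (a : ℂ)]
    field_simp
    ring_nf
    simp only [I_sq]
    ring

lemma norm_cexp_mul_sub_one_le {a : ℝ} (ha : 0 ≤ a) (ha1 : a ≤ 1) {w : ℂ} {θ : ℝ}
    (hw : w ∈ halfStrip θ 0) :
    ‖cexp (a * w) - 1‖ ≤ a * (1 + θ) * Real.exp θ * Real.exp (2 * w.re) := by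
  have hre : 0 ≤ w.re := hw.1
  have him : |w.im| ≤ θ := abs_le.mpr hw.2
  have hθ : 0 ≤ θ := (abs_nonneg _).trans him
  have hexp := Real.add_one_le_exp w.re
  have hnorm : ‖w‖ ≤ w.re + θ := by
    linarith [norm_le_abs_re_add_abs_im w, abs_of_nonneg hre]
  have hnorm' : ‖w‖ ≤ (1 + θ) * Real.exp w.re := by nlinarith
  have haw : ‖(a * w : ℂ)‖ = a * ‖w‖ := by simp [abs_of_nonneg ha]
  have h := norm_exp_sub_sum_le_norm_mul_exp (a * w) 1
  rw [Finset.sum_range_one, pow_zero, Nat.factorial_zero, Nat.cast_one, div_one, pow_one,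
    haw] at h
  calc _ ≤ a * ‖w‖ * Real.exp (a * ‖w‖) := h
    _ ≤ a * ((1 + θ) * Real.exp w.re) * Real.exp (w.re + θ) := by
      gcongr
      exact (mul_le_of_le_one_left (norm_nonneg _) ha1).trans hnorm
    _ = _ := by rw [Real.exp_add, two_mul, Real.exp_add]; ring

lemma hankelIntegral_one :
    hankelIntegral Real.pi 0 (fun _ => 1) = 2 * Real.pi * I := by
  have hpi := Real.pi_pos
  have hcont : Tendsto (fun a : ℝ => hankelIntegral Real.pi 0 (fun w => cexp (a * w))
      - hankelIntegral Real.pi 0 (fun _ => 1)) (𝓝[>] 0) (𝓝 0) := by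
    have hlim : Tendsto (fun a : ℝ => a * (1 + Real.pi) * Real.exp Real.pi
        * hankelConst Real.pi 0 2) (𝓝[>] 0) (𝓝 0) := by
      refine Tendsto.mono_left ?_ nhdsWithin_le_nhds
      exact Continuous.tendsto' (by fun_prop) _ _ (by simp)
    refine squeeze_zero_norm' ?_ hlim
    filter_upwards [Ioo_mem_nhdsGT one_pos] with a ha
    have h1 : HasExpGrowth Real.pi 0 (fun _ => (1 : ℂ)) 1 0 :=
      ⟨by fun_prop, fun w _ => by simp⟩
    rw [← hankelIntegral_sub (by linarith) le_rfl (hasExpGrowth_cexp _ _ a) h1]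
    exact norm_hankelIntegral_le (by linarith) le_rfl
      ⟨by fun_prop, fun w hw => norm_cexp_mul_sub_one_le ha.1.le ha.2.le hw⟩
  have hG : Tendsto (fun a : ℝ => (2 * Real.pi * I * ((Real.Gamma (1 - a))⁻¹ : ℝ) : ℂ)) (𝓝[>] 0)
      (𝓝 (2 * Real.pi * I)) := by
    have hc : ContinuousAt (fun a : ℝ => (Real.Gamma (1 - a))⁻¹) 0 := by
      refine ContinuousAt.inv₀ (ContinuousAt.comp (g := Real.Gamma) ?_ (by fun_prop)) (by simp)
      rw [sub_zero]
      exact (Real.differentiableAt_Gamma fun m h => by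
        linarith [(Nat.cast_nonneg m : (0 : ℝ) ≤ m)]).continuousAt
    have h := ((continuous_ofReal.tendsto _).comp hc).const_mul (2 * Real.pi * I : ℂ)
    simpa using h.mono_left nhdsWithin_le_nhds
  have h2 := hcont.sub hG
  have h3 : Tendsto (fun _ : ℝ => -hankelIntegral Real.pi 0 (fun _ => 1)) (𝓝[>] 0)
      (𝓝 (0 - 2 * Real.pi * I)) := by
    refine h2.congr' ?_
    filter_upwards [self_mem_nhdsWithin] with a ha
    rw [hankelIntegral_cexp_of_pos ha]
    ring
  linear_combination -tendsto_nhds_unique tendsto_const_nhds h3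

/-- Hankel's formula for the reciprocal Gamma function. -/
lemma hankelIntegral_cexp {θ c : ℝ} (hθ : Real.pi / 2 < θ) (hθ' : θ ≤ Real.pi) (a : ℝ) :
    hankelIntegral θ c (fun w => cexp (a * w))
      = 2 * Real.pi * I * ((Real.Gamma (1 - a))⁻¹ : ℝ) := by
  have hpi := Real.pi_pos
  rw [hankelIntegral_cexp_congr hθ hθ' a (c' := 0)]
  obtain ⟨n, hn⟩ := exists_nat_gt (-a)
  induction n generalizing a with
  | zero => exact hankelIntegral_cexp_of_pos (by simpa using hn) 0
  | succ n ih =>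
    rcases eq_or_ne a 0 with rfl | ha
    · simpa using hankelIntegral_one
    · have h := ih (a + 1) (by push_cast at hn; linarith)
      rw [hankelIntegral_cexp_add_one (by linarith) le_rfl] at h
      have ha' : (a : ℂ) ≠ 0 := by exact_mod_cast ha
      have hG : Real.Gamma (1 - a) = -a * Real.Gamma (1 - (a + 1)) := by
        have := Real.Gamma_add_one (neg_ne_zero.mpr ha)
        rw [show 1 - a = -a + 1 by ring, this]
        congr 2
        ring
      rw [hG]
      rw [mul_inv]
      push_cast at h ⊢
      rw [neg_mul, neg_eq_iff_eq_neg] at h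
      refine mul_left_cancel₀ ha' (h.trans ?_)
      field_simp

lemma exists_le_norm_cexp_add {α θ : ℝ} (hα : 0 < α) (hθ : 0 ≤ θ) (hαθ : α * θ < Real.pi) :
    ∃ κ > 0, ∀ w : ℂ, |w.im| ≤ θ → ∀ x : ℝ, 0 ≤ x →
      κ * Real.exp (α * w.re) ≤ ‖cexp (α * w) + x‖ ∧ κ * x ≤ ‖cexp (α * w) + x‖ := by
  have hcos : -1 < Real.cos (α * θ) := by
    rw [← Real.cos_pi]
    exact Real.cos_lt_cos_of_nonneg_of_le_pi (by positivity) le_rfl hαθ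
  refine ⟨√((1 + Real.cos (α * θ)) / 2), Real.sqrt_pos.mpr (by linarith), fun w hw x hx => ?_⟩
  set k := Real.cos (α * θ)
  set ρ := Real.exp (α * w.re) with hρ
  have hρ0 : 0 < ρ := Real.exp_pos _
  have hk : k ≤ Real.cos (α * w.im) := by
    rw [← Real.cos_abs (α * w.im), abs_mul, abs_of_pos hα]
    exact Real.cos_le_cos_of_nonneg_of_le_pi (by positivity) hαθ.le (by gcongr)
  have hk1 : k ≤ 1 := Real.cos_le_one _
  have hsq : ‖cexp (α * w) + x‖ ^ 2 = ρ ^ 2 + 2 * ρ * x * Real.cos (α * w.im) + x ^ 2 := by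
    rw [← normSq_eq_norm_sq, normSq_apply]
    simp only [add_re, add_im, exp_re, exp_im, mul_re, mul_im, ofReal_re, ofReal_im, zero_mul,
      sub_zero, add_zero, ← hρ]
    linear_combination ρ ^ 2 * Real.sin_sq_add_cos_sq (α * w.im)
  have hle : ρ ^ 2 + 2 * ρ * x * k + x ^ 2 ≤ ‖cexp (α * w) + x‖ ^ 2 := by
    rw [hsq]
    gcongr
  have key : ∀ s : ℝ, 0 ≤ s → s ≤ ρ + x → √((1 + k) / 2) * s ≤ ‖cexp (α * w) + x‖ := by
    intro s hs hsx
    refine abs_le_of_sq_le_sq' ?_ (norm_nonneg _) |>.2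
    rw [mul_pow, Real.sq_sqrt (by linarith)]
    refine le_trans ?_ hle
    have : s ^ 2 ≤ (ρ + x) ^ 2 := by gcongr
    nlinarith [mul_nonneg (by linarith : 0 ≤ 1 - k) (sq_nonneg (ρ - x))]
  exact ⟨key _ hρ0.le (by linarith), key _ hx (by linarith)⟩

section
variable {α θ κ x : ℝ}

lemma hasExpGrowth_cexp_of_nonpos {a c : ℝ} (ha : a ≤ 0) :
    HasExpGrowth θ c (fun w => cexp (a * w)) (Real.exp (a * c)) 0 where
  continuousOn := by fun_prop
  bound w hw := by
    have hw' : c ≤ w.re := hw.1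
    have := mul_le_mul_of_nonpos_left hw' ha
    simpa [norm_exp] using this

lemma cexp_add_ne_zero {c : ℝ} {w : ℂ} (hκ : 0 < κ)
    (hbound : ∀ w : ℂ, |w.im| ≤ θ → κ * Real.exp (α * w.re) ≤ ‖cexp (α * w) + x‖)
    (hw : w ∈ halfStrip θ c) : cexp (α * w) + x ≠ 0 := by
  have := hbound w (abs_le.mpr hw.2)
  have : 0 < κ * Real.exp (α * w.re) := by positivity
  exact norm_pos_iff.mp (by linarith)

lemma differentiableOn_cexp_div (hκ : 0 < κ)
    (hbound : ∀ w : ℂ, |w.im| ≤ θ → κ * Real.exp (α * w.re) ≤ ‖cexp (α * w) + x‖)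
    (c : ℝ) :
    DifferentiableOn ℂ (fun w => cexp (α * w) / (cexp (α * w) + x)) (halfStrip θ c) :=
  DifferentiableOn.div (by fun_prop) (by fun_prop) fun _ hw => cexp_add_ne_zero hκ hbound hw

lemma hasExpGrowth_cexp_mul_div {a c : ℝ} (hκ : 0 < κ)
    (hbound : ∀ w : ℂ, |w.im| ≤ θ → κ * Real.exp (α * w.re) ≤ ‖cexp (α * w) + x‖)
    (ha : a ≤ 0) :
    HasExpGrowth θ c (fun w => cexp (a * w) * (cexp (α * w) / (cexp (α * w) + x)))
      (Real.exp (a * c) * κ⁻¹) 0 where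
  continuousOn := ContinuousOn.mul (by fun_prop)
    (differentiableOn_cexp_div hκ hbound c).continuousOn
  bound w hw := by
    have h1 := (hasExpGrowth_cexp_of_nonpos ha (θ := θ)).bound w hw
    have h2 := hbound w (abs_le.mpr hw.2)
    have h3 : ‖cexp (α * w) / (cexp (α * w) + x)‖ ≤ κ⁻¹ := by
      have h4 := norm_pos_iff.mpr (cexp_add_ne_zero hκ hbound hw)
      rw [norm_div, div_le_iff₀ h4, ← div_eq_inv_mul, le_div_iff₀' hκ]
      simpa [norm_exp] using h2
    rw [norm_mul]
    simp only [zero_mul, Real.exp_zero, mul_one] at h1 ⊢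
    gcongr

lemma hankelIntegral_cexp_div_eq_sum (hκ : 0 < κ)
    (hbound : ∀ w : ℂ, |w.im| ≤ θ → κ * Real.exp (α * w.re) ≤ ‖cexp (α * w) + x‖)
    (hθ : Real.pi / 2 < θ) (hθ' : θ ≤ Real.pi) (hα : 0 < α)
    (c : ℝ) (N : ℕ) :
    hankelIntegral θ c (fun w => cexp (α * w) / (cexp (α * w) + x))
      = ∑ n ∈ Finset.range N,
          (-x : ℂ) ^ n * hankelIntegral θ c (fun w => cexp ((-(α * n) : ℝ) * w))
        + (-x : ℂ) ^ N * hankelIntegral θ c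
          (fun w => cexp ((-(α * N) : ℝ) * w) * (cexp (α * w) / (cexp (α * w) + x))) := by
  induction N with
  | zero => simp
  | succ N ih =>
    have hN : ∀ n : ℕ, -(α * n) ≤ 0 := fun n => by
      have : 0 ≤ α * n := by positivity
      linarith
    have hg' := hasExpGrowth_cexp_of_nonpos (θ := θ) (c := c) (hN N)
    have hg'' : HasExpGrowth θ c
        (fun w => (x : ℂ) * (cexp ((-(α * (N + 1 : ℕ)) : ℝ) * w)
          * (cexp (α * w) / (cexp (α * w) + x))))
        (|x| * (Real.exp (-(α * (N + 1 : ℕ)) * c) * κ⁻¹)) 0 := by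
      have h := hasExpGrowth_cexp_mul_div hκ hbound (hN (N + 1)) (c := c)
      refine ⟨continuousOn_const.mul h.continuousOn, fun w hw => ?_⟩
      rw [norm_mul, norm_real, Real.norm_eq_abs, mul_assoc]
      exact mul_le_mul_of_nonneg_left (h.bound w hw) (abs_nonneg x)
    have hstep : hankelIntegral θ c
          (fun w => cexp ((-(α * N) : ℝ) * w) * (cexp (α * w) / (cexp (α * w) + x)))
        = hankelIntegral θ c (fun w => cexp ((-(α * N) : ℝ) * w))
          - x * hankelIntegral θ c (fun w => cexp ((-(α * (N + 1 : ℕ)) : ℝ) * w)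
            * (cexp (α * w) / (cexp (α * w) + x))) := by
      rw [← hankelIntegral_const_mul, ← hankelIntegral_sub hθ hθ' hg' hg'']
      refine hankelIntegral_congr (by linarith [Real.pi_pos]) fun w hw => ?_
      have hne := cexp_add_ne_zero hκ hbound hw
      have hexp : cexp ((-(α * N) : ℝ) * w)
          = cexp ((-(α * (N + 1 : ℕ)) : ℝ) * w) * cexp (α * w) := by
        rw [← Complex.exp_add]
        congr 1
        push_cast
        ring
      have hdiv : cexp (α * w) / (cexp (α * w) + x)
          = 1 - x * ((cexp (α * w))⁻¹ * (cexp (α * w) / (cexp (α * w) + x))) := by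
        rw [eq_sub_iff_add_eq]
        have := Complex.exp_ne_zero (α * w)
        field_simp
      have := Complex.exp_ne_zero (α * w)
      simp only [hexp]
      nth_rewrite 1 [hdiv]
      rw [mul_sub, mul_one]
      field_simp
    rw [ih, Finset.sum_range_succ, hstep]
    ring

end

lemma mittagLeffler_neg_eq_hankelIntegral {α θ κ x : ℝ} (hκ : 0 < κ)
    (hbound : ∀ w : ℂ, |w.im| ≤ θ → κ * Real.exp (α * w.re) ≤ ‖cexp (α * w) + x‖)
    (hθ : Real.pi / 2 < θ) (hθ' : θ ≤ Real.pi) (hα : 0 < α) (hx : 0 ≤ x) :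
    2 * Real.pi * I * mittagLeffler α (-x)
      = hankelIntegral θ 0 (fun w => cexp (α * w) / (cexp (α * w) + x)) := by
  have hpi := Real.pi_pos
  obtain ⟨c, hc, hxc⟩ : ∃ c : ℝ, 0 ≤ c ∧ 2 * x ≤ Real.exp (α * c) :=
    ((eventually_ge_atTop 0).and ((Real.tendsto_exp_atTop.comp
      (tendsto_id.const_mul_atTop hα)).eventually_ge_atTop (2 * x))).exists
  have hN : ∀ n : ℕ, -(α * n) ≤ 0 := fun n => by
    have : 0 ≤ α * n := by positivity
    linarith
  have hB : 0 ≤ hankelConst θ c 0 := by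
    rw [hankelConst]
    have : 0 ≤ ∫ u in Ioi c, Real.exp (Real.exp u * Real.cos θ) * Real.exp (0 * u) :=
      integral_nonneg fun u => by positivity
    positivity
  have hpow : ∀ n : ℕ, x ^ n * Real.exp (-(α * n) * c) ≤ (1 / 2) ^ n := by
    intro n
    have h1 : Real.exp (-(α * n) * c) = (Real.exp (α * c))⁻¹ ^ n := by
      rw [← Real.exp_neg, ← Real.exp_nat_mul]
      congr 1
      ring
    rw [h1, ← mul_pow]
    gcongr
    rw [← div_eq_mul_inv, div_le_iff₀ (Real.exp_pos _)]
    linarith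
  have hterm : ∀ n : ℕ, (2 * Real.pi * I : ℂ) * (((-x) ^ n / Real.Gamma (α * n + 1) : ℝ) : ℂ)
      = (-x : ℂ) ^ n * hankelIntegral θ c (fun w => cexp ((-(α * n) : ℝ) * w)) := by
    intro n
    rw [hankelIntegral_cexp hθ hθ', sub_neg_eq_add, add_comm (1 : ℝ)]
    push_cast
    ring
  have hsummable : Summable fun n : ℕ => (-x) ^ n / Real.Gamma (α * n + 1) := by
    refine Summable.of_norm_bounded (g := fun n : ℕ => (1 / 2 : ℝ) ^ n
      * (hankelConst θ c 0 * (2 * Real.pi)⁻¹)) (summable_geometric_two.mul_right _) fun n => ?_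
    have h1 := congrArg norm (hterm n)
    have h2 := norm_hankelIntegral_le hθ hθ' (hasExpGrowth_cexp_of_nonpos (θ := θ) (c := c) (hN n))
    rw [norm_mul, norm_real, norm_mul (_ ^ n), norm_pow, norm_neg, norm_real,
      Real.norm_of_nonneg hx] at h1
    have h3 : ‖(2 * Real.pi * I : ℂ)‖ = 2 * Real.pi := by simp [abs_of_pos hpi]
    rw [h3] at h1
    rw [← mul_assoc, ← div_eq_mul_inv, le_div_iff₀' (by positivity), h1]
    calc _ ≤ x ^ n * (Real.exp (-(α * n) * c) * hankelConst θ c 0) := by gcongr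
      _ = x ^ n * Real.exp (-(α * n) * c) * hankelConst θ c 0 := by ring
      _ ≤ _ := by gcongr; exact hpow n
  have hsum : Tendsto (fun N : ℕ => ∑ n ∈ Finset.range N,
      (-x : ℂ) ^ n * hankelIntegral θ c (fun w => cexp ((-(α * n) : ℝ) * w))) atTop
      (𝓝 (2 * Real.pi * I * mittagLeffler α (-x))) := by
    have h := ((hasSum_ofReal.mpr hsummable.hasSum).mul_left (2 * Real.pi * I : ℂ)).tendsto_sum_nat
    simp only [hterm] at h
    exact h
  have hrem : Tendsto (fun N : ℕ => (-x : ℂ) ^ N * hankelIntegral θ c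
      (fun w => cexp ((-(α * N) : ℝ) * w) * (cexp (α * w) / (cexp (α * w) + x)))) atTop
      (𝓝 0) := by
    have hlim : Tendsto (fun N : ℕ => (1 / 2 : ℝ) ^ N * (κ⁻¹ * hankelConst θ c 0)) atTop
        (𝓝 (0 * (κ⁻¹ * hankelConst θ c 0))) :=
      (tendsto_pow_atTop_nhds_zero_of_lt_one (by norm_num) (by norm_num)).mul_const _
    rw [zero_mul] at hlim
    refine squeeze_zero_norm (fun N => ?_) hlim
    have h2 := norm_hankelIntegral_le hθ hθ' (hasExpGrowth_cexp_mul_div hκ hbound (hN N) (c := c))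
    rw [norm_mul, norm_pow, norm_neg, norm_real, Real.norm_of_nonneg hx]
    calc _ ≤ x ^ N * (Real.exp (-(α * N) * c) * κ⁻¹ * hankelConst θ c 0) := by gcongr
      _ = x ^ N * Real.exp (-(α * N) * c) * (κ⁻¹ * hankelConst θ c 0) := by ring
      _ ≤ _ := by gcongr; exact hpow N
  have hshift : hankelIntegral θ 0 (fun w => cexp (α * w) / (cexp (α * w) + x))
      = hankelIntegral θ c (fun w => cexp (α * w) / (cexp (α * w) + x)) := by
    have h := hasExpGrowth_cexp_mul_div hκ hbound (le_refl 0) (c := 0)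
    simp only [ofReal_zero, zero_mul, Complex.exp_zero, one_mul] at h
    exact hankelIntegral_eq_of_le hθ hθ' h (differentiableOn_cexp_div hκ hbound 0) hc
  rw [hshift]
  refine tendsto_nhds_unique hsum ?_
  have h := (tendsto_const_nhds
    (x := hankelIntegral θ c (fun w => cexp (α * w) / (cexp (α * w) + x)))).sub hrem
  rw [sub_zero] at h
  exact h.congr fun N =>
    sub_eq_of_eq_add (hankelIntegral_cexp_div_eq_sum hκ hbound hθ hθ' hα c N)

/-- The one-term asymptotic expansion of the Mittag-Leffler function on the negative axis. -/
theorem exists_abs_mittagLeffler_neg_sub_le {α : ℝ} (hα : 0 < α) (hα2 : α < 2) :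
    ∃ C : ℝ, ∀ x : ℝ, 0 < x →
      |mittagLeffler α (-x) - (Real.Gamma (1 - α) * x)⁻¹| ≤ C * (x ^ 2)⁻¹ := by
  have hpi := Real.pi_pos
  obtain ⟨θ, hθ, hθ₂⟩ : ∃ θ, Real.pi / 2 < θ ∧ θ < min Real.pi (Real.pi / α) :=
    exists_between (lt_min (by linarith) (div_lt_div_of_pos_left hpi hα hα2))
  have hθ' : θ ≤ Real.pi := (hθ₂.trans_le (min_le_left _ _)).le
  have hαθ : α * θ < Real.pi := (lt_div_iff₀' hα).mp (hθ₂.trans_le (min_le_right _ _))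
  obtain ⟨κ, hκ, hb⟩ := exists_le_norm_cexp_add hα (by linarith) hαθ
  refine ⟨κ⁻¹ * hankelConst θ 0 (2 * α) / (2 * Real.pi), fun x hx => ?_⟩
  have hbound := fun w hw => (hb w hw x hx.le).1
  have hx' : (x : ℂ) ≠ 0 := by exact_mod_cast hx.ne'
  have hg₁ : HasExpGrowth θ 0 (fun w => (x : ℂ)⁻¹ * cexp (α * w)) x⁻¹ α :=
    ⟨by fun_prop, fun w _ => by simp [norm_exp, abs_of_pos hx]⟩
  have hg₂ : HasExpGrowth θ 0
      (fun w => (x : ℂ)⁻¹ * (cexp (α * w) * (cexp (α * w) / (cexp (α * w) + x))))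
      (κ⁻¹ * (x ^ 2)⁻¹) (2 * α) := by
    refine ⟨ContinuousOn.mul (by fun_prop) (ContinuousOn.mul (by fun_prop)
      (differentiableOn_cexp_div hκ hbound 0).continuousOn), fun w hw => ?_⟩
    have h4 := norm_pos_iff.mpr (cexp_add_ne_zero hκ hbound hw)
    have h5 := (hb w (abs_le.mpr hw.2) x hx.le).2
    have hn : ‖cexp (α * w)‖ = Real.exp (α * w.re) := by simp [norm_exp]
    have h6 : ‖cexp (α * w) + x‖⁻¹ ≤ (κ * x)⁻¹ := inv_anti₀ (by positivity) h5
    rw [norm_mul, norm_mul, norm_div, hn, norm_inv, norm_real, Real.norm_of_nonneg hx.le,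
      div_eq_mul_inv]
    calc _ ≤ x⁻¹ * (Real.exp (α * w.re) * (Real.exp (α * w.re) * (κ * x)⁻¹)) := by gcongr
      _ = κ⁻¹ * (x ^ 2)⁻¹ * (Real.exp (α * w.re) * Real.exp (α * w.re)) := by
        field_simp
      _ = _ := by rw [← Real.exp_add]; congr 2; ring
  have hsplit : hankelIntegral θ 0 (fun w => cexp (α * w) / (cexp (α * w) + x))
      = (x : ℂ)⁻¹ * hankelIntegral θ 0 (fun w => cexp (α * w))
        - hankelIntegral θ 0
          (fun w => (x : ℂ)⁻¹ * (cexp (α * w) * (cexp (α * w) / (cexp (α * w) + x)))) := by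
    rw [← hankelIntegral_const_mul, ← hankelIntegral_sub hθ hθ' hg₁ hg₂]
    refine hankelIntegral_congr (by linarith) fun w hw => ?_
    have hne := cexp_add_ne_zero hκ hbound hw
    field_simp
    ring
  have heq := mittagLeffler_neg_eq_hankelIntegral hκ hbound hθ hθ' hα hx.le
  rw [hsplit, hankelIntegral_cexp hθ hθ'] at heq
  have heq' : (2 * Real.pi * I : ℂ)
        * ((mittagLeffler α (-x) - (Real.Gamma (1 - α) * x)⁻¹ : ℝ) : ℂ)
      = -hankelIntegral θ 0
          (fun w => (x : ℂ)⁻¹ * (cexp (α * w) * (cexp (α * w) / (cexp (α * w) + x)))) := by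
    push_cast at heq ⊢
    rw [mul_inv]
    linear_combination heq
  have hnorm := congrArg norm heq'
  have h3 : ‖(2 * Real.pi * I : ℂ)‖ = 2 * Real.pi := by simp [abs_of_pos hpi]
  rw [norm_mul, h3, norm_real, Real.norm_eq_abs, norm_neg] at hnorm
  have hle := norm_hankelIntegral_le hθ hθ' hg₂
  rw [← hnorm] at hle
  rw [div_mul_eq_mul_div, le_div_iff₀' (by positivity)]
  linarith

theorem one_term_asymptotics
    (α : ℝ) (hα : α ∈ Set.Ioo (0 : ℝ) 2) (hα1 : α ≠ 1)
    (β : ℝ) (hβ : β ∈ Set.Ioo (0 : ℝ) 1)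
    (lam : ℕ → ℝ) (hmono : StrictMono lam) (hpos : ∀ k, 0 < lam k)
    (htend : Filter.Tendsto lam Filter.atTop Filter.atTop)
    (a : ℕ → ℝ) (hsum : Summable (fun k => |a k|)) :
    (fun t => (∑' k, a k * mittagLeffler α (-(lam k) ^ β * t ^ α))
        - (∑' k, a k * (lam k) ^ (-β)) / (Real.Gamma (1 - α) * t ^ α))
      =O[Filter.atTop] fun t => t ^ (-(2 * α)) := by
  obtain ⟨C, hC⟩ := exists_abs_mittagLeffler_neg_sub_le hα.1 hα.2
  have hC0 : 0 ≤ C := by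
    have := (abs_nonneg _).trans (hC 1 one_pos)
    simpa using this
  have hlam : ∀ k, (lam k) ^ (-β) ≤ (lam 0) ^ (-β) := fun k =>
    Real.rpow_le_rpow_of_nonpos (hpos 0) (hmono.monotone k.zero_le) (by linarith [hβ.1])
  have hs2 : Summable fun k => a k * (lam k) ^ (-β) := by
    refine Summable.of_norm_bounded (hsum.mul_right ((lam 0) ^ (-β))) fun k => ?_
    rw [norm_mul, Real.norm_eq_abs, Real.norm_of_nonneg (Real.rpow_nonneg (hpos k).le _)]
    exact mul_le_mul_of_nonneg_left (hlam k) (abs_nonneg _)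
  refine Asymptotics.IsBigO.of_bound ((∑' k, |a k|) * (C * ((lam 0) ^ (-β)) ^ 2)) ?_
  filter_upwards [eventually_gt_atTop 0] with t ht
  have htα : 0 < t ^ α := Real.rpow_pos_of_pos ht α
  have ht2 : t ^ (-(2 * α)) = ((t ^ α) ^ 2)⁻¹ := by
    rw [Real.rpow_neg ht.le, mul_comm, Real.rpow_mul ht.le, Real.rpow_two]
  have hterm : ∀ k, ‖a k * mittagLeffler α (-(lam k) ^ β * t ^ α)
      - a k * (lam k) ^ (-β) / (Real.Gamma (1 - α) * t ^ α)‖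
      ≤ |a k| * (C * ((lam 0) ^ (-β)) ^ 2 * t ^ (-(2 * α))) := by
    intro k
    have hl := Real.rpow_pos_of_pos (hpos k) β
    have h := hC ((lam k) ^ β * t ^ α) (by positivity)
    have hinv : (lam k) ^ (-β) = ((lam k) ^ β)⁻¹ := Real.rpow_neg (hpos k).le β
    have heq : a k * mittagLeffler α (-(lam k) ^ β * t ^ α)
        - a k * (lam k) ^ (-β) / (Real.Gamma (1 - α) * t ^ α)
        = a k * (mittagLeffler α (-((lam k) ^ β * t ^ α))
          - (Real.Gamma (1 - α) * ((lam k) ^ β * t ^ α))⁻¹) := by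
      rw [hinv, neg_mul, mul_sub, mul_left_comm (Real.Gamma _), mul_inv ((lam k) ^ β)]
      ring
    rw [heq, norm_mul, Real.norm_eq_abs, Real.norm_eq_abs, ht2]
    refine mul_le_mul_of_nonneg_left (h.trans ?_) (abs_nonneg _)
    rw [mul_pow, mul_inv, ← inv_pow ((lam k) ^ β), ← hinv, ← mul_assoc]
    have := Real.rpow_nonneg (hpos k).le (-β)
    have := hlam k
    gcongr C * ?_ ^ 2 * _
  have hs3 := hs2.div_const (Real.Gamma (1 - α) * t ^ α)
  have hbs := hsum.mul_right (C * ((lam 0) ^ (-β)) ^ 2 * t ^ (-(2 * α)))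
  have hs1 : Summable fun k => a k * mittagLeffler α (-(lam k) ^ β * t ^ α) := by
    simpa using (Summable.of_norm_bounded hbs hterm).add hs3
  rw [← tsum_div_const, ← hs1.tsum_sub hs3,
    Real.norm_of_nonneg (Real.rpow_nonneg ht.le (-(2 * α))), mul_assoc (∑' k, |a k|),
    ← tsum_mul_right]
  exact tsum_of_norm_bounded hbs.hasSum hterm
end
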